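/- Let ψ: ℕ → ℝ≥0 be a function satisfying ∑_{n=1}^∞ ψ(n)φ(n)/n = ∞, where φ denotes the Euler totient function. Then for Lebesgue-almost all α ∈ [0,1], the inequality |α − a/n| ≤ ψ(n)/n has infinitely many integer solutions (a,n) with gcd(a,n) = 1. -/

import Mathlib

namespace DS

lemma geom_aux (q c : ℝ) (hq : 0 ≤ q) (hc : q ≤ c*(1-q)) (hc0 : 0 ≤ c) (n : ℕ) :
    ∑ d ∈ Finset.range n, q^(d+1) ≤ c := by
  have h : ∑ d ∈ Finset.range n, q^(d+1) ≤ c - c*(q^n) := by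
    induction n with
    | zero => simp
    | succ n ih =>
      rw [Finset.sum_range_succ]
      have : 0 ≤ q^n := by positivity
      have h2 : q^(n+1) = q^n*q := pow_succ _ _
      rw [h2]
      nlinarith
  have : 0 ≤ q^n := by positivity
  nlinarith

lemma geom_sum (q c : ℝ) (hq : 0 ≤ q) (hc : q ≤ c*(1-q)) (hc0 : 0 ≤ c) (N i : ℕ) :
    ∑ j ∈ (Finset.range N).filter (fun j => j ≠ i), q^((i-j)+(j-i)) ≤ 2*c := by
  have h1 : (Finset.range N).filter (fun j => j ≠ i) ⊆
      (Finset.range i).image (fun d => i - (d+1)) ∪ (Finset.range N).image (fun d => i + (d+1)) := by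
    intro j hj
    simp only [Finset.mem_filter, Finset.mem_range, Finset.mem_union, Finset.mem_image] at *
    rcases lt_or_gt_of_ne hj.2 with h | h
    · left; exact ⟨i-j-1, by omega, by omega⟩
    · right; exact ⟨j-i-1, by omega, by omega⟩
  refine (Finset.sum_le_sum_of_subset_of_nonneg h1 (fun _ _ _ => by positivity)).trans ?_
  have hu : ∀ A B : Finset ℕ, ∑ j ∈ A ∪ B, q^((i-j)+(j-i)) ≤
      ∑ j ∈ A, q^((i-j)+(j-i)) + ∑ j ∈ B, q^((i-j)+(j-i)) := by
    intro A B
    rw [← Finset.sum_union_inter]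
    have h0 : 0 ≤ ∑ j ∈ A ∩ B, q^((i-j)+(j-i)) := Finset.sum_nonneg (fun _ _ => by positivity)
    linarith
  refine (hu _ _).trans ?_
  · rw [Finset.sum_image (by intro a ha b hb; simp at *; omega),
      Finset.sum_image (by intro a ha b hb; simp at *)]
    have e1 : ∑ d ∈ Finset.range i, q^((i-(i-(d+1)))+((i-(d+1))-i)) = ∑ d ∈ Finset.range i, q^(d+1) := by
      apply Finset.sum_congr rfl
      intro d hd
      simp at hd
      congr 1; omega
    have e2 : ∑ d ∈ Finset.range N, q^((i-(i+(d+1)))+((i+(d+1))-i)) = ∑ d ∈ Finset.range N, q^(d+1) := by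
      apply Finset.sum_congr rfl
      intro d hd
      congr 1; omega
    rw [e1, e2]
    linarith [geom_aux q c hq hc hc0 i, geom_aux q c hq hc hc0 N]

lemma schur (q c : ℝ) (hq : 0 ≤ q) (hc : q ≤ c*(1-q)) (hc0 : 0 ≤ c) (N : ℕ) (I : Finset ℕ) (hI : I ⊆ Finset.range N)
    (u w : ℕ → ℝ) :
    ∑ i ∈ I, ∑ j ∈ I.filter (fun j => j ≠ i), q^((i-j)+(j-i)) * (u i * w j) ≤
      c*(∑ i ∈ I, u i^2 + ∑ j ∈ I, w j^2) := by
  have key : ∀ i, ∑ j ∈ I.filter (fun j => j ≠ i), q^((i-j)+(j-i)) ≤ 2*c := fun i =>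
    (Finset.sum_le_sum_of_subset_of_nonneg (Finset.filter_subset_filter _ hI)
      (fun _ _ _ => by positivity)).trans (geom_sum q c hq hc hc0 N i)
  have h1 : ∑ i ∈ I, ∑ j ∈ I.filter (fun j => j ≠ i), q^((i-j)+(j-i)) * (u i * w j) ≤
      ∑ i ∈ I, ∑ j ∈ I.filter (fun j => j ≠ i), (q^((i-j)+(j-i)) * (u i^2/2) +
        q^((i-j)+(j-i)) * (w j^2/2)) := by
    gcongr with i _ j _
    rw [← mul_add]
    gcongr
    nlinarith [sq_nonneg (u i - w j)]
  have h2 : ∑ i ∈ I, ∑ j ∈ I.filter (fun j => j ≠ i), q^((i-j)+(j-i)) * (u i^2/2) ≤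
      ∑ i ∈ I, 2*c*(u i^2/2) := by
    gcongr with i _
    rw [← Finset.sum_mul]
    gcongr
    exact key i
  have h3 : ∑ i ∈ I, ∑ j ∈ I.filter (fun j => j ≠ i), q^((i-j)+(j-i)) * (w j^2/2) ≤
      ∑ j ∈ I, 2*c*(w j^2/2) := by
    simp_rw [Finset.sum_filter]
    rw [Finset.sum_comm]
    gcongr with j _
    rw [← Finset.sum_filter, ← Finset.sum_mul]
    gcongr
    refine le_trans (le_of_eq ?_) (key j)
    apply Finset.sum_congr
    · ext i; simp [ne_comm]
    · intro i _; congr 1; omega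
  simp_rw [Finset.sum_add_distrib] at h1
  rw [← Finset.mul_sum] at h2 h3
  rw [← Finset.sum_div] at h2 h3
  linarith [show 2*c*((∑ i ∈ I, u i^2)/2) = c*(∑ i ∈ I, u i^2) by ring,
    show 2*c*((∑ i ∈ I, w i^2)/2) = c*(∑ i ∈ I, w i^2) by ring,
    show c*(∑ i ∈ I, u i^2 + ∑ j ∈ I, w j^2) = c*(∑ i ∈ I, u i^2) + c*(∑ i ∈ I, w i^2) by ring]

lemma ax2 (z c : ℝ) (h : z^2 ≤ c^2) : z^6 ≤ c^2*z^4 := by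
  have h4 : 0 ≤ z^4 := by positivity
  nlinarith

lemma ax4 (x y : ℝ) : x^2*y^2 ≤ (x^4+y^4)/2 := by
  nlinarith [sq_nonneg (x^2-y^2)]

lemma ax6 (x y : ℝ) : x^3*y^3 ≤ (x^6+y^6)/2 := by
  nlinarith [sq_nonneg (x^3-y^3)]

lemma pow4a (z w : ℝ) (h : 1 - 4*w ≤ z) : 1 - 16*w ≤ z^4 := by
  have h1 : 1 - 8*w ≤ z^2 := by nlinarith [sq_nonneg (z-1)]
  nlinarith [sq_nonneg (z^2-1)]

set_option maxHeartbeats 1000000 in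
lemma single_core (H q : ℝ) (hH : 1 ≤ H) (hq : 0 < q) (hq2 : 1024*H^3*q ≤ 1) (N : ℕ)
    (x y : ℕ → ℝ) (hx0 : ∀ i, 0 ≤ x i) (hy0 : ∀ i, 0 ≤ y i)
    (hx : ∑ i ∈ Finset.range N, x i^4 = 1) (hy : ∑ i ∈ Finset.range N, y i^4 = 1)
    (G : ℕ → ℕ → ℝ)
    (hGd : ∀ i, G i i ≤ x i^3*y i^3)
    (hG : ∀ i j, i ≠ j → G i j ≤ H*(q^((i-j)+(j-i))*(x i^3*y j^3)))
    (hsum : 1 ≤ ∑ i ∈ Finset.range N, ∑ j ∈ Finset.range N, G i j) :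
    ∃ k, ∑ i ∈ Finset.range N, ∑ j ∈ (Finset.range N).filter (fun j => j ≠ i), G i j
        ≤ 3*H*(32*H)^6 * q^4 ∧
      ∑ i ∈ (Finset.range N).filter (fun i => i ≠ k),
        ∑ j ∈ (Finset.range N).filter (fun j => j ≠ k), G i j ≤ 3*H*(32*H)^6 * q^6 := by
  have hH3 : 1 ≤ H^3 := one_le_pow₀ hH
  have hHle : H ≤ H^3 := by nlinarith [sq_nonneg H, mul_nonneg (by linarith : (0:ℝ) ≤ H) (by nlinarith : 0 ≤ H^2-1)]
  have hHq : 1024*(H*q) ≤ 1 := by nlinarith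
  have hqs : q ≤ 1/1024 := by nlinarith
  have hc2 : q ≤ 2*q*(1-q) := by nlinarith
  set R := Finset.range N with hR
  -- generic split
  have split : ∀ I : Finset ℕ, I ⊆ R → ∑ i ∈ I, ∑ j ∈ I, G i j = ∑ i ∈ I, G i i +
      ∑ i ∈ I, ∑ j ∈ I.filter (fun j => j ≠ i), G i j := by
    intro I _
    rw [← Finset.sum_add_distrib]
    apply Finset.sum_congr rfl
    intro i hi
    rw [← Finset.sum_filter_add_sum_filter_not I (fun j => j = i)]
    congr 1
    rw [Finset.filter_eq']; simp [hi]
  have offb : ∀ I : Finset ℕ, I ⊆ R → ∑ i ∈ I, ∑ j ∈ I.filter (fun j => j ≠ i), G i j ≤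
      H*(2*q*(∑ i ∈ I, x i^6 + ∑ i ∈ I, y i^6)) := by
    intro I hI
    have := schur q (2*q) hq.le hc2 (by linarith) N I hI (fun i => x i^3) (fun i => y i^3)
    calc _ ≤ ∑ i ∈ I, ∑ j ∈ I.filter (fun j => j ≠ i), H*(q^((i-j)+(j-i))*(x i^3*y j^3)) := by
          gcongr with i _ j hj
          exact hG i j (by simp at hj; exact fun h => hj.2 h.symm)
      _ = H * ∑ i ∈ I, ∑ j ∈ I.filter (fun j => j ≠ i), (q^((i-j)+(j-i))*(x i^3*y j^3)) := by
          simp_rw [Finset.mul_sum]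
      _ ≤ _ := by
          gcongr
          refine this.trans (le_of_eq ?_)
          simp_rw [← pow_mul]
  have le1 : ∀ z : ℕ → ℝ, (∀ i, 0 ≤ z i) → ∀ I : Finset ℕ, ∀ c, 0 ≤ c → (∑ i ∈ I, z i^4 = c^4) →
      (∀ i ∈ I, z i ≤ c) ∧ ∑ i ∈ I, z i^6 ≤ c^6 := by
    intro z hz I c hc hs
    have a : ∀ i ∈ I, z i ≤ c := by
      intro i hi
      have : z i^4 ≤ c^4 := hs ▸ Finset.single_le_sum (f := fun i => z i^4) (fun _ _ => by positivity) hi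
      exact le_of_pow_le_pow_left₀ (by norm_num) hc this
    refine ⟨a, ?_⟩
    calc ∑ i ∈ I, z i^6 ≤ ∑ i ∈ I, c^2*z i^4 := by
          apply Finset.sum_le_sum
          intro i hi
          have := pow_le_pow_left₀ (hz i) (a i hi) 2
          have h4 : 0 ≤ z i^4 := by positivity
          exact ax2 _ _ this
      _ = c^6 := by rw [← Finset.mul_sum, hs]; ring
  obtain ⟨hx1, hx6⟩ := le1 x hx0 R 1 zero_le_one (by simpa using hx)
  obtain ⟨hy1, hy6⟩ := le1 y hy0 R 1 zero_le_one (by simpa using hy)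
  have hoff := offb R subset_rfl
  have hsp := split R subset_rfl
  have hdiag : ∑ i ∈ R, G i i ≤ ∑ i ∈ R, x i^3*y i^3 := Finset.sum_le_sum (fun i _ => hGd i)
  have hdge : 1 - 4*(H*q) ≤ ∑ i ∈ R, x i^3*y i^3 := by
    have : H*(2*q*(∑ i ∈ R, x i^6 + ∑ i ∈ R, y i^6)) ≤ H*(2*q*(1+1)) := by
      gcongr
      · simpa using hx6
      · simpa using hy6
    linarith
  obtain ⟨k, hkR, hk⟩ : ∃ k ∈ R, 1 - 4*(H*q) ≤ x k*y k := by
    by_contra! hcon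
    have hxy : ∑ i ∈ R, x i^2*y i^2 ≤ 1 := by
      calc _ ≤ ∑ i ∈ R, (x i^4+y i^4)/2 := by
            gcongr with i _
            exact ax4 _ _
        _ = 1 := by rw [← Finset.sum_div, Finset.sum_add_distrib, hx, hy]; norm_num
    have hne : ∃ i ∈ R, 0 < x i^3*y i^3 := by
      by_contra! h
      have : ∑ i ∈ R, x i^3*y i^3 ≤ 0 := Finset.sum_nonpos h
      linarith
    have : ∑ i ∈ R, x i^3*y i^3 < ∑ i ∈ R, (1-4*(H*q))*(x i^2*y i^2) := by
      obtain ⟨i0, hi0, hp⟩ := hne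
      apply Finset.sum_lt_sum
      · intro i hi
        have := hcon i hi
        have h2 : 0 ≤ x i^2*y i^2 := by positivity
        calc x i^3*y i^3 = (x i*y i)*(x i^2*y i^2) := by ring
          _ ≤ _ := mul_le_mul_of_nonneg_right this.le h2
      · refine ⟨i0, hi0, ?_⟩
        have := hcon i0 hi0
        have h2 : 0 < x i0^2*y i0^2 := by
          have a := hx0 i0
          have b := hy0 i0
          rcases a.eq_or_lt with a | a
          · rw [← a] at hp; simp at hp
          rcases b.eq_or_lt with b | b
          · rw [← b] at hp; simp at hp
          positivity
        calc x i0^3*y i0^3 = (x i0*y i0)*(x i0^2*y i0^2) := by ring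
          _ < _ := mul_lt_mul_of_pos_right this h2
    rw [← Finset.mul_sum] at this
    have := this.trans_le (mul_le_of_le_one_right (by linarith) hxy)
    linarith
  set I := R.filter (fun i => i ≠ k) with hI
  have hIR : I ⊆ R := Finset.filter_subset _ _
  have sumk : ∀ f : ℕ → ℝ, ∑ i ∈ R, f i = f k + ∑ i ∈ I, f i := by
    intro f
    rw [← Finset.sum_filter_add_sum_filter_not R (fun j => j = k)]
    congr 1
    rw [Finset.filter_eq']; simp [hkR]
  have hxk := hx1 k hkR
  have hyk := hy1 k hkR
  have hx0k := hx0 k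
  have hy0k := hy0 k
  have root : ∀ X : ℝ, 0 ≤ X → ∃ c, 0 ≤ c ∧ X = c^4 := fun X hX =>
    ⟨√(√X), by positivity, by
      rw [show (4:ℕ) = 2*2 by norm_num, pow_mul, Real.sq_sqrt (by positivity), Real.sq_sqrt hX]⟩
  obtain ⟨a, ha0, ha⟩ := root (∑ i ∈ I, x i^4) (Finset.sum_nonneg fun i _ => by positivity)
  obtain ⟨b, hb0, hb⟩ := root (∑ i ∈ I, y i^4) (Finset.sum_nonneg fun i _ => by positivity)
  obtain ⟨hxa, hxa6⟩ := le1 x hx0 I a ha0 ha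
  obtain ⟨hyb, hyb6⟩ := le1 y hy0 I b hb0 hb
  have hsx := sumk (fun i => x i^4)
  have hsy := sumk (fun i => y i^4)
  rw [hx, ha] at hsx
  rw [hy, hb] at hsy
  -- smallness
  have pow4 : ∀ z : ℝ, 0 ≤ z → 1 - 4*(H*q) ≤ z → 1 - 16*(H*q) ≤ z^4 := by
    exact fun z _ h => pow4a _ _ h
  have ha4 : a^4 ≤ 16*(H*q) := by
    have := pow4 (x k) hx0k (hk.trans (mul_le_of_le_one_right hx0k hyk))
    linarith
  have hb4 : b^4 ≤ 16*(H*q) := by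
    have := pow4 (y k) hy0k (hk.trans (mul_le_of_le_one_left hy0k hxk))
    linarith
  -- bounds for I x I
  have hII : ∑ i ∈ I, ∑ j ∈ I, G i j ≤ H*(a^6+b^6) := by
    rw [split I hIR]
    have h1 := offb I hIR
    have h2 : ∑ i ∈ I, G i i ≤ (a^6+b^6)/2 := by
      calc _ ≤ ∑ i ∈ I, (x i^6+y i^6)/2 := by
            apply Finset.sum_le_sum
            intro i _
            refine (hGd i).trans ?_
            exact ax6 _ _
        _ ≤ _ := by rw [← Finset.sum_div, Finset.sum_add_distrib]; linarith
    have h3 : H*(2*q*(∑ i ∈ I, x i^6 + ∑ i ∈ I, y i^6)) ≤ H*(2*q*(a^6+b^6)) := by gcongr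
    have h4 : 0 ≤ a^6+b^6 := by positivity
    have h5 : 0 ≤ (a^6+b^6)*(H-1) := mul_nonneg h4 (by linarith)
    have h6 : 0 ≤ (a^6+b^6)*(1-1024*(H*q)) := mul_nonneg h4 (by linarith)
    linarith
  have hrow : ∑ j ∈ I, G k j ≤ 4*(H*q)*b^3 := by
    calc _ ≤ ∑ j ∈ I, H*(q^((k-j)+(j-k))*b^3) := by
          apply Finset.sum_le_sum
          intro j hj
          have hj' := hj
          simp only [hI, Finset.mem_filter] at hj'
          refine (hG k j (fun h => hj'.2 h.symm)).trans ?_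
          have h1 : x k^3 ≤ 1 := pow_le_one₀ hx0k hxk
          have h2 : y j^3 ≤ b^3 := pow_le_pow_left₀ (hy0 j) (hyb j hj) 3
          have h3 : 0 ≤ y j^3 := pow_nonneg (hy0 j) 3
          gcongr
          exact (mul_le_of_le_one_left h3 h1).trans h2
      _ = H*(b^3*∑ j ∈ I, q^((k-j)+(j-k))) := by
          rw [Finset.mul_sum, Finset.mul_sum]
          exact Finset.sum_congr rfl fun _ _ => by ring
      _ ≤ H*(b^3*(4*q)) := by
          gcongr
          exact (geom_sum q (2*q) hq.le hc2 (by linarith) N k).trans (by linarith)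
      _ = _ := by ring
  have hcol : ∑ i ∈ I, G i k ≤ 4*(H*q)*a^3 := by
    calc _ ≤ ∑ j ∈ I, H*(q^((k-j)+(j-k))*a^3) := by
          apply Finset.sum_le_sum
          intro j hj
          have hj' := hj
          simp only [hI, Finset.mem_filter] at hj'
          refine (hG j k hj'.2).trans ?_
          have h1 : y k^3 ≤ 1 := pow_le_one₀ hy0k hyk
          have h2 : x j^3 ≤ a^3 := pow_le_pow_left₀ (hx0 j) (hxa j hj) 3
          have h3 : 0 ≤ x j^3 := pow_nonneg (hx0 j) 3
          rw [add_comm (j-k)]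
          gcongr
          exact (mul_le_of_le_one_right h3 h1).trans h2
      _ = H*(a^3*∑ j ∈ I, q^((k-j)+(j-k))) := by
          rw [Finset.mul_sum, Finset.mul_sum]
          exact Finset.sum_congr rfl fun _ _ => by ring
      _ ≤ H*(a^3*(4*q)) := by
          gcongr
          exact (geom_sum q (2*q) hq.le hc2 (by linarith) N k).trans (by linarith)
      _ = _ := by ring
  have htot : ∑ i ∈ R, ∑ j ∈ R, G i j = G k k + ∑ j ∈ I, G k j + (∑ i ∈ I, G i k + ∑ i ∈ I, ∑ j ∈ I, G i j) := by
    rw [sumk (fun i => ∑ j ∈ R, G i j), sumk (fun j => G k j)]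
    congr 1
    rw [← Finset.sum_add_distrib]
    exact Finset.sum_congr rfl fun i _ => sumk _
  have hkk : G k k ≤ 1 - (a^4+b^4)/2 := by
    refine (hGd k).trans ?_
    have h1 : x k*y k ≤ 1 := mul_le_one₀ hxk hy0k hyk
    have h2 : 0 ≤ x k*y k := by positivity
    have h3 : (x k*y k)^3 ≤ (x k*y k)^2 := pow_le_pow_of_le_one h2 h1 (by norm_num)
    have h4 := ax4 (x k) (y k)
    rw [mul_pow, mul_pow] at h3
    linarith
  have hmain : (a^4+b^4)/2 ≤ 4*(H*q)*(a^3+b^3) + H*(a^6+b^6) := by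
    rw [htot] at hsum; linarith
  -- max
  obtain ⟨τ, hτ0, haτ, hbτ, hτ4, hτle⟩ : ∃ τ, 0 ≤ τ ∧ a ≤ τ ∧ b ≤ τ ∧ τ^4 ≤ 16*(H*q) ∧ τ^4 ≤ a^4+b^4 := by
    rcases le_total a b with h | h
    · exact ⟨b, hb0, h, le_rfl, hb4, by linarith [pow_nonneg ha0 4]⟩
    · exact ⟨a, ha0, le_rfl, h, ha4, by linarith [pow_nonneg hb0 4]⟩
  have hτ : τ ≤ 32*(H*q) := by
    by_contra! hc
    have hτp : 0 < τ := lt_of_le_of_lt (by positivity) hc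
    have a3 := pow_le_pow_left₀ ha0 haτ 3
    have b3 := pow_le_pow_left₀ hb0 hbτ 3
    have a6 := pow_le_pow_left₀ ha0 haτ 6
    have b6 := pow_le_pow_left₀ hb0 hbτ 6
    have h1 : τ^4/2 ≤ 4*(H*q)*(τ^3+τ^3)+H*(τ^6+τ^6) := by
      calc τ^4/2 ≤ (a^4+b^4)/2 := by linarith
        _ ≤ _ := hmain
        _ ≤ _ := by gcongr
    have h2 : 8*(H*τ^2) ≤ 1 := by
      have : (8*(H*τ^2))^2 ≤ 1^2 := by
        have : (8*(H*τ^2))^2 = 64*H^2*τ^4 := by ring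
        rw [this]
        have : 64*H^2*τ^4 ≤ 64*H^2*(16*(H*q)) := by gcongr
        linarith [show 64*H^2*(16*(H*q)) = 1024*H^3*q by ring]
      exact le_of_pow_le_pow_left₀ (by norm_num) (by norm_num) this
    have h3 : 0 < τ^3 := by positivity
    have h4 : τ^3*(τ/2) ≤ τ^3*(8*(H*q) + 2*(H*τ^2)*τ) := by
      linarith [show τ^3*(8*(H*q) + 2*(H*τ^2)*τ) = 4*(H*q)*(τ^3+τ^3)+H*(τ^6+τ^6) by ring,
        show τ^3*(τ/2) = τ^4/2 by ring]
    have h5 := le_of_mul_le_mul_left h4 h3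
    have h6 : 0 ≤ τ*(1-8*(H*τ^2)) := mul_nonneg hτ0 (by linarith)
    linarith
  have hτ3 := pow_le_pow_left₀ hτ0 hτ 3
  have hτ6 := pow_le_pow_left₀ hτ0 hτ 6
  have a3 := (pow_le_pow_left₀ ha0 haτ 3).trans hτ3
  have b3 := (pow_le_pow_left₀ hb0 hbτ 3).trans hτ3
  have a6 := (pow_le_pow_left₀ ha0 haτ 6).trans hτ6
  have b6 := (pow_le_pow_left₀ hb0 hbτ 6).trans hτ6
  have hII2 : H*(a^6+b^6) ≤ 2*H*(32*H)^6*q^6 := by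
    have : H*(a^6+b^6) ≤ H*((32*(H*q))^6+(32*(H*q))^6) := by gcongr
    refine this.trans (le_of_eq (by ring))
  refine ⟨k, ?_, ?_⟩
  · -- off-diagonal
    have hoffI : ∑ i ∈ R, ∑ j ∈ R.filter (fun j => j ≠ i), G i j =
        ∑ j ∈ I, G k j + ∑ i ∈ I, G i k + ∑ i ∈ I, ∑ j ∈ I.filter (fun j => j ≠ i), G i j := by
      have e1 := split R subset_rfl
      have e2 := split I hIR
      have e3 := sumk (fun i => G i i)
      linarith
    rw [hoffI]
    have h1 := offb I hIR
    have h3 : H*(2*q*(∑ i ∈ I, x i^6 + ∑ i ∈ I, y i^6)) ≤ H*(2*q*(a^6+b^6)) := by gcongr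
    have h4 : H*(2*q*(a^6+b^6)) ≤ H*(a^6+b^6) := by
      gcongr
      have : 0 ≤ a^6+b^6 := by positivity
      have h7 : 0 ≤ (1-2*q)*(a^6+b^6) := mul_nonneg (by linarith) this
      linarith
    have h5 : 4*(H*q)*b^3 + 4*(H*q)*a^3 ≤ 8*H*(32*H)^3*q^4 := by
      calc _ ≤ 4*(H*q)*(32*(H*q))^3 + 4*(H*q)*(32*(H*q))^3 := by gcongr
        _ = _ := by ring
    have h6 : 2*H*(32*H)^6*q^6 ≤ 2*H*(32*H)^6*q^4 := by
      gcongr 2*H*(32*H)^6*?_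
      exact pow_le_pow_of_le_one hq.le (by linarith) (by norm_num)
    have h7 : 8*H*(32*H)^3*q^4 ≤ H*(32*H)^6*q^4 := by
      have : (8:ℝ) ≤ (32*H)^3 := by
        rw [mul_pow]; linarith
      calc 8*H*(32*H)^3*q^4 ≤ (32*H)^3*H*(32*H)^3*q^4 := by gcongr
        _ = _ := by ring
    linarith
  · refine hII.trans (hII2.trans ?_)
    gcongr
    norm_num

noncomputable def rt (x : ℝ) : ℝ := √(√x)

lemma rt_nonneg (x : ℝ) : 0 ≤ rt x := Real.sqrt_nonneg _

lemma rt_pow (x : ℝ) (hx : 0 ≤ x) : rt x^4 = x := by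
  unfold rt
  rw [show (4:ℕ) = 2*2 by norm_num, pow_mul, Real.sq_sqrt (by positivity), Real.sq_sqrt hx]

lemma rt_mul (x y : ℝ) (hx : 0 ≤ x) : rt (x*y) = rt x*rt y := by
  unfold rt
  rw [Real.sqrt_mul hx, Real.sqrt_mul (by positivity)]

lemma rt_mono {x y : ℝ} (h : x ≤ y) : rt x ≤ rt y := Real.sqrt_le_sqrt (Real.sqrt_le_sqrt h)

lemma rt_pos {x : ℝ} (h : 0 < x) : 0 < rt x := by unfold rt; positivity

/-- crude bound for small primes -/
lemma crude (H q A : ℝ) (hH : 1 ≤ H) (hA : 0 ≤ A) (hq : 0 < q) (hq2 : q ≤ 85/100) (N : ℕ)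
    (x y : ℕ → ℝ) (hx0 : ∀ i, 0 ≤ x i) (hy0 : ∀ i, 0 ≤ y i) (G : ℕ → ℕ → ℝ)
    (hG : ∀ i j, G i j ≤ A*(H*(q^((i-j)+(j-i))*(rt (x i)*rt (y j))^3))) :
    ∑ i ∈ Finset.range N, ∑ j ∈ Finset.range N, G i j ≤
      A*(13*H)*(rt (∑ i ∈ Finset.range N, x i)*rt (∑ i ∈ Finset.range N, y i))^3 := by
  set R := Finset.range N
  have sq6 : ∀ x : ℕ → ℝ, (∀ i, 0 ≤ x i) → ∑ i ∈ R, (rt (x i)^3)^2 ≤ (rt (∑ i ∈ R, x i)^3)^2 := by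
    intro x hx0
    set m := ∑ i ∈ R, x i with hm
    have hm0 : 0 ≤ m := Finset.sum_nonneg fun i _ => hx0 i
    calc ∑ i ∈ R, (rt (x i)^3)^2 ≤ ∑ i ∈ R, rt m^2*x i := by
          apply Finset.sum_le_sum
          intro i hi
          have h1 : rt (x i) ≤ rt m := rt_mono (Finset.single_le_sum (fun i _ => hx0 i) hi)
          have h2 := pow_le_pow_left₀ (rt_nonneg _) h1 2
          calc (rt (x i)^3)^2 = rt (x i)^2*rt (x i)^4 := by ring
            _ ≤ rt m^2*rt (x i)^4 := by gcongr
            _ = _ := by rw [rt_pow _ (hx0 i)]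
      _ = rt m^2*m := by rw [← Finset.mul_sum]
      _ = rt m^2*rt m^4 := by rw [rt_pow _ hm0]
      _ = _ := by ring
  set m := ∑ i ∈ R, x i with hm
  set n := ∑ i ∈ R, y i with hn
  have hm0 : 0 ≤ m := Finset.sum_nonneg fun i _ => hx0 i
  have hn0 : 0 ≤ n := Finset.sum_nonneg fun i _ => hy0 i
  rcases hm0.eq_or_lt with hm1 | hm1
  · have hz : ∀ i ∈ R, x i = 0 := (Finset.sum_eq_zero_iff_of_nonneg (fun i _ => hx0 i)).1 hm1.symm
    refine (Finset.sum_nonpos fun i hi => Finset.sum_nonpos fun j hj => ?_).trans (by have := rt_nonneg m; have := rt_nonneg n; positivity)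
    refine (hG i j).trans (le_of_eq ?_)
    rw [hz i hi]; simp [rt]
  rcases hn0.eq_or_lt with hn1 | hn1
  · have hz : ∀ i ∈ R, y i = 0 := (Finset.sum_eq_zero_iff_of_nonneg (fun i _ => hy0 i)).1 hn1.symm
    refine (Finset.sum_nonpos fun i hi => Finset.sum_nonpos fun j hj => ?_).trans (by have := rt_nonneg m; have := rt_nonneg n; positivity)
    refine (hG i j).trans (le_of_eq ?_)
    rw [hz j hj]; simp [rt]
  have hrm := rt_pos hm1
  have hrn := rt_pos hn1
  set u : ℕ → ℝ := fun i => rt (x i)^3/rt m^3 with hu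
  set w : ℕ → ℝ := fun i => rt (y i)^3/rt n^3 with hw
  have hu2 : ∑ i ∈ R, u i^2 ≤ 1 := by
    simp only [hu, div_pow]
    rw [← Finset.sum_div]
    rw [div_le_one (by positivity)]
    exact (sq6 x hx0).trans (le_of_eq (by ring))
  have hw2 : ∑ i ∈ R, w i^2 ≤ 1 := by
    simp only [hw, div_pow]
    rw [← Finset.sum_div]
    rw [div_le_one (by positivity)]
    exact (sq6 y hy0).trans (le_of_eq (by ring))
  have hs := schur q 6 hq.le (by linarith) (by norm_num) N R subset_rfl u w
  have hd : ∑ i ∈ R, u i*w i ≤ 1 := by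
    have : ∑ i ∈ R, u i*w i ≤ ∑ i ∈ R, (u i^2/2+w i^2/2) := by
      gcongr with i
      nlinarith [sq_nonneg (u i - w i)]
    rw [Finset.sum_add_distrib, ← Finset.sum_div, ← Finset.sum_div] at this
    linarith
  have hall : ∑ i ∈ R, ∑ j ∈ R, q^((i-j)+(j-i))*(u i*w j) ≤ 13 := by
    have : ∑ i ∈ R, ∑ j ∈ R, q^((i-j)+(j-i))*(u i*w j) = ∑ i ∈ R, u i*w i +
        ∑ i ∈ R, ∑ j ∈ R.filter (fun j => j ≠ i), q^((i-j)+(j-i)) * (u i * w j) := by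
      rw [← Finset.sum_add_distrib]
      apply Finset.sum_congr rfl
      intro i hi
      rw [← Finset.sum_filter_add_sum_filter_not R (fun j => j = i)]
      congr 1
      rw [Finset.filter_eq']; simp [hi]
    linarith
  calc _ ≤ ∑ i ∈ R, ∑ j ∈ R, A*H*(rt m*rt n)^3*(q^((i-j)+(j-i))*(u i*w j)) := by
        apply Finset.sum_le_sum; intro i _
        apply Finset.sum_le_sum; intro j _
        refine (hG i j).trans (le_of_eq ?_)
        simp only [hu, hw]
        field_simp
    _ = A*H*(rt m*rt n)^3*∑ i ∈ R, ∑ j ∈ R, (q^((i-j)+(j-i))*(u i*w j)) := by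
        simp_rw [Finset.mul_sum]
    _ ≤ A*H*(rt m*rt n)^3*13 := by gcongr
    _ = _ := by ring

lemma single (H q A : ℝ) (hH : 1 ≤ H) (hA : 0 < A) (hq : 0 < q) (hq2 : 1024*H^3*q ≤ 1) (N : ℕ)
    (x y : ℕ → ℝ) (hx0 : ∀ i, 0 ≤ x i) (hy0 : ∀ i, 0 ≤ y i) (G : ℕ → ℕ → ℝ)
    (hGd : ∀ i, G i i ≤ A*(rt (x i)*rt (y i))^3)
    (hG : ∀ i j, i ≠ j → G i j ≤ A*(H*(q^((i-j)+(j-i))*(rt (x i)*rt (y j))^3)))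
    (hsum : A*(rt (∑ i ∈ Finset.range N, x i)*rt (∑ i ∈ Finset.range N, y i))^3 <
      ∑ i ∈ Finset.range N, ∑ j ∈ Finset.range N, G i j) :
    ∃ k, ∑ i ∈ Finset.range N, ∑ j ∈ (Finset.range N).filter (fun j => j ≠ i), G i j
        ≤ 3*H*(32*H)^6 * q^4 * ∑ i ∈ Finset.range N, ∑ j ∈ Finset.range N, G i j ∧
      ∑ i ∈ (Finset.range N).filter (fun i => i ≠ k),
        ∑ j ∈ (Finset.range N).filter (fun j => j ≠ k), G i j ≤ 3*H*(32*H)^6 * q^6 *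
        ∑ i ∈ Finset.range N, ∑ j ∈ Finset.range N, G i j := by
  set R := Finset.range N with hR
  set m := ∑ i ∈ R, x i with hm
  set n := ∑ i ∈ R, y i with hn
  have hm0 : 0 ≤ m := Finset.sum_nonneg fun i _ => hx0 i
  have hn0 : 0 ≤ n := Finset.sum_nonneg fun i _ => hy0 i
  have hGall : ∀ i j, rt (x i)*rt (y j) = 0 → G i j ≤ 0 := by
    intro i j h
    by_cases hij : i = j
    · subst hij
      refine (hGd i).trans (le_of_eq ?_)
      rw [h]; ring
    · refine (hG i j hij).trans (le_of_eq ?_)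
      rw [h]; ring
  rcases hm0.eq_or_lt with hm1 | hm1
  · have hz : ∀ i ∈ R, x i = 0 := (Finset.sum_eq_zero_iff_of_nonneg (fun i _ => hx0 i)).1 hm1.symm
    exfalso
    have : ∑ i ∈ R, ∑ j ∈ R, G i j ≤ 0 := (Finset.sum_nonpos fun i hi => Finset.sum_nonpos fun j hj =>
      hGall i j (by rw [hz i hi]; simp [rt]))
    rw [← hm1] at hsum
    simp [rt] at hsum
    linarith
  rcases hn0.eq_or_lt with hn1 | hn1
  · have hz : ∀ i ∈ R, y i = 0 := (Finset.sum_eq_zero_iff_of_nonneg (fun i _ => hy0 i)).1 hn1.symm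
    exfalso
    have : ∑ i ∈ R, ∑ j ∈ R, G i j ≤ 0 := (Finset.sum_nonpos fun i hi => Finset.sum_nonpos fun j hj =>
      hGall i j (by rw [hz j hj]; simp [rt]))
    rw [← hn1] at hsum
    simp [rt] at hsum
    linarith
  have hrm := rt_pos hm1
  have hrn := rt_pos hn1
  set Z := A*(rt m*rt n)^3 with hZ
  have hZp : 0 < Z := by positivity
  obtain ⟨k, h1, h2⟩ := single_core H q hH hq hq2 N (fun i => rt (x i)/rt m) (fun i => rt (y i)/rt n)
    (fun i => div_nonneg (rt_nonneg _) hrm.le) (fun i => div_nonneg (rt_nonneg _) hrn.le)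
    (by
      simp_rw [div_pow, rt_pow _ (hx0 _), rt_pow _ hm0]
      rw [← Finset.sum_div, ← hR, ← hm, div_self hm1.ne'])
    (by
      simp_rw [div_pow, rt_pow _ (hy0 _), rt_pow _ hn0]
      rw [← Finset.sum_div, ← hR, ← hn, div_self hn1.ne'])
    (fun i j => G i j/Z)
    (by
      intro i
      rw [div_le_iff₀ hZp]
      refine (hGd i).trans (le_of_eq ?_)
      rw [hZ]; field_simp)
    (by
      intro i j hij
      rw [div_le_iff₀ hZp]
      refine (hG i j hij).trans (le_of_eq ?_)
      rw [hZ]; field_simp)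
    (by
      simp_rw [← Finset.sum_div]
      rw [le_div_iff₀ hZp, one_mul]
      exact hsum.le)
  refine ⟨k, ?_, ?_⟩
  · simp_rw [← Finset.sum_div] at h1
    rw [div_le_iff₀ hZp] at h1
    refine h1.trans ?_
    gcongr
  · simp_rw [← Finset.sum_div] at h2
    rw [div_le_iff₀ hZp] at h2
    refine h2.trans ?_
    gcongr

end DS


namespace DS

noncomputable section

def aP (P : Finset ℕ) (e : ℕ → ℕ → ℕ) (v w : ℕ) : ℝ := ∏ p ∈ P, (p:ℝ)^(e v p - e w p)
def rho (P : Finset ℕ) (e : ℕ → ℕ → ℕ) (v : ℕ) : ℝ := ∏ p ∈ P, if e v p = 0 then 1 else (1-1/(p:ℝ))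
def hwt (P : Finset ℕ) (h : ℕ → ℝ) (e : ℕ → ℕ → ℕ) (v w : ℕ) : ℝ :=
  ∏ p ∈ P, if e v p = e w p then 1 else h p
def edge (P : Finset ℕ) (e : ℕ → ℕ → ℕ) (ψ θ : ℕ → ℝ) (v w : ℕ) : Prop :=
  ψ v * aP P e w v ≤ 1 ∧ θ w * aP P e v w ≤ 1
def tm (P : Finset ℕ) (e : ℕ → ℕ → ℕ) (h : ℕ → ℝ) (ψ θ : ℕ → ℝ) (v w : ℕ) : ℝ :=
  open Classical in
  if edge P e ψ θ v w then ψ v * rho P e v * (θ w * rho P e w) * hwt P h e v w else 0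
def mass (P : Finset ℕ) (e : ℕ → ℕ → ℕ) (ψ : ℕ → ℝ) (V : Finset ℕ) : ℝ := ∑ v ∈ V, ψ v * rho P e v
def Inj (P : Finset ℕ) (e : ℕ → ℕ → ℕ) (V : Finset ℕ) : Prop :=
  ∀ v ∈ V, ∀ v' ∈ V, (∀ p ∈ P, e v p = e v' p) → v = v'
def Bd (P : Finset ℕ) (e : ℕ → ℕ → ℕ) (h : ℕ → ℝ) (C : ℝ) : Prop :=
  ∀ (V W : Finset ℕ) (ψ θ : ℕ → ℝ), (∀ v, 0 ≤ ψ v) → (∀ v, 0 ≤ θ v) → Inj P e V → Inj P e W →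
    ∑ v ∈ V, ∑ w ∈ W, tm P e h ψ θ v w ≤ C*(rt (mass P e ψ V)*rt (mass P e θ W))^3

end

lemma fib (e : ℕ → ℕ → ℕ) (p N : ℕ) (V W : Finset ℕ) (hV : ∀ v ∈ V, e v p < N)
    (hW : ∀ v ∈ W, e v p < N) (T : ℕ → ℕ → ℝ) :
    ∑ i ∈ Finset.range N, ∑ j ∈ Finset.range N, ∑ v ∈ V.filter (fun v => e v p = i),
      ∑ w ∈ W.filter (fun w => e w p = j), T v w = ∑ v ∈ V, ∑ w ∈ W, T v w := by
  have h1 : ∀ v, ∑ j ∈ Finset.range N, ∑ w ∈ W.filter (fun w => e w p = j), T v w = ∑ w ∈ W, T v w :=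
    fun v => Finset.sum_fiberwise_of_maps_to (fun w hw => Finset.mem_range.2 (hW w hw)) _
  rw [← Finset.sum_fiberwise_of_maps_to (s := V) (g := fun v => e v p)
    (fun w hw => Finset.mem_range.2 (hV w hw))]
  apply Finset.sum_congr rfl
  intro i _
  rw [Finset.sum_comm]
  exact Finset.sum_congr rfl fun v _ => h1 v

lemma fib_pred (e : ℕ → ℕ → ℕ) (p N : ℕ) (V W : Finset ℕ) (hV : ∀ v ∈ V, e v p < N)
    (hW : ∀ v ∈ W, e v p < N) (T : ℕ → ℕ → ℝ) (Q : ℕ → ℕ → Prop) [∀ i j, Decidable (Q i j)] :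
    ∑ i ∈ Finset.range N, ∑ j ∈ Finset.range N, (if Q i j then ∑ v ∈ V.filter (fun v => e v p = i),
      ∑ w ∈ W.filter (fun w => e w p = j), T v w else 0) =
      ∑ v ∈ V, ∑ w ∈ W, if Q (e v p) (e w p) then T v w else 0 := by
  rw [← fib e p N V W hV hW]
  apply Finset.sum_congr rfl; intro i _
  apply Finset.sum_congr rfl; intro j _
  rw [← Finset.sum_filter_add_sum_filter_not (s := Finset.filter (fun v => e v p = i) V) (fun _ => True)]
  simp only [Finset.filter_true, not_true, Finset.filter_false, Finset.sum_empty, add_zero]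
  by_cases h : Q i j
  · rw [if_pos h]
    apply Finset.sum_congr rfl; intro v hv
    apply Finset.sum_congr rfl; intro w hw
    simp only [Finset.mem_filter] at hv hw
    rw [if_pos (by rw [hv.2, hw.2]; exact h)]
  · rw [if_neg h]
    symm
    apply Finset.sum_eq_zero; intro v hv
    apply Finset.sum_eq_zero; intro w hw
    simp only [Finset.mem_filter] at hv hw
    rw [if_neg (by rw [hv.2, hw.2]; exact h)]

lemma rho_nonneg {P : Finset ℕ} (hP : ∀ p ∈ P, 2 ≤ p) (e : ℕ → ℕ → ℕ) (v : ℕ) : 0 ≤ rho P e v := by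
  apply Finset.prod_nonneg
  intro p hp
  have : (2:ℝ) ≤ p := by exact_mod_cast hP p hp
  split_ifs
  · norm_num
  · rw [sub_nonneg, div_le_one (by linarith)]; linarith

lemma hwt_nonneg {P : Finset ℕ} {h : ℕ → ℝ} (h1 : ∀ p, 1 ≤ h p) (e : ℕ → ℕ → ℕ) (v w : ℕ) :
    0 ≤ hwt P h e v w := by
  apply Finset.prod_nonneg
  intro p hp
  split_ifs
  · norm_num
  · linarith [h1 p]

lemma tm_nonneg {P : Finset ℕ} (hP : ∀ p ∈ P, 2 ≤ p) {e : ℕ → ℕ → ℕ} {h : ℕ → ℝ} (h1 : ∀ p, 1 ≤ h p)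
    {ψ θ : ℕ → ℝ} (hψ : ∀ v, 0 ≤ ψ v) (hθ : ∀ v, 0 ≤ θ v) (v w : ℕ) : 0 ≤ tm P e h ψ θ v w := by
  unfold tm
  split_ifs
  · have := rho_nonneg hP e v
    have := rho_nonneg hP e w
    have := hwt_nonneg (P := P) h1 e v w
    have := hψ v
    have := hθ w
    positivity
  · exact le_rfl

lemma mass_nonneg {P : Finset ℕ} (hP : ∀ p ∈ P, 2 ≤ p) {e : ℕ → ℕ → ℕ}
    {ψ : ℕ → ℝ} (hψ : ∀ v, 0 ≤ ψ v) (V : Finset ℕ) : 0 ≤ mass P e ψ V :=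
  Finset.sum_nonneg fun v _ => mul_nonneg (hψ v) (rho_nonneg hP e v)

lemma step {P : Finset ℕ} (hP : ∀ p ∈ P, 2 ≤ p) {e : ℕ → ℕ → ℕ} {h : ℕ → ℝ} (h1 : ∀ p, 1 ≤ h p)
    {p : ℕ} (hp : p ∈ P) {C : ℝ} (hC : 0 ≤ C) (hB : Bd (P.erase p) e h C)
    (V W : Finset ℕ) {ψ θ : ℕ → ℝ} (hψ : ∀ v, 0 ≤ ψ v) (hθ : ∀ v, 0 ≤ θ v)
    (hV : Inj P e V) (hW : Inj P e W) (i j : ℕ) :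
    ∑ v ∈ V.filter (fun v => e v p = i), ∑ w ∈ W.filter (fun w => e w p = j), tm P e h ψ θ v w ≤
      C*((if i = j then 1 else h p)*((rt (1/p))^((i-j)+(j-i))*
        (rt (mass P e ψ (V.filter (fun v => e v p = i)))*
          rt (mass P e θ (W.filter (fun v => e v p = j))))^3)) := by
  set Vi := V.filter (fun v => e v p = i) with hVi
  set Wj := W.filter (fun v => e v p = j) with hWj
  have hp2 : (2:ℝ) ≤ p := by exact_mod_cast hP p hp
  have hp0 : (0:ℝ) < p := by linarith
  set u : ℕ → ℝ := fun i => if i = 0 then 1 else (1-1/(p:ℝ)) with hu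
  have hu0 : ∀ i, 0 < u i := by
    intro i; simp only [hu]; split_ifs
    · norm_num
    · rw [sub_pos, div_lt_one (by linarith)]; linarith
  have hu1 : ∀ i, u i ≤ 1 := by
    intro i; simp only [hu]; split_ifs
    · norm_num
    · have : 0 ≤ 1/(p:ℝ) := by positivity
      linarith
  have hrho : ∀ v, rho P e v = u (e v p)*rho (P.erase p) e v := by
    intro v; unfold rho; rw [← Finset.mul_prod_erase P _ hp]
  have ha : ∀ v w, aP P e v w = (p:ℝ)^(e v p - e w p)*aP (P.erase p) e v w := by
    intro v w; unfold aP; rw [← Finset.mul_prod_erase P _ hp]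
  have hh : ∀ v w, hwt P h e v w = (if e v p = e w p then 1 else h p)*hwt (P.erase p) h e v w := by
    intro v w; unfold hwt; rw [← Finset.mul_prod_erase P _ hp]
  set ψ' : ℕ → ℝ := fun v => (p:ℝ)^(j-i)*ψ v with hψ'
  set θ' : ℕ → ℝ := fun v => (p:ℝ)^(i-j)*θ v with hθ'
  set d : ℝ := (p:ℝ)^((i-j)+(j-i)) with hd
  have hd0 : 0 < d := by positivity
  set hc : ℝ := if i = j then 1 else h p with hhc
  have hc0 : 0 ≤ hc := by
    rw [hhc]; split_ifs
    · norm_num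
    · linarith [h1 p]
  have hterm : ∀ v ∈ Vi, ∀ w ∈ Wj, tm P e h ψ θ v w = hc*(u i*u j/d)*tm (P.erase p) e h ψ' θ' v w := by
    intro v hv w hw
    simp only [hVi, hWj, Finset.mem_filter] at hv hw
    have hedge : edge P e ψ θ v w ↔ edge (P.erase p) e ψ' θ' v w := by
      unfold edge
      rw [ha, ha, hv.2, hw.2]
      simp only [hψ', hθ']
      rw [show ψ v * ((p:ℝ)^(j-i)*aP (P.erase p) e w v) = (p:ℝ)^(j-i)*ψ v*aP (P.erase p) e w v by ring,
        show θ w * ((p:ℝ)^(i-j)*aP (P.erase p) e v w) = (p:ℝ)^(i-j)*θ w*aP (P.erase p) e v w by ring]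
    unfold tm
    by_cases hE : edge P e ψ θ v w
    · rw [if_pos hE, if_pos (hedge.1 hE), hrho, hrho, hh, hv.2, hw.2]
      simp only [hψ', hθ', hd, pow_add]
      rw [hhc]
      field_simp
    · rw [if_neg hE, if_neg (fun h => hE (hedge.2 h))]
      ring
  have hmψ : mass (P.erase p) e ψ' Vi = (p:ℝ)^(j-i)/u i*mass P e ψ Vi := by
    unfold mass
    rw [Finset.mul_sum]
    apply Finset.sum_congr rfl
    intro v hv
    simp only [hVi, Finset.mem_filter] at hv
    rw [hrho, hv.2]
    have := (hu0 i).ne'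
    simp only [hψ']
    field_simp
  have hmθ : mass (P.erase p) e θ' Wj = (p:ℝ)^(i-j)/u j*mass P e θ Wj := by
    unfold mass
    rw [Finset.mul_sum]
    apply Finset.sum_congr rfl
    intro v hv
    simp only [hWj, Finset.mem_filter] at hv
    rw [hrho, hv.2]
    have := (hu0 j).ne'
    simp only [hθ']
    field_simp
  have hinj : ∀ (V : Finset ℕ) (i : ℕ), Inj P e V → Inj (P.erase p) e (V.filter (fun v => e v p = i)) := by
    intro V i hV v hv v' hv' hall
    simp only [Finset.mem_filter] at hv hv'
    refine hV v hv.1 v' hv'.1 fun r hr => ?_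
    by_cases hrp : r = p
    · rw [hrp, hv.2, hv'.2]
    · exact hall r (Finset.mem_erase.2 ⟨hrp, hr⟩)
  have hmain := hB Vi Wj ψ' θ' (fun v => by have := hψ v; positivity) (fun v => by have := hθ v; positivity)
    (hinj V i hV) (hinj W j hW)
  rw [Finset.sum_congr rfl (fun v hv => Finset.sum_congr rfl (fun w hw => hterm v hv w hw))]
  simp_rw [← Finset.mul_sum]
  have hui := hu0 i
  have huj := hu0 j
  set κ : ℝ := d/(u i*u j) with hκ
  have hκ0 : 0 < κ := by positivity
  have hdκ : d ≤ κ := by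
    rw [hκ, le_div_iff₀ (by positivity)]
    exact mul_le_of_le_one_right hd0.le (mul_le_one₀ (hu1 i) huj.le (hu1 j))
  have hrr : rt (mass (P.erase p) e ψ' Vi)*rt (mass (P.erase p) e θ' Wj) =
      rt κ*(rt (mass P e ψ Vi)*rt (mass P e θ Wj)) := by
    rw [hmψ, hmθ, rt_mul _ _ (by positivity), rt_mul _ _ (by positivity)]
    have : κ = (p:ℝ)^(j-i)/u i*((p:ℝ)^(i-j)/u j) := by
      rw [hκ, hd, pow_add]; field_simp
    rw [this, rt_mul _ _ (by positivity)]; ring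
  rw [hrr] at hmain
  have hrt1 : rt (1/(p:ℝ)) = 1/rt p := by
    have h1 := rt_mul (1/(p:ℝ)) p (by positivity)
    rw [one_div_mul_cancel hp0.ne'] at h1
    have h2 : rt 1 = 1 := by simp [rt]
    have := rt_pos hp0
    rw [h2] at h1
    field_simp
    linarith
  have hrtpow : ∀ n : ℕ, rt ((p:ℝ)^n) = rt p^n := by
    intro n
    induction n with
    | zero => simp [rt]
    | succ n ih => rw [pow_succ, rt_mul _ _ (by positivity), ih, pow_succ]
  have hrtd : rt d = rt p^((i-j)+(j-i)) := hrtpow _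
  have hrκ := rt_pos hκ0
  have hrd := rt_pos hd0
  have hX : 0 ≤ (rt (mass P e ψ Vi)*rt (mass P e θ Wj))^3 := by
    have := rt_nonneg (mass P e ψ Vi); have := rt_nonneg (mass P e θ Wj); positivity
  calc hc*(u i*u j/d)*∑ v ∈ Vi, ∑ w ∈ Wj, tm (P.erase p) e h ψ' θ' v w
      ≤ hc*(u i*u j/d)*(C*(rt κ*(rt (mass P e ψ Vi)*rt (mass P e θ Wj)))^3) := by gcongr
    _ = C*(hc*((1/rt κ)*(rt (mass P e ψ Vi)*rt (mass P e θ Wj))^3)) := by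
        have e1 : u i*u j/d = 1/κ := by rw [hκ]; field_simp
        have e2 : (1:ℝ)/κ = 1/rt κ^4 := by rw [rt_pow κ hκ0.le]
        rw [e1, e2]
        field_simp
    _ ≤ C*(hc*((1/rt d)*(rt (mass P e ψ Vi)*rt (mass P e θ Wj))^3)) := by
        gcongr
        exact rt_mono hdκ
    _ = _ := by rw [hrt1, hrtd, one_div_pow]

lemma tele (t N : ℕ) (ht : 1 ≤ t) :
    ∑ n ∈ Finset.Ioc t N, 1/((n:ℝ)*(n-1)) ≤ 1/t := by
  have ht' : (0:ℝ) < t := by exact_mod_cast ht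
  rcases le_or_gt t N with h | h
  · have : ∑ n ∈ Finset.Ioc t N, 1/((n:ℝ)*(n-1)) = 1/t - 1/N := by
      induction N, h using Nat.le_induction with
      | base => simp
      | succ N hN ih =>
        rw [← Finset.insert_Ioc_right_eq_Ioc_add_one (by omega), Finset.sum_insert (by simp), ih]
        have : (0:ℝ) < N := by exact_mod_cast (by omega : 0 < N)
        push_cast
        rw [add_sub_cancel_right]
        field_simp
        ring
    rw [this]
    have : (0:ℝ) ≤ 1/N := by positivity
    linarith
  · rw [Finset.Ioc_eq_empty (by omega)]; simp

lemma tele' (t : ℕ) (ht : 1 ≤ t) (P : Finset ℕ) (hP : ∀ p ∈ P, t < p) :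
    ∑ n ∈ P, 1/((n:ℝ)*(n-1)) ≤ 1/t := by
  refine le_trans (Finset.sum_le_sum_of_subset_of_nonneg (t := Finset.Ioc t (P.sup id)) ?_ ?_) (tele t _ ht)
  · intro p hp
    exact Finset.mem_Ioc.2 ⟨hP p hp, Finset.le_sup (f := id) hp⟩
  · intro n hn _
    have : (1:ℝ) ≤ n := by
      have := (Finset.mem_Ioc.1 hn).1
      exact_mod_cast (by omega : 1 ≤ n)
    have h2 : (0:ℝ) ≤ n - 1 := by linarith
    positivity

lemma prod_le_three (P : Finset ℕ) (hP : ∀ p ∈ P, 2 ≤ p) : ∏ p ∈ P, (1+1/((p:ℝ)*(p-1))) ≤ 3 := by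
  calc _ ≤ ∏ p ∈ P, Real.exp (1/((p:ℝ)*(p-1))) := by
        apply Finset.prod_le_prod
        · intro p hp
          have : (2:ℝ) ≤ p := by exact_mod_cast hP p hp
          have h2 : (0:ℝ) ≤ p - 1 := by linarith
          positivity
        · intro p _
          linarith [Real.add_one_le_exp (1/((p:ℝ)*(p-1)))]
    _ = Real.exp (∑ p ∈ P, 1/((p:ℝ)*(p-1))) := (Real.exp_sum _ _).symm
    _ ≤ Real.exp 1 := by
        gcongr
        simpa using tele' 1 le_rfl P (fun p hp => hP p hp)
    _ ≤ 3 := by linarith [Real.exp_one_lt_d9]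

end DS


namespace DS

def pl (P : Finset ℕ) (e : ℕ → ℕ → ℕ) (k : ℕ → ℕ) (v : ℕ) : ℕ := ∏ p ∈ P, p^(e v p - k p)
def mi (P : Finset ℕ) (e : ℕ → ℕ → ℕ) (k : ℕ → ℕ) (v : ℕ) : ℕ := ∏ p ∈ P, p^(k p - e v p)

lemma pl_pos {P : Finset ℕ} (hP : ∀ p ∈ P, p.Prime) (e : ℕ → ℕ → ℕ) (k : ℕ → ℕ) (v : ℕ) : 0 < pl P e k v :=
  Finset.prod_pos fun p hp => pow_pos (hP p hp).pos _
lemma mi_pos {P : Finset ℕ} (hP : ∀ p ∈ P, p.Prime) (e : ℕ → ℕ → ℕ) (k : ℕ → ℕ) (v : ℕ) : 0 < mi P e k v :=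
  Finset.prod_pos fun p hp => pow_pos (hP p hp).pos _

lemma fact_prod {P : Finset ℕ} (hP : ∀ p ∈ P, p.Prime) (f : ℕ → ℕ) {q : ℕ} (hq : q ∈ P) :
    (∏ p ∈ P, p^(f p)).factorization q = f q := by
  rw [Nat.factorization_prod (fun p hp => pow_ne_zero _ (hP p hp).ne_zero)]
  rw [Finset.sum_apply']
  rw [Finset.sum_eq_single q]
  · rw [Nat.factorization_pow, Finsupp.smul_apply, (hP q hq).factorization_self]; simp
  · intro p hp hpq
    rw [Nat.factorization_pow, Finsupp.smul_apply, (hP p hp).factorization, Finsupp.single_eq_of_ne (Ne.symm hpq)]; simp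
  · exact fun h => absurd hq h

lemma local_sum (p k : ℕ) (hp : 2 ≤ p) :
    ∑ l ∈ Finset.range (k+1), (if l = 0 then (if k = 0 then (1:ℝ) else 1-1/(p:ℝ)) else 1/(p:ℝ)^l) ≤
      1+1/((p:ℝ)*(p-1)) := by
  have hp2 : (2:ℝ) ≤ p := by exact_mod_cast hp
  have h2 : (0:ℝ) < p - 1 := by linarith
  rw [Finset.sum_range_succ']
  simp only [Nat.add_eq_zero_iff, one_ne_zero, and_false, if_false, if_true]
  rcases Nat.eq_zero_or_pos k with hk | hk
  · subst hk
    simp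
    positivity
  · rw [if_neg (by omega)]
    have hs : ∀ n : ℕ, ∑ l ∈ Finset.range n, 1/(p:ℝ)^(l+1) ≤ 1/(p-1) - 1/((p-1)*(p:ℝ)^n) := by
      intro n
      induction n with
      | zero => simp
      | succ n ih =>
        rw [Finset.sum_range_succ]
        have : 1/((p-1)*(p:ℝ)^n) = 1/((p-1)*(p:ℝ)^(n+1)) + 1/(p:ℝ)^(n+1) := by
          rw [pow_succ]; field_simp; ring
        linarith
    have h3 := hs k
    have h4 : 0 ≤ 1/((p-1)*(p:ℝ)^k) := by positivity
    have h5 : 1/((p:ℝ)*(p-1)) = 1/(p-1) - 1/p := by field_simp; ring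
    linarith

lemma count {P : Finset ℕ} (hP : ∀ p ∈ P, p.Prime) {e : ℕ → ℕ → ℕ} {W : Finset ℕ} (hW : Inj P e W)
    (k : ℕ → ℕ) (R : ℕ) (hR : ∀ w ∈ W, pl P e k w ≤ R) :
    ∑ w ∈ W, rho P e w/(mi P e k w : ℝ) ≤ 3*R := by
  set c : ℕ → ℕ → ℝ := fun p l => if l = 0 then (if k p = 0 then (1:ℝ) else 1-1/(p:ℝ)) else 1/(p:ℝ)^l with hc
  have hp2 : ∀ p ∈ P, (2:ℝ) ≤ p := fun p hp => by exact_mod_cast (hP p hp).two_le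
  have hc0 : ∀ p ∈ P, ∀ l, 0 ≤ c p l := by
    intro p hp l
    have := hp2 p hp
    simp only [hc]
    split_ifs
    · norm_num
    · rw [sub_nonneg, div_le_one (by linarith)]; linarith
    · positivity
  set T : Finset (ℕ × ((a : ℕ) → a ∈ P → ℕ)) := Finset.Icc 1 R ×ˢ P.pi (fun p => Finset.range (k p+1)) with hT
  set g : ℕ → (ℕ × ((a : ℕ) → a ∈ P → ℕ)) := fun w => (pl P e k w, fun p _ => k p - e w p) with hg
  set G : (ℕ × ((a : ℕ) → a ∈ P → ℕ)) → ℝ := fun x => ∏ p ∈ P.attach, c p.1 (x.2 p.1 p.2) with hG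
  have hginj : Set.InjOn g W := by
    intro w hw w' hw' h
    simp only [hg, Prod.mk.injEq] at h
    refine hW w hw w' hw' fun p hp => ?_
    have h1 : e w p - k p = e w' p - k p := by
      rw [← fact_prod hP (fun p => e w p - k p) hp, ← fact_prod hP (fun p => e w' p - k p) hp]
      exact congrArg (fun n : ℕ => n.factorization p) h.1
    have h2 : k p - e w p = k p - e w' p := congrFun (congrFun h.2 p) hp
    omega
  have hpt : ∀ w ∈ W, rho P e w/(mi P e k w : ℝ) ≤ G (g w) := by
    intro w hw
    simp only [hG, hg]
    rw [Finset.prod_attach P (fun p => c p (k p - e w p))]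
    unfold rho mi
    push_cast
    rw [← Finset.prod_div_distrib]
    apply Finset.prod_le_prod
    · intro p hp
      have := hp2 p hp
      have : 0 ≤ 1 - 1/(p:ℝ) := by rw [sub_nonneg, div_le_one (by linarith)]; linarith
      split_ifs <;> positivity
    · intro p hp
      have := hp2 p hp
      have h3 : 0 ≤ 1/(p:ℝ) := by positivity
      simp only [hc]
      by_cases h1 : k p - e w p = 0
      · rw [if_pos h1, h1, pow_zero, div_one]
        split_ifs with h2 h4 h5
        · exact le_rfl
        · omega
        · linarith
        · exact le_rfl
      · rw [if_neg h1]
        gcongr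
        split_ifs
        · exact le_rfl
        · linarith
  calc ∑ w ∈ W, rho P e w/(mi P e k w : ℝ) ≤ ∑ w ∈ W, G (g w) := Finset.sum_le_sum hpt
    _ = ∑ x ∈ W.image g, G x := (Finset.sum_image hginj).symm
    _ ≤ ∑ x ∈ T, G x := by
        apply Finset.sum_le_sum_of_subset_of_nonneg
        · intro x hx
          obtain ⟨w, hw, rfl⟩ := Finset.mem_image.1 hx
          simp only [hT, hg, Finset.mem_product, Finset.mem_Icc, Finset.mem_pi, Finset.mem_range]
          exact ⟨⟨pl_pos hP e k w, hR w hw⟩, fun p _ => by omega⟩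
        · intro x _ _
          exact Finset.prod_nonneg fun p _ => hc0 p.1 p.2 _
    _ = R*∑ f ∈ P.pi (fun p => Finset.range (k p+1)), ∏ p ∈ P.attach, c p.1 (f p.1 p.2) := by
        rw [hT, Finset.sum_product]
        simp [hG]
    _ = R*∏ p ∈ P, ∑ l ∈ Finset.range (k p+1), c p l := by rw [Finset.prod_sum]
    _ ≤ R*∏ p ∈ P, (1+1/((p:ℝ)*(p-1))) := by
        gcongr with p hp
        · intro p hp; exact Finset.sum_nonneg fun l _ => hc0 p hp l
        · exact local_sum p (k p) (hP p hp).two_le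
    _ ≤ R*3 := by
        gcongr
        exact prod_le_three P fun p hp => (hP p hp).two_le
    _ = 3*R := by ring

open Classical in
lemma maxsub (V W : Finset ℕ) (f g : ℕ → ℝ) (hf : ∀ v ∈ V, 0 < f v) (hg : ∀ w ∈ W, 0 < g w)
    (E : ℕ → ℕ → Prop) (Φ : ℝ) (hΦ : Φ = ∑ v ∈ V, ∑ w ∈ W, if E v w then f v*g w else 0) (hpos : 0 < Φ) :
    ∃ V0 ⊆ V, ∃ W0 ⊆ W, V0.Nonempty ∧ W0.Nonempty ∧
      (∀ v ∈ V0, Φ/(3*∑ v ∈ V, f v) ≤ ∑ w ∈ W0, if E v w then g w else 0) ∧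
      (∀ w ∈ W0, Φ/(3*∑ w ∈ W, g w) ≤ ∑ v ∈ V0, if E v w then f v else 0) := by
  set m := ∑ v ∈ V, f v with hm
  set n := ∑ w ∈ W, g w with hn
  have hVne : V.Nonempty := by
    by_contra h; rw [Finset.not_nonempty_iff_eq_empty] at h
    rw [h] at hΦ; simp at hΦ; linarith
  have hWne : W.Nonempty := by
    by_contra h; rw [Finset.not_nonempty_iff_eq_empty] at h
    rw [h] at hΦ; simp at hΦ; linarith
  have hm0 : 0 < m := Finset.sum_pos hf hVne
  have hn0 : 0 < n := Finset.sum_pos hg hWne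
  set a := Φ/(3*m) with ha
  set b := Φ/(3*n) with hb
  have ha0 : 0 < a := by positivity
  have hb0 : 0 < b := by positivity
  set J : Finset ℕ × Finset ℕ → ℝ := fun x =>
    (∑ v ∈ x.1, ∑ w ∈ x.2, if E v w then f v*g w else 0) - a*∑ v ∈ x.1, f v - b*∑ w ∈ x.2, g w with hJ
  obtain ⟨⟨V0, W0⟩, hmem, hmax⟩ := Finset.exists_max_image (V.powerset ×ˢ W.powerset) J
    ⟨(V, W), by simp⟩
  simp only [Finset.mem_product, Finset.mem_powerset] at hmem
  have hJ0 : 0 < J (V0, W0) := by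
    have h1 := hmax (V, W) (by simp)
    have h2 : J (V, W) = Φ/3 := by
      simp only [hJ]
      rw [← hΦ, ← hm, ← hn, ha, hb]; field_simp; ring
    linarith
  refine ⟨V0, hmem.1, W0, hmem.2, ?_, ?_, ?_, ?_⟩
  · by_contra h; rw [Finset.not_nonempty_iff_eq_empty] at h
    simp only [hJ, h, Finset.sum_empty, mul_zero, sub_zero, zero_sub] at hJ0
    have : 0 ≤ ∑ w ∈ W0, g w := Finset.sum_nonneg fun w hw => (hg w (hmem.2 hw)).le
    have : 0 ≤ b*∑ w ∈ W0, g w := by positivity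
    linarith
  · by_contra h; rw [Finset.not_nonempty_iff_eq_empty] at h
    simp only [hJ, h, Finset.sum_empty, mul_zero, sub_zero, zero_sub, Finset.sum_const_zero] at hJ0
    have : 0 ≤ ∑ w ∈ V0, f w := Finset.sum_nonneg fun w hw => (hf w (hmem.1 hw)).le
    have : 0 ≤ a*∑ w ∈ V0, f w := by positivity
    linarith
  · intro v hv
    have h1 := hmax (V0.erase v, W0) (by
      simp only [Finset.mem_product, Finset.mem_powerset]
      exact ⟨(Finset.erase_subset _ _).trans hmem.1, hmem.2⟩)
    simp only [hJ] at h1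
    rw [← Finset.add_sum_erase V0 _ hv, ← Finset.add_sum_erase V0 f hv] at h1
    have h2 : (∑ w ∈ W0, if E v w then f v*g w else 0) = f v*∑ w ∈ W0, if E v w then g w else 0 := by
      rw [Finset.mul_sum]; exact Finset.sum_congr rfl fun w _ => by split_ifs <;> simp
    rw [h2] at h1
    have h3 := hf v (hmem.1 hv)
    have h4 : f v*a ≤ f v*∑ w ∈ W0, if E v w then g w else 0 := by linarith
    exact le_of_mul_le_mul_left h4 h3
  · intro w hw
    have h1 := hmax (V0, W0.erase w) (by
      simp only [Finset.mem_product, Finset.mem_powerset]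
      exact ⟨hmem.1, (Finset.erase_subset _ _).trans hmem.2⟩)
    simp only [hJ] at h1
    rw [Finset.sum_comm, Finset.sum_comm (s := V0)] at h1
    rw [← Finset.add_sum_erase W0 _ hw, ← Finset.add_sum_erase W0 g hw] at h1
    have h2 : (∑ v ∈ V0, if E v w then f v*g w else 0) = g w*∑ v ∈ V0, if E v w then f v else 0 := by
      rw [Finset.mul_sum]; exact Finset.sum_congr rfl fun v _ => by split_ifs <;> simp [mul_comm]
    rw [h2] at h1
    have h3 := hg w (hmem.2 hw)
    have h4 : g w*b ≤ g w*∑ v ∈ V0, if E v w then f v else 0 := by linarith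
    exact le_of_mul_le_mul_left h4 h3

lemma aP_split (P : Finset ℕ) (e : ℕ → ℕ → ℕ) (k : ℕ → ℕ) (v w : ℕ)
    (h : ∀ p ∈ P, e v p = k p ∨ e w p = k p) : aP P e v w = pl P e k v*mi P e k w := by
  unfold aP pl mi
  push_cast
  rw [← Finset.prod_mul_distrib]
  refine Finset.prod_congr rfl fun p hp => ?_
  rw [← pow_add]
  congr 1
  rcases h p hp with h | h <;> omega

open Classical in
lemma deg_le {P : Finset ℕ} (hP : ∀ p ∈ P, p.Prime) {e : ℕ → ℕ → ℕ} {W : Finset ℕ} (hW : Inj P e W)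
    (k : ℕ → ℕ) (R M : ℕ) (hM : 0 < M) (hR : ∀ w ∈ W, pl P e k w ≤ R) (θ : ℕ → ℝ) (E : ℕ → Prop)
    (hE : ∀ w ∈ W, E w → θ w*(M*mi P e k w) ≤ 1) :
    ∑ w ∈ W, (if E w then θ w*rho P e w else 0) ≤ 3*R/M := by
  have hM' : (0:ℝ) < M := by exact_mod_cast hM
  calc _ ≤ ∑ w ∈ W, rho P e w/(mi P e k w : ℝ)/M := by
        apply Finset.sum_le_sum
        intro w hw
        have h1 : (0:ℝ) < mi P e k w := by exact_mod_cast mi_pos hP e k w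
        have h2 := rho_nonneg (fun p hp => (hP p hp).two_le) e w
        split_ifs with h
        · have h3 := hE w hw h
          rw [div_div, le_div_iff₀ (by positivity)]
          calc θ w*rho P e w*(mi P e k w*M) = rho P e w*(θ w*(M*mi P e k w)) := by ring
            _ ≤ rho P e w*1 := by gcongr
            _ = _ := mul_one _
        · positivity
    _ = (∑ w ∈ W, rho P e w/(mi P e k w : ℝ))/M := by rw [Finset.sum_div]
    _ ≤ _ := by gcongr; exact count hP hW k R hR

lemma Inj.mono {P : Finset ℕ} {e : ℕ → ℕ → ℕ} {V W : Finset ℕ} (h : Inj P e W) (hs : V ⊆ W) : Inj P e V :=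
  fun v hv v' hv' => h v (hs hv) v' (hs hv')

open Classical in
lemma endgame {P : Finset ℕ} (hP : ∀ p ∈ P, p.Prime) {e : ℕ → ℕ → ℕ} (V W : Finset ℕ)
    (hV : Inj P e V) (hW : Inj P e W) {ψ θ : ℕ → ℝ} (hψ : ∀ v, 0 ≤ ψ v) (hθ : ∀ v, 0 ≤ θ v)
    (k : ℕ → ℕ) (E : ℕ → ℕ → Prop)
    (hE : ∀ v w, E v w → edge P e ψ θ v w ∧ ∀ p ∈ P, e v p = k p ∨ e w p = k p) :
    (∑ v ∈ V, ∑ w ∈ W, if E v w then ψ v*rho P e v*(θ w*rho P e w) else 0)^2 ≤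
      81*(mass P e ψ V*mass P e θ W) := by
  have hP2 : ∀ p ∈ P, 2 ≤ p := fun p hp => (hP p hp).two_le
  set f : ℕ → ℝ := fun v => ψ v*rho P e v with hf
  set g : ℕ → ℝ := fun v => θ v*rho P e v with hg
  have hf0 : ∀ v, 0 ≤ f v := fun v => mul_nonneg (hψ v) (rho_nonneg hP2 e v)
  have hg0 : ∀ v, 0 ≤ g v := fun v => mul_nonneg (hθ v) (rho_nonneg hP2 e v)
  have hmV : mass P e ψ V = ∑ v ∈ V.filter (fun v => 0 < f v), f v := by
    unfold mass
    rw [Finset.sum_filter]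
    refine Finset.sum_congr rfl fun v _ => ?_
    split_ifs with h
    · rfl
    · exact le_antisymm (not_lt.1 h) (hf0 v)
  have hmW : mass P e θ W = ∑ v ∈ W.filter (fun v => 0 < g v), g v := by
    unfold mass
    rw [Finset.sum_filter]
    refine Finset.sum_congr rfl fun v _ => ?_
    split_ifs with h
    · rfl
    · exact le_antisymm (not_lt.1 h) (hg0 v)
  have hΦ' : (∑ v ∈ V, ∑ w ∈ W, if E v w then ψ v*rho P e v*(θ w*rho P e w) else 0) =
      ∑ v ∈ V.filter (fun v => 0 < f v), ∑ w ∈ W.filter (fun v => 0 < g v), if E v w then f v*g w else 0 := by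
    rw [Finset.sum_filter]
    refine Finset.sum_congr rfl fun v _ => ?_
    split_ifs with h
    · rw [Finset.sum_filter]
      refine Finset.sum_congr rfl fun w _ => ?_
      by_cases h2 : 0 < g w
      · rw [if_pos h2]
      · rw [if_neg h2]
        have : g w = 0 := le_antisymm (not_lt.1 h2) (hg0 w)
        simp only [hg] at this
        rw [this]; simp
    · have : f v = 0 := le_antisymm (not_lt.1 h) (hf0 v)
      simp only [hf] at this
      rw [this]; simp
  rw [hΦ', hmV, hmW]
  set V' := V.filter (fun v => 0 < f v) with hV'
  set W' := W.filter (fun v => 0 < g v) with hW'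
  set Φ := ∑ v ∈ V', ∑ w ∈ W', if E v w then f v*g w else 0 with hΦ
  have hΦ0 : 0 ≤ Φ := Finset.sum_nonneg fun v _ => Finset.sum_nonneg fun w _ => by
    have := hf0 v; have := hg0 w; split_ifs <;> positivity
  have hm0 : 0 ≤ ∑ v ∈ V', f v := Finset.sum_nonneg fun v _ => hf0 v
  have hn0 : 0 ≤ ∑ v ∈ W', g v := Finset.sum_nonneg fun v _ => hg0 v
  rcases hΦ0.eq_or_lt with h0 | hpos
  · rw [← h0, zero_pow two_ne_zero]; positivity
  obtain ⟨V0, hV0, W0, hW0, hVne, hWne, hdV, hdW⟩ := maxsub V' W' f g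
    (fun v hv => (Finset.mem_filter.1 hv).2) (fun v hv => (Finset.mem_filter.1 hv).2) E Φ hΦ hpos
  obtain ⟨v1, hv1, hv1m⟩ := Finset.exists_max_image V0 (pl P e k) hVne
  obtain ⟨w1, hw1, hw1m⟩ := Finset.exists_max_image W0 (pl P e k) hWne
  have hMpos := pl_pos hP e k v1
  have hRpos := pl_pos hP e k w1
  have hi1 := hV.mono (hV0.trans (Finset.filter_subset _ _))
  have hi2 := hW.mono (hW0.trans (Finset.filter_subset _ _))
  have d1 := (hdV v1 hv1).trans (deg_le hP hi2 k _ _ hMpos hw1m θ (E v1) (fun w _ hEw => by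
    have h2 := hE v1 w hEw
    rw [← aP_split P e k v1 w h2.2]
    exact h2.1.2))
  have d2 := (hdW w1 hw1).trans (deg_le hP hi1 k _ _ hRpos hv1m ψ (fun v => E v w1) (fun v _ hEw => by
    have h2 := hE v w1 hEw
    rw [← aP_split P e k w1 v (fun p hp => (h2.2 p hp).symm)]
    exact h2.1.1))
  set m := ∑ v ∈ V', f v with hm
  set n := ∑ v ∈ W', g v with hn
  have hmp : 0 < m := by
    rcases hm0.eq_or_lt with h | h
    · exfalso
      obtain ⟨v, hv⟩ := hVne
      have h3 := (Finset.mem_filter.1 (hV0 hv)).2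
      have h4 := Finset.single_le_sum (f := f) (fun v _ => hf0 v) (hV0 hv)
      linarith
    · exact h
  have hnp : 0 < n := by
    rcases hn0.eq_or_lt with h | h
    · exfalso
      obtain ⟨v, hv⟩ := hWne
      have h3 := (Finset.mem_filter.1 (hW0 hv)).2
      have h4 := Finset.single_le_sum (f := g) (fun v _ => hg0 v) (hW0 hv)
      linarith
    · exact h
  have hM' : (0:ℝ) < pl P e k v1 := by exact_mod_cast hMpos
  have hR' : (0:ℝ) < pl P e k w1 := by exact_mod_cast hRpos
  have d3 := mul_le_mul d1 d2 (by positivity) (by positivity)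
  have d4 : 3*(pl P e k w1:ℝ)/pl P e k v1*(3*(pl P e k v1:ℝ)/pl P e k w1) = 9 := by field_simp; norm_num
  rw [d4] at d3
  have d5 : Φ/(3*m)*(Φ/(3*n)) = Φ^2/(9*(m*n)) := by field_simp; norm_num
  rw [d5, div_le_iff₀ (by positivity)] at d3
  linarith

end DS


namespace DS

lemma mass_fib {P : Finset ℕ} {e : ℕ → ℕ → ℕ} (p N : ℕ) (V : Finset ℕ) (hV : ∀ v ∈ V, e v p < N) (ψ : ℕ → ℝ) :
    ∑ i ∈ Finset.range N, mass P e ψ (V.filter (fun v => e v p = i)) = mass P e ψ V :=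
  Finset.sum_fiberwise_of_maps_to (fun w hw => Finset.mem_range.2 (hV w hw)) _

lemma exN (e : ℕ → ℕ → ℕ) (p : ℕ) (V W : Finset ℕ) :
    ∃ N, (∀ v ∈ V, e v p < N) ∧ (∀ v ∈ W, e v p < N) :=
  ⟨(V ∪ W).sup (fun v => e v p) + 1,
    fun _ hv => Nat.lt_succ_of_le (Finset.le_sup (f := fun v => e v p) (Finset.mem_union_left _ hv)),
    fun _ hv => Nat.lt_succ_of_le (Finset.le_sup (f := fun v => e v p) (Finset.mem_union_right _ hv))⟩

open Classical in
lemma conc {P : Finset ℕ} (hP : ∀ p ∈ P, 2 ≤ p) {e : ℕ → ℕ → ℕ} {h : ℕ → ℝ} {H : ℝ} (h1 : ∀ p, 1 ≤ h p)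
    (hH : ∀ p, h p ≤ H)
    {p : ℕ} (hp : p ∈ P) (hq : 1024*H^3*rt (1/p) ≤ 1) {C : ℝ} (hC : 0 < C) (hB : Bd (P.erase p) e h C)
    (V W : Finset ℕ) {ψ θ : ℕ → ℝ} (hψ : ∀ v, 0 ≤ ψ v) (hθ : ∀ v, 0 ≤ θ v)
    (hV : Inj P e V) (hW : Inj P e W)
    (hF : C*(rt (mass P e ψ V)*rt (mass P e θ W))^3 < ∑ v ∈ V, ∑ w ∈ W, tm P e h ψ θ v w) :
    ∃ k : ℕ, (∑ v ∈ V, ∑ w ∈ W, if e v p ≠ e w p then tm P e h ψ θ v w else 0) ≤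
        3*H*(32*H)^6*rt (1/p)^4*∑ v ∈ V, ∑ w ∈ W, tm P e h ψ θ v w ∧
      (∑ v ∈ V, ∑ w ∈ W, if e v p ≠ k ∧ e w p ≠ k then tm P e h ψ θ v w else 0) ≤
        3*H*(32*H)^6*rt (1/p)^6*∑ v ∈ V, ∑ w ∈ W, tm P e h ψ θ v w := by
  obtain ⟨N, hNV, hNW⟩ := exN e p V W
  have hp0 : (0:ℝ) < p := by exact_mod_cast (by have := hP p hp; omega : 0 < p)
  have hH1 : 1 ≤ H := (h1 0).trans (hH 0)
  have key := single H (rt (1/p)) C hH1 hC (rt_pos (by positivity)) hq N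
    (fun i => mass P e ψ (V.filter (fun v => e v p = i))) (fun i => mass P e θ (W.filter (fun v => e v p = i)))
    (fun i => mass_nonneg hP hψ _) (fun i => mass_nonneg hP hθ _)
    (fun i j => ∑ v ∈ V.filter (fun v => e v p = i), ∑ w ∈ W.filter (fun w => e w p = j), tm P e h ψ θ v w)
    (fun i => by
      have := step hP h1 hp hC.le hB V W hψ hθ hV hW i i
      simpa using this)
    (fun i j hij => by
      have := step hP h1 hp hC.le hB V W hψ hθ hV hW i j
      rw [if_neg hij] at this
      refine this.trans ?_
      have := rt_nonneg (1/(p:ℝ))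
      have := rt_nonneg (mass P e ψ (V.filter (fun v => e v p = i)))
      have := rt_nonneg (mass P e θ (W.filter (fun v => e v p = j)))
      gcongr
      exact hH p)
    (by rw [mass_fib p N V hNV, mass_fib p N W hNW, fib e p N V W hNV hNW]; exact hF)
  rw [fib e p N V W hNV hNW] at key
  obtain ⟨k, hk1, hk2⟩ := key
  refine ⟨k, ?_, ?_⟩
  · rw [← fib_pred e p N V W hNV hNW (tm P e h ψ θ) (fun i j => i ≠ j)]
    refine le_trans (le_of_eq ?_) hk1
    refine Finset.sum_congr rfl fun i _ => ?_
    rw [Finset.sum_filter]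
    refine Finset.sum_congr rfl fun j _ => ?_
    simp only [ne_comm]
  · rw [← fib_pred e p N V W hNV hNW (tm P e h ψ θ) (fun i j => i ≠ k ∧ j ≠ k)]
    refine le_trans (le_of_eq ?_) hk2
    rw [Finset.sum_filter]
    refine Finset.sum_congr rfl fun i _ => ?_
    by_cases hi : i ≠ k
    · rw [if_pos hi, Finset.sum_filter]
      refine Finset.sum_congr rfl fun j _ => ?_
      simp only [hi, true_and, ne_eq, not_false_eq_true]
    · rw [if_neg hi]
      refine Finset.sum_eq_zero fun j _ => ?_
      rw [if_neg (fun h => hi h.1)]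

lemma rt_le_of (x c : ℝ) (hx : 0 ≤ x) (hc : 0 < c) (h : c^4*x ≤ 1) : c*rt x ≤ 1 := by
  have h0 := rt_nonneg x
  have : (c*rt x)^4 ≤ 1 := by rw [mul_pow, rt_pow x hx]; exact h
  exact (pow_le_one_iff_of_nonneg (by positivity) (by norm_num)).1 this

lemma rt6_summable : Summable (fun n : ℕ => rt (1/(n:ℝ))^6) := by
  have h : (fun n : ℕ => rt (1/(n:ℝ))^6) = fun n : ℕ => 1/(n:ℝ)^((3:ℝ)/2) := by
    funext n
    have h0 : (0:ℝ) ≤ n := Nat.cast_nonneg n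
    have h1 : rt (1/(n:ℝ))^2 = √(1/(n:ℝ)) := by
      unfold rt; exact Real.sq_sqrt (Real.sqrt_nonneg _)
    rw [show 6 = 2*3 by norm_num, pow_mul, h1, Real.sqrt_div zero_le_one, Real.sqrt_one, div_pow, one_pow,
      Real.sqrt_eq_rpow, ← Real.rpow_natCast, ← Real.rpow_mul h0]
    norm_num
  rw [h]
  exact Real.summable_one_div_nat_rpow.2 (by norm_num)

lemma exp0 (H : ℝ) (hH : 1 ≤ H) (B : ℝ) (hB : 0 < B) : ∃ p0 : ℕ, 1 ≤ p0 ∧ (∀ p : ℕ, p0 ≤ p → 1024*H^3*rt (1/p) ≤ 1) ∧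
    ∀ P : Finset ℕ, (∀ p ∈ P, p0 ≤ p) → ∑ p ∈ P, B*rt (1/p)^6 ≤ 1/4 := by
  obtain ⟨s, hs⟩ := summable_iff_vanishing_norm.1 rt6_summable (1/(4*B)) (by positivity)
  obtain ⟨n, hn⟩ := exists_nat_ge ((1024*H^3)^4)
  refine ⟨max (s.sup id + 1) n, le_max_of_le_left (by omega), ?_, ?_⟩
  · intro p hp
    have h1 : (n:ℝ) ≤ p := by exact_mod_cast le_trans (le_max_right _ _) hp
    apply rt_le_of _ _ (by positivity) (by positivity)
    have h0 : 0 < (1024*H^3)^4 := by positivity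
    rw [mul_one_div, div_le_one (by linarith)]; linarith
  · intro P hP
    have h1 := hs P (by
      rw [Finset.disjoint_left]
      intro p hp hps
      have h2 := hP p hp
      have h3 : p ≤ s.sup id := Finset.le_sup (f := id) hps
      have := le_trans (le_max_left _ _) h2
      omega)
    rw [← Finset.mul_sum]
    have h2 := (Real.le_norm_self _).trans h1.le
    calc _ ≤ B*(1/(4*B)) := by gcongr
      _ = 1/4 := by field_simp

lemma phi_bound (X Φ : ℝ) (hX : 0 ≤ X) (hΦ : 0 ≤ Φ) (h1 : Φ^2 ≤ 81*X^4) (h2 : Φ ≤ X^4) : Φ ≤ 3*X^3 := by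
  have h3 : 0 ≤ X^3 := by positivity
  rcases le_total X 3 with h | h
  · calc Φ ≤ X^3*X := by rw [← pow_succ]; exact h2
      _ ≤ X^3*3 := by gcongr
      _ = _ := by ring
  · have h4 : Φ ≤ 9*X^2 := by
      apply le_of_sq_le_sq _ (by positivity)
      calc Φ^2 ≤ _ := h1
        _ = _ := by ring
    calc Φ ≤ 9*X^2 := h4
      _ = 3*(X^2*3) := by ring
      _ ≤ 3*(X^2*X) := by gcongr
      _ = _ := by ring

lemma log_hwt {P : Finset ℕ} {h : ℕ → ℝ} (h1 : ∀ p, 1 ≤ h p) (e : ℕ → ℕ → ℕ) (v w : ℕ) :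
    Real.log (hwt P h e v w) = ∑ p ∈ P, if e v p ≠ e w p then Real.log (h p) else 0 := by
  unfold hwt
  rw [Real.log_prod]
  · refine Finset.sum_congr rfl fun p _ => ?_
    by_cases hh : e v p = e w p <;> simp [hh]
  · intro p _
    have := h1 p
    split_ifs <;> linarith

lemma hwt_pos {P : Finset ℕ} {h : ℕ → ℝ} (h1 : ∀ p, 1 ≤ h p) (e : ℕ → ℕ → ℕ) (v w : ℕ) :
    0 < hwt P h e v w := by
  apply Finset.prod_pos
  intro p hp
  split_ifs
  · norm_num
  · linarith [h1 p]

open Classical in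
lemma rough_step {P : Finset ℕ} (hP : ∀ p ∈ P, p.Prime) {e : ℕ → ℕ → ℕ} {h : ℕ → ℝ} {H : ℝ} (h1 : ∀ p, 1 ≤ h p)
    (hH : ∀ p, h p ≤ H) (hlog : ∑ p ∈ P, Real.log (h p)/p ≤ H)
    {B : ℝ} (hB : B = 3*H*(32*H)^6)
    (hq : ∀ p ∈ P, 1024*H^3*rt (1/p) ≤ 1) (hq6 : ∑ p ∈ P, B*rt (1/p)^6 ≤ 1/4)
    {C : ℝ} (hC : C = 6*Real.exp (4*B*H)) (hIH : ∀ p ∈ P, Bd (P.erase p) e h C) : Bd P e h C := by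
  intro V W ψ θ hψ hθ hV hW
  by_contra hcon
  rw [not_le] at hcon
  have hP2 : ∀ p ∈ P, 2 ≤ p := fun p hp => (hP p hp).two_le
  have hH1 : 1 ≤ H := (h1 0).trans (hH 0)
  have hB0 : 0 < B := by rw [hB]; positivity
  have hC0 : 0 < C := by rw [hC]; positivity
  have hex : ∀ p, ∃ k : ℕ, p ∈ P → (∑ v ∈ V, ∑ w ∈ W, if e v p ≠ e w p then tm P e h ψ θ v w else 0) ≤
        B*rt (1/p)^4*∑ v ∈ V, ∑ w ∈ W, tm P e h ψ θ v w ∧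
      (∑ v ∈ V, ∑ w ∈ W, if e v p ≠ k ∧ e w p ≠ k then tm P e h ψ θ v w else 0) ≤
        B*rt (1/p)^6*∑ v ∈ V, ∑ w ∈ W, tm P e h ψ θ v w := by
    intro p
    by_cases hp : p ∈ P
    · obtain ⟨k, hk⟩ := conc hP2 h1 hH hp (hq p hp) hC0 (hIH p hp) V W hψ hθ hV hW hcon
      rw [hB]
      exact ⟨k, fun _ => hk⟩
    · exact ⟨0, fun h => absurd h hp⟩
  choose k hk using hex
  set F := ∑ v ∈ V, ∑ w ∈ W, tm P e h ψ θ v w with hF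
  have htm : ∀ v w, 0 ≤ tm P e h ψ θ v w := fun v w => tm_nonneg hP2 h1 hψ hθ v w
  have hF0 : 0 ≤ F := Finset.sum_nonneg fun v _ => Finset.sum_nonneg fun w _ => htm v w
  set Λ := 4*B*H with hΛ
  have hΛ0 : 0 < Λ := by positivity
  set E : ℕ → ℕ → Prop := fun v w => edge P e ψ θ v w ∧ ∀ p ∈ P, e v p = k p ∨ e w p = k p with hE
  set Φ := ∑ v ∈ V, ∑ w ∈ W, if E v w then ψ v*rho P e v*(θ w*rho P e w) else 0 with hΦ
  have hend : Φ^2 ≤ 81*(mass P e ψ V*mass P e θ W) := by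
    convert endgame hP V W hV hW hψ hθ k E (fun v w h => h)
  have hfg : ∀ v w, 0 ≤ ψ v*rho P e v*(θ w*rho P e w) := fun v w =>
    mul_nonneg (mul_nonneg (hψ v) (rho_nonneg hP2 e v)) (mul_nonneg (hθ w) (rho_nonneg hP2 e w))
  have hΦ0 : 0 ≤ Φ := Finset.sum_nonneg fun v _ => Finset.sum_nonneg fun w _ => by
    have := hfg v w; split_ifs <;> simp [this]
  have hΦ2 : Φ ≤ mass P e ψ V*mass P e θ W := by
    unfold mass
    rw [Finset.sum_mul_sum]
    apply Finset.sum_le_sum; intro v _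
    apply Finset.sum_le_sum; intro w _
    have := hfg v w; split_ifs <;> simp [this]
  have hlogn : ∀ p, 0 ≤ Real.log (h p) := fun p => Real.log_nonneg (h1 p)
  have hlh : ∀ v w, 0 ≤ Real.log (hwt P h e v w) := by
    intro v w; rw [log_hwt h1]
    apply Finset.sum_nonneg; intro p _
    have := hlogn p
    split_ifs <;> simp [this]
  have hbad : ∀ v w, 0 ≤ ∑ p ∈ P, (if e v p ≠ k p ∧ e w p ≠ k p then tm P e h ψ θ v w else 0) := by
    intro v w
    apply Finset.sum_nonneg; intro p _
    have := htm v w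
    split_ifs <;> simp [this]
  have hpt : ∀ v w, tm P e h ψ θ v w ≤ Real.exp Λ*(if E v w then ψ v*rho P e v*(θ w*rho P e w) else 0) +
      ∑ p ∈ P, (if e v p ≠ k p ∧ e w p ≠ k p then tm P e h ψ θ v w else 0) +
      tm P e h ψ θ v w*Real.log (hwt P h e v w)/Λ := by
    intro v w
    have t1 := htm v w
    have t2 := hlh v w
    have t3 := hbad v w
    have t4 : 0 ≤ Real.exp Λ*(if E v w then ψ v*rho P e v*(θ w*rho P e w) else 0) := by
      have := hfg v w
      have := (Real.exp_pos Λ).le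
      split_ifs <;> positivity
    have t5 : 0 ≤ tm P e h ψ θ v w*Real.log (hwt P h e v w)/Λ := by positivity
    by_cases hedge : edge P e ψ θ v w
    swap
    · have : tm P e h ψ θ v w = 0 := by unfold tm; rw [if_neg hedge]
      linarith
    by_cases hb : ∀ p ∈ P, e v p = k p ∨ e w p = k p
    swap
    · push Not at hb
      obtain ⟨p, hp, hb⟩ := hb
      have := Finset.single_le_sum (f := fun p => if e v p ≠ k p ∧ e w p ≠ k p then tm P e h ψ θ v w else 0)
        (fun p _ => by split_ifs <;> simp [t1]) hp
      simp only [if_pos hb] at this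
      linarith
    rcases le_or_gt (Real.log (hwt P h e v w)) Λ with hl | hl
    · have t6 : tm P e h ψ θ v w ≤ Real.exp Λ*(if E v w then ψ v*rho P e v*(θ w*rho P e w) else 0) := by
        rw [if_pos (show E v w from ⟨hedge, hb⟩)]
        unfold tm
        rw [if_pos hedge, mul_comm]
        apply mul_le_mul_of_nonneg_right _ (hfg v w)
        rwa [← Real.log_le_iff_le_exp (hwt_pos h1 e v w)]
      linarith
    · have t6 : tm P e h ψ θ v w ≤ tm P e h ψ θ v w*Real.log (hwt P h e v w)/Λ := by
        rw [le_div_iff₀ hΛ0]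
        gcongr
      linarith
  have hsum : F ≤ Real.exp Λ*Φ + ∑ p ∈ P, (∑ v ∈ V, ∑ w ∈ W, if e v p ≠ k p ∧ e w p ≠ k p then tm P e h ψ θ v w else 0)
      + ∑ p ∈ P, Real.log (h p)/Λ*(∑ v ∈ V, ∑ w ∈ W, if e v p ≠ e w p then tm P e h ψ θ v w else 0) := by
    refine (Finset.sum_le_sum fun v _ => Finset.sum_le_sum fun w _ => hpt v w).trans (le_of_eq ?_)
    simp_rw [Finset.sum_add_distrib]
    congr 1
    · congr 1
      · rw [hΦ]; simp_rw [Finset.mul_sum]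
      · simp_rw [Finset.sum_comm (s := W) (t := P)]
        rw [Finset.sum_comm]
    · simp_rw [log_hwt h1, Finset.mul_sum, Finset.sum_div]
      simp_rw [Finset.sum_comm (s := W) (t := P)]
      rw [Finset.sum_comm]
      refine Finset.sum_congr rfl fun p _ => Finset.sum_congr rfl fun v _ => Finset.sum_congr rfl fun w _ => ?_
      split_ifs
      · ring
      · ring
  have hs1 : ∑ p ∈ P, (∑ v ∈ V, ∑ w ∈ W, if e v p ≠ k p ∧ e w p ≠ k p then tm P e h ψ θ v w else 0) ≤ 1/4*F := by
    refine (Finset.sum_le_sum fun p hp => (hk p hp).2).trans ?_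
    rw [← Finset.sum_mul]
    gcongr
  have hs2 : ∑ p ∈ P, Real.log (h p)/Λ*(∑ v ∈ V, ∑ w ∈ W, if e v p ≠ e w p then tm P e h ψ θ v w else 0) ≤ 1/4*F := by
    calc _ ≤ ∑ p ∈ P, Real.log (h p)/p*(B/Λ*F) := by
          apply Finset.sum_le_sum
          intro p hp
          have h2 := (hk p hp).1
          rw [rt_pow _ (by positivity)] at h2
          have h3 := hlogn p
          calc _ ≤ Real.log (h p)/Λ*(B*(1/p)*F) := by gcongr
            _ = _ := by ring
      _ = (∑ p ∈ P, Real.log (h p)/p)*(B/Λ*F) := by rw [Finset.sum_mul]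
      _ ≤ H*(B/Λ*F) := by gcongr
      _ = 1/4*F := by rw [hΛ]; field_simp
  have hF2 : F ≤ 2*Real.exp Λ*Φ := by linarith
  set X := rt (mass P e ψ V)*rt (mass P e θ W) with hX
  have hX0 : 0 ≤ X := mul_nonneg (rt_nonneg _) (rt_nonneg _)
  have hX4 : X^4 = mass P e ψ V*mass P e θ W := by
    rw [hX, mul_pow, rt_pow _ (mass_nonneg hP2 hψ V), rt_pow _ (mass_nonneg hP2 hθ W)]
  rw [← hX4] at hend hΦ2
  have := phi_bound X Φ hX0 hΦ0 hend hΦ2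
  have h9 : 2*Real.exp Λ*Φ ≤ 2*Real.exp Λ*(3*X^3) := by gcongr
  rw [hC] at hcon
  linarith

theorem rough (H : ℝ) (hH1 : 1 ≤ H) : ∃ p0 : ℕ, ∃ C : ℝ, 0 < C ∧ ∀ (h : ℕ → ℝ), (∀ p, 1 ≤ h p) → (∀ p, h p ≤ H) →
    (∀ P : Finset ℕ, (∀ p ∈ P, p.Prime) → ∑ p ∈ P, Real.log (h p)/p ≤ H) →
    ∀ (e : ℕ → ℕ → ℕ) (P : Finset ℕ), (∀ p ∈ P, p.Prime) → (∀ p ∈ P, p0 ≤ p) → Bd P e h C := by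
  obtain ⟨p0, _, hq, hq6⟩ := exp0 H hH1 (3*H*(32*H)^6) (by positivity)
  refine ⟨p0, 6*Real.exp (4*(3*H*(32*H)^6)*H), by positivity, ?_⟩
  intro h h1 hH hlog e P
  induction P using Finset.strongInduction with
  | H P ih =>
    intro hP hPp
    refine rough_step hP h1 hH (hlog P hP) rfl (fun p hp => hq p (hPp p hp)) (hq6 P hPp) rfl ?_
    intro p hp
    exact ih _ (Finset.erase_ssubset hp) (fun r hr => hP r (Finset.mem_of_mem_erase hr))
      (fun r hr => hPp r (Finset.mem_of_mem_erase hr))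

lemma rt_half {p : ℕ} (hp : 2 ≤ p) : rt (1/(p:ℝ)) ≤ 85/100 := by
  have hp2 : (2:ℝ) ≤ p := by exact_mod_cast hp
  have h0 := rt_nonneg (1/(p:ℝ))
  apply le_of_pow_le_pow_left₀ (n := 4) (by norm_num) (by norm_num)
  rw [rt_pow _ (by positivity)]
  calc 1/(p:ℝ) ≤ 1/2 := by gcongr
    _ ≤ _ := by norm_num

lemma crude_step {P : Finset ℕ} (hP : ∀ p ∈ P, 2 ≤ p) {e : ℕ → ℕ → ℕ} {h : ℕ → ℝ} {H : ℝ} (h1 : ∀ p, 1 ≤ h p)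
    (hH : ∀ p, h p ≤ H) {p : ℕ} (hp : p ∈ P) {C : ℝ} (hC : 0 ≤ C) (hB : Bd (P.erase p) e h C) :
    Bd P e h (C*(13*H)) := by
  intro V W ψ θ hψ hθ hV hW
  obtain ⟨N, hNV, hNW⟩ := exN e p V W
  have hp0 : (0:ℝ) < p := by exact_mod_cast (by have := hP p hp; omega : 0 < p)
  have hH1 : 1 ≤ H := (h1 0).trans (hH 0)
  have key := crude H (rt (1/p)) C hH1 hC (rt_pos (by positivity)) (rt_half (hP p hp)) N
    (fun i => mass P e ψ (V.filter (fun v => e v p = i))) (fun i => mass P e θ (W.filter (fun v => e v p = i)))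
    (fun i => mass_nonneg hP hψ _) (fun i => mass_nonneg hP hθ _)
    (fun i j => ∑ v ∈ V.filter (fun v => e v p = i), ∑ w ∈ W.filter (fun w => e w p = j), tm P e h ψ θ v w)
    (fun i j => by
      have := step hP h1 hp hC hB V W hψ hθ hV hW i j
      refine this.trans ?_
      have := rt_nonneg (1/(p:ℝ))
      have := rt_nonneg (mass P e ψ (V.filter (fun v => e v p = i)))
      have := rt_nonneg (mass P e θ (W.filter (fun v => e v p = j)))
      gcongr
      split_ifs
      · exact hH1
      · exact hH p)
  rwa [mass_fib p N V hNV, mass_fib p N W hNW, fib e p N V W hNV hNW] at key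

theorem full (H : ℝ) (hH1 : 1 ≤ H) : ∃ C : ℝ, 0 < C ∧ ∀ (h : ℕ → ℝ), (∀ p, 1 ≤ h p) → (∀ p, h p ≤ H) →
    (∀ P : Finset ℕ, (∀ p ∈ P, p.Prime) → ∑ p ∈ P, Real.log (h p)/p ≤ H) →
    ∀ (e : ℕ → ℕ → ℕ) (P : Finset ℕ), (∀ p ∈ P, p.Prime) → Bd P e h C := by
  obtain ⟨p0, C, hC, hr⟩ := rough H hH1
  refine ⟨C*(13*H)^p0, by positivity, ?_⟩
  intro h h1 hH hlog e
  have key : ∀ n, ∀ P : Finset ℕ, (∀ p ∈ P, p.Prime) → (P.filter (· < p0)).card = n → Bd P e h (C*(13*H)^n) := by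
    intro n
    induction n with
    | zero =>
      intro P hP hcard
      rw [pow_zero, mul_one]
      refine hr h h1 hH hlog e P hP fun p hp => ?_
      by_contra hlt
      rw [Finset.card_eq_zero] at hcard
      have : p ∈ P.filter (· < p0) := Finset.mem_filter.2 ⟨hp, not_le.1 hlt⟩
      rw [hcard] at this
      simp at this
    | succ n ih =>
      intro P hP hcard
      have hne : (P.filter (· < p0)).Nonempty := by rw [← Finset.card_pos]; omega
      obtain ⟨p, hp⟩ := hne
      have hp' := (Finset.mem_filter.1 hp).1
      rw [pow_succ, ← mul_assoc]
      refine crude_step (fun p hp => (hP p hp).two_le) h1 hH hp' (by positivity)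
        (ih _ (fun r hr => hP r (Finset.mem_of_mem_erase hr)) ?_)
      rw [Finset.filter_erase, Finset.card_erase_of_mem hp]
      omega
  intro P hP V W ψ θ hψ hθ hV hW
  refine (key _ P hP rfl V W ψ θ hψ hθ hV hW).trans ?_
  have := rt_nonneg (mass P e ψ V)
  have := rt_nonneg (mass P e θ W)
  gcongr
  · linarith
  · refine (Finset.card_le_card (t := Finset.range p0) ?_).trans (by simp)
    intro p hp
    simpa using (Finset.mem_filter.1 hp).2

end DS


namespace DS

noncomputable section
def rr (n : ℕ) : ℝ := (Nat.totient n : ℝ)/n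
def Mf (m n : ℕ) : ℕ := (m / Nat.gcd m n)*(n / Nat.gcd m n)
def Lf (m n t : ℕ) : ℝ := ∑ p ∈ (Mf m n).primeFactors.filter (fun p => t < p), 1/(p:ℝ)
def Df (ψ : ℕ → ℝ) (m n : ℕ) : ℝ := max (m*ψ n) (n*ψ m)/(Nat.gcd m n)
def zf (ψ : ℕ → ℝ) (m n : ℕ) : ℕ := Nat.log 4 ⌊2*Df ψ m n⌋₊
end

lemma rr_prod {n : ℕ} (hn : n ≠ 0) : rr n = ∏ p ∈ n.primeFactors, (1-1/(p:ℝ)) := by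
  have h := Nat.totient_eq_mul_prod_factors n
  have h2 : (Nat.totient n : ℝ) = n*∏ p ∈ n.primeFactors, (1-((p:ℝ))⁻¹) := by
    have := congrArg (fun x : ℚ => (x:ℝ)) h
    push_cast at this
    exact this
  unfold rr
  have : (n:ℝ) ≠ 0 := by exact_mod_cast hn
  rw [h2]
  field_simp

lemma Mf_ne {m n : ℕ} (hm : m ≠ 0) (hn : n ≠ 0) : Mf m n ≠ 0 := by
  unfold Mf
  have h1 := Nat.div_pos (Nat.le_of_dvd (Nat.pos_of_ne_zero hm) (Nat.gcd_dvd_left m n)) (Nat.gcd_pos_of_pos_left n (Nat.pos_of_ne_zero hm))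
  have h2 := Nat.div_pos (Nat.le_of_dvd (Nat.pos_of_ne_zero hn) (Nat.gcd_dvd_right m n)) (Nat.gcd_pos_of_pos_left n (Nat.pos_of_ne_zero hm))
  positivity

lemma fact_div_gcd {m n : ℕ} (hm : m ≠ 0) (hn : n ≠ 0) (p : ℕ) :
    (m / Nat.gcd m n).factorization p = m.factorization p - n.factorization p := by
  rw [Nat.factorization_div (Nat.gcd_dvd_left m n), Nat.factorization_gcd hm hn]
  simp only [Finsupp.coe_tsub, Pi.sub_apply, Finsupp.inf_apply]
  omega

lemma mem_Mf {m n : ℕ} (hm : m ≠ 0) (hn : n ≠ 0) (p : ℕ) :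
    p ∈ (Mf m n).primeFactors ↔ m.factorization p ≠ n.factorization p := by
  have h := Mf_ne hm hn
  rw [← Nat.support_factorization, Finsupp.mem_support_iff]
  unfold Mf at *
  rw [Nat.factorization_mul (left_ne_zero_of_mul h) (right_ne_zero_of_mul h), Finsupp.add_apply,
    fact_div_gcd hm hn, Nat.gcd_comm, fact_div_gcd hn hm]
  omega

lemma aP_fact {P : Finset ℕ} {m n : ℕ} (hm : m ≠ 0) (hn : n ≠ 0) (hP : m.primeFactors ⊆ P) :
    aP P (fun v p => v.factorization p) m n = ((m / Nat.gcd m n : ℕ) : ℝ) := by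
  have h := Mf_ne hm hn
  have h1 := left_ne_zero_of_mul h
  rw [← Nat.prod_factorization_pow_eq_self h1, Finsupp.prod_of_support_subset (s := P)]
  · unfold aP
    push_cast
    refine Finset.prod_congr rfl fun p _ => ?_
    rw [fact_div_gcd hm hn]
  · rw [Nat.support_factorization]
    exact (Nat.primeFactors_mono (Nat.div_dvd_of_dvd (Nat.gcd_dvd_left m n)) hm).trans hP
  · simp

lemma rho_fact {P : Finset ℕ} {m : ℕ} (hm : m ≠ 0) (hP : m.primeFactors ⊆ P) :
    rho P (fun v p => v.factorization p) m = rr m := by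
  unfold rho
  rw [rr_prod hm, ← Finset.prod_subset hP (f := fun p => if m.factorization p = 0 then (1:ℝ) else 1-1/(p:ℝ))]
  · refine Finset.prod_congr rfl fun p hp => ?_
    rw [← Nat.support_factorization, Finsupp.mem_support_iff] at hp
    rw [if_neg hp]
  · intro p _ hp
    rw [← Nat.support_factorization, Finsupp.notMem_support_iff] at hp
    rw [if_pos hp]

lemma exp5 : (128:ℝ) ≤ Real.exp 5 := by
  have h := Real.exp_one_gt_d9
  have h2 : Real.exp 5 = Real.exp 1^5 := by rw [← Real.exp_nat_mul]; norm_num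
  rw [h2]
  calc (128:ℝ) ≤ 2.7^5 := by norm_num
    _ ≤ _ := by gcongr; linarith

lemma h_log (t : ℕ) (p : ℕ) : Real.log (if t < p then Real.exp (5*t/p) else 1) = if t < p then 5*(t:ℝ)/p else 0 := by
  split_ifs
  · rw [Real.log_exp]
  · exact Real.log_one

lemma h_sum (t : ℕ) (ht : 1 ≤ t) (P : Finset ℕ) :
    ∑ p ∈ P, Real.log (if t < p then Real.exp (5*t/p) else 1)/p ≤ 5 := by
  have ht' : (0:ℝ) < t := by exact_mod_cast ht
  calc _ = ∑ p ∈ P.filter (fun p => t < p), 5*(t:ℝ)/p/p := by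
        rw [Finset.sum_filter]
        refine Finset.sum_congr rfl fun p _ => ?_
        rw [h_log]; split_ifs <;> simp
    _ ≤ ∑ p ∈ P.filter (fun p => t < p), 5*(t:ℝ)*(1/((p:ℝ)*(p-1))) := by
        apply Finset.sum_le_sum
        intro p hp
        have h1 := (Finset.mem_filter.1 hp).2
        have h2 : (2:ℝ) ≤ p := by exact_mod_cast (by omega : 2 ≤ p)
        rw [div_div, mul_one_div]
        have : (0:ℝ) < p - 1 := by linarith
        gcongr
        linarith
    _ = 5*(t:ℝ)*∑ p ∈ P.filter (fun p => t < p), 1/((p:ℝ)*(p-1)) := by rw [Finset.mul_sum]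
    _ ≤ 5*(t:ℝ)*(1/t) := by
        gcongr
        exact tele' t ht _ fun p hp => (Finset.mem_filter.1 hp).2
    _ = 5 := by field_simp

lemma rr_nonneg (n : ℕ) : 0 ≤ rr n := by unfold rr; positivity

open Classical in
lemma tail : ∃ C : ℝ, 0 < C ∧ ∀ (ψ : ℕ → ℝ), (∀ n, 0 ≤ ψ n) → ∀ S : Finset ℕ, (∀ n ∈ S, n ≠ 0) →
    ∑ n ∈ S, ψ n*rr n ≤ 2 → ∀ t : ℕ, 1 ≤ t →
    ∑ m ∈ S, ∑ n ∈ S, (if ψ m*(n / Nat.gcd n m : ℕ) ≤ 4^(t+1) ∧ ψ n*(m / Nat.gcd m n : ℕ) ≤ 4^(t+1) ∧ 1 ≤ Lf m n t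
      then ψ m*rr m*(ψ n*rr n) else 0) ≤ C*(1/8)^t := by
  have hE := exp5
  obtain ⟨C, hC, hfull⟩ := full (Real.exp 5) (by linarith)
  refine ⟨16*C, by positivity, ?_⟩
  intro ψ hψ S hS hmass t ht
  have ht' : (0:ℝ) < t := by exact_mod_cast ht
  set h : ℕ → ℝ := fun p => if t < p then Real.exp (5*t/p) else 1 with hh
  have h1 : ∀ p, 1 ≤ h p := by
    intro p; simp only [hh]; split_ifs
    · exact Real.one_le_exp (by positivity)
    · exact le_rfl
  have hH : ∀ p, h p ≤ Real.exp 5 := by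
    intro p; simp only [hh]; split_ifs with hp
    · have hp' : (t:ℝ) < p := by exact_mod_cast hp
      apply Real.exp_le_exp.2
      rw [div_le_iff₀ (by linarith)]
      linarith
    · linarith
  set P := S.biUnion Nat.primeFactors with hP
  have hPp : ∀ p ∈ P, p.Prime := by
    intro p hp
    obtain ⟨n, _, hn⟩ := Finset.mem_biUnion.1 hp
    exact Nat.prime_of_mem_primeFactors hn
  have hPS : ∀ n ∈ S, n.primeFactors ⊆ P := fun n hn => Finset.subset_biUnion_of_mem _ hn
  set e : ℕ → ℕ → ℕ := fun v p => v.factorization p with he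
  have hinj : Inj P e S := by
    intro v hv w hw hvw
    refine Nat.eq_of_factorization_eq (hS v hv) (hS w hw) fun p => ?_
    by_cases hp : p ∈ P
    · exact hvw p hp
    · have h2 : ∀ n ∈ S, n.factorization p = 0 := by
        intro n hn
        rw [← Finsupp.notMem_support_iff, Nat.support_factorization]
        exact fun h => hp (hPS n hn h)
      rw [h2 v hv, h2 w hw]
  set c : ℝ := 4^(t+1) with hc
  have hc0 : 0 < c := by positivity
  have key := hfull h h1 hH (fun P _ => (h_sum t ht P).trans (by linarith)) e P hPp S S (fun n => ψ n/c) (fun n => ψ n/c)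
    (fun n => by have := hψ n; positivity) (fun n => by have := hψ n; positivity) hinj hinj
  have hmass2 : mass P e (fun n => ψ n/c) S ≤ 1 := by
    have : mass P e (fun n => ψ n/c) S = (∑ n ∈ S, ψ n*rr n)/c := by
      unfold mass
      rw [Finset.sum_div]
      refine Finset.sum_congr rfl fun n hn => ?_
      rw [rho_fact (hS n hn) (hPS n hn)]; ring
    rw [this, div_le_one hc0]
    have : (4:ℝ)^2 ≤ c := by rw [hc]; exact pow_le_pow_right₀ (by norm_num) (by omega)
    linarith
  have hrt : rt (mass P e (fun n => ψ n/c) S) ≤ 1 := by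
    have := rt_mono hmass2
    simpa [rt] using this
  have hrt0 := rt_nonneg (mass P e (fun n => ψ n/c) S)
  have hle : (rt (mass P e (fun n => ψ n/c) S)*rt (mass P e (fun n => ψ n/c) S))^3 ≤ 1 :=
    pow_le_one₀ (by positivity) (mul_le_one₀ hrt hrt0 hrt)
  have key2 : ∑ v ∈ S, ∑ w ∈ S, tm P e h (fun n => ψ n/c) (fun n => ψ n/c) v w ≤ C := by
    refine key.trans ?_
    calc _ ≤ C*1 := by gcongr
      _ = C := mul_one C
  have hpt : ∀ m ∈ S, ∀ n ∈ S, (if ψ m*(n / Nat.gcd n m : ℕ) ≤ c ∧ ψ n*(m / Nat.gcd m n : ℕ) ≤ c ∧ 1 ≤ Lf m n t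
      then ψ m*rr m*(ψ n*rr n) else 0) ≤ c^2/Real.exp (5*t)*tm P e h (fun n => ψ n/c) (fun n => ψ n/c) m n := by
    intro m hm n hn
    have htm := tm_nonneg (P := P) (fun p hp => (hPp p hp).two_le) (e := e) h1 (ψ := fun n => ψ n/c) (θ := fun n => ψ n/c)
      (fun n => by have := hψ n; positivity) (fun n => by have := hψ n; positivity) m n
    split_ifs with hcond
    swap
    · positivity
    obtain ⟨c1, c2, c3⟩ := hcond
    have hedge : edge P e (fun n => ψ n/c) (fun n => ψ n/c) m n := by
      unfold edge
      rw [aP_fact (hS m hm) (hS n hn) (hPS m hm), aP_fact (hS n hn) (hS m hm) (hPS n hn)]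
      constructor
      · rw [div_mul_eq_mul_div, div_le_one hc0]; exact c1
      · rw [div_mul_eq_mul_div, div_le_one hc0]; exact c2
    have hw : Real.exp (5*t) ≤ hwt P h e m n := by
      rw [← Real.le_log_iff_exp_le (hwt_pos h1 e m n), log_hwt h1]
      have : ∑ p ∈ P, (if e m p ≠ e n p then Real.log (h p) else 0) = 5*t*Lf m n t := by
        unfold Lf
        rw [Finset.mul_sum]
        have hsub : (Mf m n).primeFactors.filter (fun p => t < p) ⊆ P := by
          intro p hp
          have h3 := (Finset.mem_filter.1 hp).1
          rw [mem_Mf (hS m hm) (hS n hn)] at h3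
          by_contra hpP
          have h2 : ∀ n ∈ S, n.factorization p = 0 := by
            intro n hn
            rw [← Finsupp.notMem_support_iff, Nat.support_factorization]
            exact fun h => hpP (hPS n hn h)
          exact h3 (by rw [h2 m hm, h2 n hn])
        rw [← Finset.sum_subset hsub (f := fun p => if e m p ≠ e n p then Real.log (h p) else 0)]
        · refine Finset.sum_congr rfl fun p hp => ?_
          have h3 := Finset.mem_filter.1 hp
          rw [if_pos ((mem_Mf (hS m hm) (hS n hn) p).1 h3.1)]
          simp only [hh]
          rw [h_log, if_pos h3.2]
          ring
        · intro p _ hp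
          rw [Finset.mem_filter, mem_Mf (hS m hm) (hS n hn)] at hp
          split_ifs with h3
          · simp only [hh]
            rw [h_log, if_neg (fun h4 => hp ⟨h3, h4⟩)]
          · rfl
      rw [this]
      exact le_mul_of_one_le_right (by positivity) c3
    have hw0 : 0 < Real.exp (5*t) := Real.exp_pos _
    unfold tm
    rw [if_pos hedge, rho_fact (hS m hm) (hPS m hm), rho_fact (hS n hn) (hPS n hn)]
    have e1 : ψ m*rr m*(ψ n*rr n) = c^2/Real.exp (5*t)*(ψ m/c*rr m*(ψ n/c*rr n)*Real.exp (5*t)) := by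
      field_simp
    rw [e1]
    have := hψ m; have := hψ n; have := rr_nonneg m; have := rr_nonneg n
    gcongr
  calc _ ≤ ∑ m ∈ S, ∑ n ∈ S, c^2/Real.exp (5*t)*tm P e h (fun n => ψ n/c) (fun n => ψ n/c) m n :=
        Finset.sum_le_sum fun m hm => Finset.sum_le_sum fun n hn => hpt m hm n hn
    _ = c^2/Real.exp (5*t)*∑ m ∈ S, ∑ n ∈ S, tm P e h (fun n => ψ n/c) (fun n => ψ n/c) m n := by
        simp_rw [← Finset.mul_sum]
    _ ≤ c^2/Real.exp (5*t)*C := by gcongr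
    _ = 16*C*(16/Real.exp 5)^t := by
        have e2 : Real.exp (5*t) = Real.exp 5^t := by rw [← Real.exp_nat_mul]; ring_nf
        have e3 : c^2 = 16*16^t := by rw [hc, ← pow_mul, mul_comm, pow_mul, pow_succ]; norm_num; ring
        rw [e2, e3, div_pow]; ring
    _ ≤ 16*C*(1/8)^t := by
        have e4 : 16/Real.exp 5 ≤ 1/8 := by
          rw [div_le_div_iff₀ (by linarith) (by norm_num)]
          linarith
        gcongr 16*C*?_^t

lemma Lf_nonneg (m n t : ℕ) : 0 ≤ Lf m n t := Finset.sum_nonneg fun p _ => by positivity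

lemma Lf_split (m n z t : ℕ) : Lf m n z ≤ 1 + Real.log t + Lf m n t := by
  unfold Lf
  have h1 : (Mf m n).primeFactors.filter (fun p => z < p) ⊆
      Finset.Icc 1 t ∪ (Mf m n).primeFactors.filter (fun p => t < p) := by
    intro p hp
    have h2 := Finset.mem_filter.1 hp
    rw [Finset.mem_union, Finset.mem_Icc, Finset.mem_filter]
    have := (Nat.prime_of_mem_primeFactors h2.1).pos
    by_cases h : t < p
    · exact Or.inr ⟨h2.1, h⟩
    · exact Or.inl ⟨by omega, by omega⟩
  calc _ ≤ ∑ p ∈ Finset.Icc 1 t ∪ (Mf m n).primeFactors.filter (fun p => t < p), 1/(p:ℝ) :=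
        Finset.sum_le_sum_of_subset_of_nonneg h1 fun p _ _ => by positivity
    _ ≤ ∑ p ∈ Finset.Icc 1 t, 1/(p:ℝ) + ∑ p ∈ (Mf m n).primeFactors.filter (fun p => t < p), 1/(p:ℝ) := by
        rw [← Finset.sum_union_inter]
        have : 0 ≤ ∑ p ∈ Finset.Icc 1 t ∩ (Mf m n).primeFactors.filter (fun p => t < p), 1/(p:ℝ) :=
          Finset.sum_nonneg fun p _ => by positivity
        linarith
    _ ≤ _ := by
        have := harmonic_le_one_add_log t
        rw [harmonic_eq_sum_Icc] at this
        push_cast at this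
        simp_rw [one_div]
        linarith

open Classical in
lemma pointwise (m n z T : ℕ) (hT : Lf m n T < 1) (hzT : z ≤ T) :
    Real.exp (2*Lf m n z) ≤ Real.exp 2 + ∑ t ∈ Finset.Ico 1 T,
      if z ≤ t ∧ 1 ≤ Lf m n t then Real.exp 4*((t:ℝ)+1)^2 else 0 := by
  have hnn : ∀ t : ℕ, 0 ≤ (if z ≤ t ∧ 1 ≤ Lf m n t then Real.exp 4*((t:ℝ)+1)^2 else 0) := by
    intro t; split_ifs <;> positivity
  have hs0 := Finset.sum_nonneg (s := Finset.Ico 1 T) fun t _ => hnn t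
  have hex : ∃ t, z ≤ t ∧ Lf m n t < 1 := ⟨T, hzT, hT⟩
  obtain ⟨t1, ht1⟩ : ∃ t1, t1 = Nat.find hex := ⟨_, rfl⟩
  have hspec := Nat.find_spec hex
  rw [← ht1] at hspec
  rcases hspec.1.eq_or_lt with heq | hlt
  · have : Real.exp (2*Lf m n z) ≤ Real.exp 2 := by
      apply Real.exp_le_exp.2; rw [heq]; linarith [hspec.2]
    linarith
  · have hmin : ¬ (z ≤ t1-1 ∧ Lf m n (t1-1) < 1) := Nat.find_min hex (by omega)
    have hge : 1 ≤ Lf m n (t1-1) := by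
      by_contra h; exact hmin ⟨by omega, not_le.1 h⟩
    have hT1 : t1 ≤ T := by rw [ht1]; exact Nat.find_min' hex ⟨hzT, hT⟩
    have ht2 : 1 ≤ t1 - 1 := by
      by_contra h
      have h1 : t1 = 1 := by omega
      have : Lf m n 1 = Lf m n 0 := by
        unfold Lf
        congr 1
        apply Finset.filter_congr
        intro p hp
        have := (Nat.prime_of_mem_primeFactors hp).two_le
        omega
      rw [h1] at hge hspec
      rw [this] at hspec
      simp at hge
      linarith [hspec.2]
    have h3 := Finset.single_le_sum (f := fun t : ℕ => if z ≤ t ∧ 1 ≤ Lf m n t then Real.exp 4*((t:ℝ)+1)^2 else 0)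
      (fun t _ => hnn t) (Finset.mem_Ico.2 ⟨ht2, by omega⟩ : t1-1 ∈ Finset.Ico 1 T)
    beta_reduce at h3
    rw [if_pos ⟨by omega, hge⟩] at h3
    have ht0 : (0:ℝ) < t1 := by exact_mod_cast (by omega : 0 < t1)
    have h4 : ((t1-1 : ℕ):ℝ)+1 = t1 := by
      have : t1 - 1 + 1 = t1 := by omega
      exact_mod_cast this
    rw [h4] at h3
    have h5 : Real.exp (2*Lf m n z) ≤ Real.exp 4*(t1:ℝ)^2 := by
      have h6 := Lf_split m n z t1
      calc _ ≤ Real.exp (4 + 2*Real.log t1) := by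
            apply Real.exp_le_exp.2; linarith [hspec.2]
        _ = _ := by
          rw [Real.exp_add, two_mul (Real.log _), Real.exp_add, Real.exp_log ht0]; ring
    have := Real.exp_pos 2
    linarith

lemma zf_cond (ψ : ℕ → ℝ) (hψ : ∀ n, 0 ≤ ψ n) (m n t : ℕ) (hm : m ≠ 0) (h : zf ψ m n ≤ t) :
    ψ m*(n / Nat.gcd n m : ℕ) ≤ 4^(t+1) ∧ ψ n*(m / Nat.gcd m n : ℕ) ≤ 4^(t+1) := by
  have hg : (0:ℝ) < Nat.gcd m n := by exact_mod_cast Nat.gcd_pos_of_pos_left n (Nat.pos_of_ne_zero hm)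
  have hD0 : 0 ≤ Df ψ m n := by
    unfold Df
    have : 0 ≤ (m:ℝ)*ψ n := by have := hψ n; positivity
    have : 0 ≤ max ((m:ℝ)*ψ n) (n*ψ m) := le_max_of_le_left this
    positivity
  have h1 : ⌊2*Df ψ m n⌋₊ < 4^(t+1) := by
    have := Nat.lt_pow_succ_log_self (b := 4) (by norm_num) ⌊2*Df ψ m n⌋₊
    exact this.trans_le (Nat.pow_le_pow_right (by norm_num) (by unfold zf at h; omega))
  have h2 : 2*Df ψ m n < 4^(t+1) := by
    rw [Nat.floor_lt (by positivity)] at h1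
    exact_mod_cast h1
  have h3 : max ((m:ℝ)*ψ n) (n*ψ m)/(Nat.gcd m n) ≤ 4^(t+1) := by
    have : Df ψ m n ≤ 4^(t+1) := by linarith
    exact this
  have e1 : ((n / Nat.gcd n m : ℕ) : ℝ) = n/Nat.gcd m n := by
    rw [Nat.gcd_comm]; exact Nat.cast_div (Nat.gcd_dvd_right m n) hg.ne'
  have e2 : ((m / Nat.gcd m n : ℕ) : ℝ) = m/Nat.gcd m n :=
    Nat.cast_div (Nat.gcd_dvd_left m n) hg.ne'
  rw [e1, e2]
  constructor
  · refine le_trans ?_ h3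
    rw [mul_div_assoc', mul_comm]; gcongr; exact le_max_right _ _
  · refine le_trans ?_ h3
    rw [mul_div_assoc', mul_comm]; gcongr; exact le_max_left _ _

theorem anatomy : ∃ C : ℝ, 0 < C ∧ ∀ (ψ : ℕ → ℝ), (∀ n, 0 ≤ ψ n) → ∀ S : Finset ℕ, (∀ n ∈ S, n ≠ 0) →
    ∑ n ∈ S, ψ n*rr n ≤ 2 →
    ∑ m ∈ S, ∑ n ∈ S, ψ m*rr m*(ψ n*rr n)*Real.exp (2*Lf m n (zf ψ m n)) ≤ C := by
  classical
  obtain ⟨C, hC, htail⟩ := tail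
  refine ⟨Real.exp 2*4 + Real.exp 4*C*2, by positivity, ?_⟩
  intro ψ hψ S hS hmass
  obtain ⟨T, hT⟩ : ∃ T, ∀ m ∈ S, ∀ n ∈ S, Lf m n T < 1 ∧ zf ψ m n ≤ T := by
    refine ⟨S.sup (fun m => S.sup (fun n => Mf m n + zf ψ m n)), fun m hm n hn => ?_⟩
    have h1 : Mf m n + zf ψ m n ≤ S.sup (fun m => S.sup (fun n => Mf m n + zf ψ m n)) :=
      (Finset.le_sup (f := fun n => Mf m n + zf ψ m n) hn).trans
        (Finset.le_sup (f := fun m => S.sup (fun n => Mf m n + zf ψ m n)) hm)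
    refine ⟨?_, by omega⟩
    unfold Lf
    rw [Finset.filter_eq_empty_iff.2]
    · simp
    · intro p hp hlt
      have := Nat.le_of_mem_primeFactors hp
      omega
  set T' := T
  have hf0 : ∀ n, 0 ≤ ψ n*rr n := fun n => mul_nonneg (hψ n) (rr_nonneg n)
  set A : ℕ → ℕ → ℕ → ℝ := fun t m n => if ψ m*(n / Nat.gcd n m : ℕ) ≤ 4^(t+1) ∧ ψ n*(m / Nat.gcd m n : ℕ) ≤ 4^(t+1) ∧ 1 ≤ Lf m n t
      then ψ m*rr m*(ψ n*rr n) else 0 with hA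
  have hpt : ∀ m ∈ S, ∀ n ∈ S, ψ m*rr m*(ψ n*rr n)*Real.exp (2*Lf m n (zf ψ m n)) ≤
      Real.exp 2*(ψ m*rr m*(ψ n*rr n)) + ∑ t ∈ Finset.Ico 1 T, Real.exp 4*((t:ℝ)+1)^2*A t m n := by
    intro m hm n hn
    have h0 : 0 ≤ ψ m*rr m*(ψ n*rr n) := mul_nonneg (hf0 m) (hf0 n)
    have h1 := pointwise m n (zf ψ m n) T (hT m hm n hn).1 (hT m hm n hn).2
    refine (mul_le_mul_of_nonneg_left h1 h0).trans ?_
    rw [mul_add, mul_comm _ (Real.exp 2), Finset.mul_sum]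
    refine add_le_add le_rfl (Finset.sum_le_sum fun t ht => ?_)
    rw [hA]; beta_reduce
    split_ifs with h2 h3 h3
    · rw [mul_comm]
    · exact absurd ⟨(zf_cond ψ hψ m n t (hS m hm) h2.1).1, (zf_cond ψ hψ m n t (hS m hm) h2.1).2, h2.2⟩ h3
    · rw [mul_zero]; positivity
    · simp
  have hA0 : ∀ t m n, 0 ≤ A t m n := by
    intro t m n
    have := mul_nonneg (hf0 m) (hf0 n)
    rw [hA]; beta_reduce
    split_ifs
    · exact this
    · exact le_rfl
  have hpow : ∀ t : ℕ, ((t:ℝ)+1)^2 ≤ 4^t := by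
    intro t
    have h1 : t + 1 ≤ 2^t := Nat.lt_two_pow_self
    have h2 : (t:ℝ)+1 ≤ 2^t := by exact_mod_cast h1
    calc ((t:ℝ)+1)^2 ≤ (2^t)^2 := by gcongr
      _ = 4^t := by rw [← pow_mul, mul_comm, pow_mul]; norm_num
  calc _ ≤ ∑ m ∈ S, ∑ n ∈ S, (Real.exp 2*(ψ m*rr m*(ψ n*rr n)) +
          ∑ t ∈ Finset.Ico 1 T, Real.exp 4*((t:ℝ)+1)^2*A t m n) :=
        Finset.sum_le_sum fun m hm => Finset.sum_le_sum fun n hn => hpt m hm n hn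
    _ = Real.exp 2*((∑ n ∈ S, ψ n*rr n)*(∑ n ∈ S, ψ n*rr n)) +
          ∑ t ∈ Finset.Ico 1 T, Real.exp 4*((t:ℝ)+1)^2*∑ m ∈ S, ∑ n ∈ S, A t m n := by
        simp_rw [Finset.sum_add_distrib]
        congr 1
        · rw [Finset.sum_mul_sum]; simp_rw [Finset.mul_sum]
        · simp_rw [Finset.sum_comm (s := S) (t := Finset.Ico 1 T), Finset.mul_sum]
    _ ≤ Real.exp 2*(2*2) + ∑ t ∈ Finset.Ico 1 T, Real.exp 4*4^t*(C*(1/8)^t) := by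
        have hs := Finset.sum_nonneg (s := S) fun n _ => hf0 n
        gcongr with t ht
        · exact Finset.sum_nonneg fun m _ => Finset.sum_nonneg fun n _ => hA0 t m n
        · exact hpow t
        · exact htail ψ hψ S hS hmass t (Finset.mem_Ico.1 ht).1
    _ = Real.exp 2*4 + Real.exp 4*C*∑ t ∈ Finset.Ico 1 T, (1/2:ℝ)^t := by
        rw [Finset.mul_sum]
        congr 1
        · norm_num
        · refine Finset.sum_congr rfl fun t _ => ?_
          have : (4:ℝ)^t*(1/8)^t = (1/2)^t := by rw [← mul_pow]; norm_num
          rw [← this]; ring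
    _ ≤ Real.exp 2*4 + Real.exp 4*C*2 := by
        gcongr
        calc ∑ t ∈ Finset.Ico 1 T, (1/2:ℝ)^t ≤ ∑ t ∈ Finset.range T, (1/2:ℝ)^t := by
              apply Finset.sum_le_sum_of_subset_of_nonneg
              · intro t ht; simp at ht ⊢; omega
              · intro t _ _; positivity
          _ ≤ 2 := sum_geometric_two_le T

end DS


namespace DS

lemma rr_inv {c : ℕ} (hc : c ≠ 0) : 1/rr c = ∏ p ∈ c.primeFactors, (1+1/((p:ℝ)-1)) := by
  rw [rr_prod hc, one_div, ← Finset.prod_inv_distrib]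
  refine Finset.prod_congr rfl fun p hp => ?_
  have h2 : (2:ℝ) ≤ p := by exact_mod_cast (Nat.prime_of_mem_primeFactors hp).two_le
  have h3 : (p:ℝ) - 1 ≠ 0 := by linarith
  have h4 : (1:ℝ) - 1/p = (p-1)/p := by field_simp
  rw [h4, inv_div]
  field_simp
  ring

lemma big_part {c K : ℕ} (hc : c ≠ 0) (hcK : c ≤ K) :
    ∏ p ∈ c.primeFactors.filter (fun p => Nat.log 4 K < p), (1+1/((p:ℝ)-1)) ≤ Real.exp 3 := by
  set z := Nat.log 4 K with hz
  set A := c.primeFactors.filter (fun p => z < p) with hA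
  have hcard : A.card ≤ 2*z+1 := by
    have h1 : 2^A.card ≤ ∏ p ∈ c.primeFactors, p := by
      calc 2^A.card = ∏ p ∈ A, 2 := by simp
        _ ≤ ∏ p ∈ A, p := Finset.prod_le_prod' fun p hp =>
            (Nat.prime_of_mem_primeFactors (Finset.mem_filter.1 hp).1).two_le
        _ ≤ ∏ p ∈ c.primeFactors, p := Finset.prod_le_prod_of_subset_of_one_le' (Finset.filter_subset _ _)
            fun p hp _ => (Nat.prime_of_mem_primeFactors hp).one_le
    have h2 : ∏ p ∈ c.primeFactors, p ≤ c := Nat.le_of_dvd (Nat.pos_of_ne_zero hc) (Nat.prod_primeFactors_dvd c)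
    have h3 : K < 4^(z+1) := Nat.lt_pow_succ_log_self (by norm_num) K
    have h4 : (4:ℕ)^(z+1) = 2^(2*z+2) := by
      rw [show (4:ℕ) = 2^2 by norm_num, ← pow_mul]; ring_nf
    have h5 : 2^A.card < 2^(2*z+2) := by omega
    have := (Nat.pow_lt_pow_iff_right (by norm_num : 1 < 2)).1 h5
    omega
  set y : ℝ := ((max z 1 : ℕ) : ℝ) with hy
  have hy1 : (1:ℝ) ≤ y := by rw [hy]; exact_mod_cast le_max_right z 1
  have hyz : (z:ℝ) ≤ y := by rw [hy]; exact_mod_cast le_max_left z 1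
  calc ∏ p ∈ A, (1+1/((p:ℝ)-1)) ≤ ∏ p ∈ A, Real.exp (1/y) := by
        apply Finset.prod_le_prod
        · intro p hp
          have h2 : (2:ℝ) ≤ p := by exact_mod_cast (Nat.prime_of_mem_primeFactors (Finset.mem_filter.1 hp).1).two_le
          have h3 : (0:ℝ) < p - 1 := by linarith
          positivity
        · intro p hp
          have h2 := (Nat.prime_of_mem_primeFactors (Finset.mem_filter.1 hp).1).two_le
          have h4 := (Finset.mem_filter.1 hp).2
          have h5 : max z 1 + 1 ≤ p := by
            rcases le_total z 1 with h | h
            · rw [max_eq_right h]; exact h2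
            · rw [max_eq_left h]; exact h4
          have h6 : y + 1 ≤ p := by rw [hy]; exact_mod_cast h5
          calc 1+1/((p:ℝ)-1) ≤ 1+1/y := by gcongr; linarith
            _ ≤ _ := by linarith [Real.add_one_le_exp (1/y)]
    _ = Real.exp (A.card*(1/y)) := by rw [Finset.prod_const, Real.exp_nat_mul]
    _ ≤ Real.exp 3 := by
        apply Real.exp_le_exp.2
        rw [mul_one_div, div_le_iff₀ (by linarith)]
        have : (A.card:ℝ) ≤ 2*z+1 := by exact_mod_cast hcard
        linarith

lemma small_expand {z M c : ℕ} (hc : c ≠ 0) (hcop : Nat.Coprime c M) :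
    ∏ p ∈ c.primeFactors.filter (fun p => ¬ z < p), (1+1/((p:ℝ)-1)) =
      ∑ U ∈ ((Finset.range (z+1)).filter (fun p => p.Prime ∧ ¬ p ∣ M)).powerset,
        if (∏ p ∈ U, p) ∣ c then ∏ p ∈ U, (1/((p:ℝ)-1)) else 0 := by
  rw [Finset.prod_one_add, ← Finset.sum_filter]
  refine Finset.sum_congr ?_ fun _ _ => rfl
  ext U
  simp only [Finset.mem_powerset, Finset.mem_filter]
  constructor
  · intro h
    refine ⟨fun p hp => ?_, ?_⟩
    · have h1 := Finset.mem_filter.1 (h hp)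
      have hpp := Nat.prime_of_mem_primeFactors h1.1
      refine Finset.mem_filter.2 ⟨Finset.mem_range.2 (by omega), hpp, fun hd => ?_⟩
      exact hpp.one_lt.ne' (Nat.eq_one_of_dvd_coprimes hcop (Nat.dvd_of_mem_primeFactors h1.1) hd)
    · exact (Finset.prod_dvd_prod_of_subset _ _ _ (fun p hp => (Finset.mem_filter.1 (h hp)).1)).trans
        (Nat.prod_primeFactors_dvd c)
  · rintro ⟨h1, h2⟩ p hp
    have h3 := Finset.mem_filter.1 (h1 hp)
    refine Finset.mem_filter.2 ⟨Nat.mem_primeFactors.2 ⟨h3.2.1, (Finset.dvd_prod_of_mem _ hp).trans h2, hc⟩, ?_⟩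
    have := Finset.mem_range.1 h3.1
    omega

lemma count_d (K M d Mz : ℕ) (hd : 0 < d) (hMz : 0 < Mz) (hMzM : Mz ∣ M) (hle : d*Mz ≤ K) :
    (((Finset.Icc 1 K).filter (fun c => Nat.Coprime c M ∧ d ∣ c)).card : ℝ) ≤ 2*K*rr Mz/d := by
  have h1 : ((Finset.Icc 1 K).filter (fun c => Nat.Coprime c M ∧ d ∣ c)).card ≤
      ((Finset.Ico 1 (1+K/d)).filter (fun x => Mz.Coprime x)).card := by
    apply Finset.card_le_card_of_injOn (fun c => c/d)
    · intro c hc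
      simp only [Finset.coe_filter, Finset.mem_Icc, Set.mem_ofPred_eq, Finset.mem_Ico] at hc ⊢
      obtain ⟨⟨h1, h2⟩, h3, h4⟩ := hc
      refine ⟨⟨Nat.div_pos (Nat.le_of_dvd h1 h4) hd, ?_⟩, ?_⟩
      · have := Nat.div_le_div_right (c := d) h2; omega
      · exact ((Nat.Coprime.coprime_dvd_left (Nat.div_dvd_of_dvd h4) h3).coprime_dvd_right hMzM).symm
    · intro c hc c' hc' h
      simp only [Finset.coe_filter, Set.mem_ofPred_eq] at hc hc'
      exact Nat.div_left_inj hc.2.2 hc'.2.2 |>.1 h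
  have h2 := h1.trans (Nat.Ico_filter_coprime_le 1 (K/d) hMz.ne')
  have h3 : 1 ≤ K/d/Mz := by
    rw [Nat.div_div_eq_div_mul]
    exact Nat.div_pos hle (by positivity)
  have h4 : ((K/d/Mz : ℕ) : ℝ) ≤ K/(d*Mz) := by
    rw [Nat.div_div_eq_div_mul]
    calc _ ≤ (K:ℝ)/((d*Mz : ℕ):ℝ) := Nat.cast_div_le
      _ = _ := by push_cast; rfl
  have h3' : (1:ℝ) ≤ ((K/d/Mz : ℕ) : ℝ) := by exact_mod_cast h3
  have hd' : (0:ℝ) < d := by exact_mod_cast hd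
  have hM' : (0:ℝ) < Mz := by exact_mod_cast hMz
  calc (((Finset.Icc 1 K).filter (fun c => Nat.Coprime c M ∧ d ∣ c)).card : ℝ) ≤
        (Nat.totient Mz : ℝ)*(((K/d/Mz : ℕ) : ℝ)+1) := by exact_mod_cast h2
    _ ≤ (Nat.totient Mz : ℝ)*(2*(K/(d*Mz))) := by gcongr; linarith
    _ = _ := by unfold rr; field_simp

theorem sieve (K M : ℕ) (hK : 1 ≤ K) (hM : M ≠ 0) :
    ∑ c ∈ (Finset.Icc 1 K).filter (fun c => Nat.Coprime c M), 1/rr c ≤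
      Real.exp 3*6*K*∏ p ∈ M.primeFactors.filter (fun p => ¬ Nat.log 4 K < p), (1-1/(p:ℝ)) := by
  set z := Nat.log 4 K with hz
  set Q := (Finset.range (z+1)).filter (fun p => p.Prime ∧ ¬ p ∣ M) with hQ
  set MP := M.primeFactors.filter (fun p => ¬ z < p) with hMP
  set Mz := ∏ p ∈ MP, p with hMz
  have hMPp : ∀ p ∈ MP, p.Prime := fun p hp => Nat.prime_of_mem_primeFactors (Finset.mem_filter.1 hp).1
  have hMz0 : 0 < Mz := Finset.prod_pos fun p hp => (hMPp p hp).pos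
  have hMzpf : Mz.primeFactors = MP := Nat.primeFactors_prod hMPp
  have hMzM : Mz ∣ M := (Finset.prod_dvd_prod_of_subset _ _ _ (Finset.filter_subset _ _)).trans
    (Nat.prod_primeFactors_dvd M)
  have hprod : ∏ p ∈ MP, (1-1/(p:ℝ)) = rr Mz := by rw [rr_prod hMz0.ne', hMzpf]
  rw [hprod]
  have hQp : ∀ U ∈ Q.powerset, ∀ p ∈ U, p.Prime := fun U hU p hp =>
    (Finset.mem_filter.1 ((Finset.mem_powerset.1 hU) hp)).2.1
  have hdU : ∀ U ∈ Q.powerset, (∏ p ∈ U, p)*Mz ≤ K := by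
    intro U hU
    have hU' := Finset.mem_powerset.1 hU
    have hdisj : Disjoint U MP := by
      rw [Finset.disjoint_left]
      intro p hp hp2
      exact (Finset.mem_filter.1 (hU' hp)).2.2 (Nat.dvd_of_mem_primeFactors (Finset.mem_filter.1 hp2).1)
    rw [hMz, ← Finset.prod_union hdisj]
    calc ∏ p ∈ U ∪ MP, p ≤ ∏ p ∈ (Finset.range (z+1)).filter Nat.Prime, p := by
          apply Finset.prod_le_prod_of_subset_of_one_le'
          · intro p hp
            rcases Finset.mem_union.1 hp with h | h
            · have := Finset.mem_filter.1 (hU' h)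
              exact Finset.mem_filter.2 ⟨this.1, this.2.1⟩
            · have := (Finset.mem_filter.1 h).2
              exact Finset.mem_filter.2 ⟨Finset.mem_range.2 (by omega), hMPp p h⟩
          · intro p hp _
            exact (Finset.mem_filter.1 hp).2.one_le
      _ ≤ 4^z := primorial_le_four_pow z
      _ ≤ K := Nat.pow_log_le_self 4 (by omega)
  have hpt : ∀ c ∈ (Finset.Icc 1 K).filter (fun c => Nat.Coprime c M), 1/rr c ≤
      Real.exp 3*∑ U ∈ Q.powerset, if (∏ p ∈ U, p) ∣ c then ∏ p ∈ U, (1/((p:ℝ)-1)) else 0 := by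
    intro c hc
    rw [Finset.mem_filter, Finset.mem_Icc] at hc
    have hc0 : c ≠ 0 := by omega
    rw [rr_inv hc0, ← Finset.prod_filter_mul_prod_filter_not _ (fun p => z < p), ← small_expand hc0 hc.2]
    gcongr
    · apply Finset.prod_nonneg
      intro p hp
      have h2 : (2:ℝ) ≤ p := by exact_mod_cast (Nat.prime_of_mem_primeFactors (Finset.mem_filter.1 hp).1).two_le
      have h3 : (0:ℝ) < p - 1 := by linarith
      positivity
    · exact big_part hc0 hc.1.2
  have hU0 : ∀ U ∈ Q.powerset, 0 ≤ ∏ p ∈ U, (1/((p:ℝ)-1)) := by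
    intro U hU
    apply Finset.prod_nonneg
    intro p hp
    have h2 : (2:ℝ) ≤ p := by exact_mod_cast (hQp U hU p hp).two_le
    have h3 : (0:ℝ) < p - 1 := by linarith
    positivity
  calc _ ≤ ∑ c ∈ (Finset.Icc 1 K).filter (fun c => Nat.Coprime c M),
        Real.exp 3*∑ U ∈ Q.powerset, if (∏ p ∈ U, p) ∣ c then ∏ p ∈ U, (1/((p:ℝ)-1)) else 0 :=
        Finset.sum_le_sum hpt
    _ = Real.exp 3*∑ U ∈ Q.powerset, (((Finset.Icc 1 K).filter (fun c => Nat.Coprime c M ∧ (∏ p ∈ U, p) ∣ c)).card : ℝ)*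
        ∏ p ∈ U, (1/((p:ℝ)-1)) := by
        rw [← Finset.mul_sum, Finset.sum_comm]
        congr 1
        refine Finset.sum_congr rfl fun U _ => ?_
        rw [← Finset.sum_filter, Finset.filter_filter, Finset.sum_const, nsmul_eq_mul]
    _ ≤ Real.exp 3*∑ U ∈ Q.powerset, 2*K*rr Mz/((∏ p ∈ U, p : ℕ):ℝ)*∏ p ∈ U, (1/((p:ℝ)-1)) := by
        gcongr with U hU
        · exact hU0 U hU
        · exact count_d K M _ Mz (Finset.prod_pos fun p hp => (hQp U hU p hp).pos) hMz0 hMzM (hdU U hU)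
    _ = Real.exp 3*(2*K*rr Mz*∏ p ∈ Q, (1+1/((p:ℝ)*(p-1)))) := by
        rw [Finset.prod_one_add]
        congr 1
        rw [Finset.mul_sum]
        refine Finset.sum_congr rfl fun U _ => ?_
        rw [div_eq_mul_one_div, mul_assoc]
        congr 1
        push_cast
        rw [one_div, ← Finset.prod_inv_distrib, ← Finset.prod_mul_distrib]
        refine Finset.prod_congr rfl fun p _ => ?_
        rw [one_div, one_div, mul_inv]
    _ ≤ Real.exp 3*(2*K*rr Mz*3) := by
        have := rr_nonneg Mz
        gcongr
        exact prod_le_three Q fun p hp => (Finset.mem_filter.1 hp).2.1.two_le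
    _ = _ := by ring

end DS


namespace DS

lemma crt_count (g : ℕ) (hg : 0 < g) (A : ℕ → Finset ℕ) :
    ((Finset.range g).filter (fun t => ∀ p ∈ g.primeFactors, t % p ∈ A p)).card ≤
      (g / ∏ p ∈ g.primeFactors, p)*∏ p ∈ g.primeFactors, (A p).card := by
  set P := g.primeFactors with hP
  set Q := ∏ p ∈ P, p with hQ
  have hQg : Q ∣ g := Nat.prod_primeFactors_dvd g
  have hQ0 : 0 < Q := Nat.pos_of_dvd_of_pos hQg hg
  rw [← Finset.card_pi P A, ← Finset.card_range (g/Q), ← Finset.card_product]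
  apply Finset.card_le_card_of_injOn (fun t => (t/Q, fun p _ => t % p))
  · intro t ht
    simp only [Finset.coe_filter, Finset.mem_range, Set.mem_ofPred_eq] at ht
    simp only [Finset.coe_product, Set.mem_prod, Finset.mem_coe, Finset.mem_range, Finset.mem_pi]
    exact ⟨Nat.div_lt_div_of_lt_of_dvd hQg ht.1, fun p hp => ht.2 p hp⟩
  · intro t _ s _ h
    simp only [Prod.mk.injEq] at h
    have h1 : (Q:ℤ) ∣ (t:ℤ) - s := by
      rw [hQ]; push_cast
      have : ∀ p ∈ P, (p:ℤ) ∣ (t:ℤ) - s := by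
        intro p hp
        have h2 : t % p = s % p := congrFun (congrFun h.2 p) hp
        exact (Nat.modEq_iff_dvd.1 (show s ≡ t [MOD p] from h2.symm))
      have h3 : Q ∣ ((t:ℤ) - s).natAbs := by
        apply Finset.prod_primes_dvd
        · intro p hp; exact (Nat.prime_of_mem_primeFactors hp).prime
        · intro p hp; exact Int.natCast_dvd.1 (this p hp)
      have h4 := Int.natCast_dvd.2 h3
      rw [hQ] at h4
      push_cast at h4
      exact h4
    have h2 : s % Q = t % Q := Nat.modEq_iff_dvd.2 h1
    rw [← Nat.div_add_mod t Q, ← Nat.div_add_mod s Q, h.1, h2]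

lemma root {p : ℕ} (hp : p.Prime) (x k : ℤ) (hk : ¬ (p:ℤ) ∣ k) : ∃ t < p, (p:ℤ) ∣ x + k*t := by
  haveI := Fact.mk hp
  refine ⟨(-(x:ZMod p)/(k:ZMod p)).val, ZMod.val_lt _, ?_⟩
  rw [← ZMod.intCast_zmod_eq_zero_iff_dvd]
  have : (k:ZMod p) ≠ 0 := by rwa [Ne, ZMod.intCast_zmod_eq_zero_iff_dvd]
  push_cast
  rw [ZMod.natCast_zmod_val]
  field_simp
  ring

lemma local_count {p : ℕ} (hp : p.Prime) (c u v m1 n1 : ℤ) (huv : u*n1 - v*m1 = 1) :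
    (((Finset.range p).filter (fun t : ℕ => ¬ (p:ℤ) ∣ (c*u+m1*t) ∧ ¬ (p:ℤ) ∣ (c*v+n1*t))).card : ℝ) ≤
      p*((1-1/(p:ℝ))*(if (p:ℤ) ∣ m1*n1*c then 1 else (1-1/(p:ℝ)))) := by
  have hpZ : Prime (p:ℤ) := Nat.prime_iff_prime_int.1 hp
  have hp0 : (0:ℝ) < p := by exact_mod_cast hp.pos
  set A := (Finset.range p).filter (fun t : ℕ => ¬ (p:ℤ) ∣ (c*u+m1*t) ∧ ¬ (p:ℤ) ∣ (c*v+n1*t)) with hA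
  split_ifs with h
  · have hex : ∃ t < p, t ∉ A := by
      by_cases h1 : (p:ℤ) ∣ m1
      · have h2 : ¬ (p:ℤ) ∣ n1 := by
          intro h2
          have : (p:ℤ) ∣ 1 := by rw [← huv]; exact dvd_sub (h2.mul_left u) (h1.mul_left v)
          exact hpZ.not_unit (isUnit_of_dvd_one this)
        obtain ⟨t, ht, ht2⟩ := root hp (c*v) n1 h2
        exact ⟨t, ht, fun h => (Finset.mem_filter.1 h).2.2 ht2⟩
      · obtain ⟨t, ht, ht2⟩ := root hp (c*u) m1 h1
        exact ⟨t, ht, fun h => (Finset.mem_filter.1 h).2.1 ht2⟩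
    obtain ⟨t, ht, htA⟩ := hex
    have hc : A.card ≤ p - 1 := by
      have : A ⊆ (Finset.range p).erase t := by
        intro s hs
        exact Finset.mem_erase.2 ⟨fun h => htA (h ▸ hs), (Finset.mem_filter.1 hs).1⟩
      have := Finset.card_le_card this
      rwa [Finset.card_erase_of_mem (Finset.mem_range.2 ht), Finset.card_range] at this
    have hc2 : (A.card:ℝ) + 1 ≤ p := by
      have := hp.pos
      exact_mod_cast (by omega : A.card + 1 ≤ p)
    have : p*((1-1/(p:ℝ))*1) = p - 1 := by field_simp
    linarith
  · have h1 : ¬ (p:ℤ) ∣ m1 := fun h1 => h ((h1.mul_right n1).mul_right c)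
    have h2 : ¬ (p:ℤ) ∣ n1 := fun h1 => h ((h1.mul_left m1).mul_right c)
    have h3 : ¬ (p:ℤ) ∣ c := fun h1 => h (h1.mul_left _)
    obtain ⟨t, ht, ht2⟩ := root hp (c*u) m1 h1
    obtain ⟨s, hs, hs2⟩ := root hp (c*v) n1 h2
    have hts : t ≠ s := by
      intro hts
      rw [← hts] at hs2
      apply h3
      have : c = n1*(c*u+m1*t) - m1*(c*v+n1*t) := by linear_combination (-c)*huv
      rw [this]
      exact dvd_sub (ht2.mul_left _) (hs2.mul_left _)
    have hc : A.card ≤ p - 1 - 1 := by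
      have : A ⊆ ((Finset.range p).erase t).erase s := by
        intro r hr
        have hr' := Finset.mem_filter.1 hr
        refine Finset.mem_erase.2 ⟨fun h => hr'.2.2 (h ▸ hs2), Finset.mem_erase.2 ⟨fun h => hr'.2.1 (h ▸ ht2), hr'.1⟩⟩
      have := Finset.card_le_card this
      rwa [Finset.card_erase_of_mem (Finset.mem_erase.2 ⟨hts.symm, Finset.mem_range.2 hs⟩),
        Finset.card_erase_of_mem (Finset.mem_range.2 ht), Finset.card_range] at this
    have hc2 : (A.card:ℝ) + 2 ≤ p := by
      have := hp.two_le
      exact_mod_cast (by omega : A.card + 2 ≤ p)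
    have e1 : p*((1-1/(p:ℝ))*(1-1/(p:ℝ))) = p - 2 + 1/p := by field_simp; ring
    have e2 : 0 < 1/(p:ℝ) := by positivity
    linarith

def Xc (g m1 n1 : ℕ) (c : ℤ) : Finset (ℕ × ℕ) :=
  (Finset.range (g*m1) ×ˢ Finset.range (g*n1)).filter (fun x => Nat.Coprime x.1 (g*m1) ∧ Nat.Coprime x.2 (g*n1) ∧
    ((g*m1*n1 : ℕ) : ℤ) ∣ (x.1:ℤ)*n1 - x.2*m1 - c)

lemma card_Xc (g m1 n1 : ℕ) (hg : 0 < g) (hm : 0 < m1) (hn : 0 < n1) (hcop : Nat.Coprime m1 n1) (c : ℤ) :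
    ((Xc g m1 n1 c).card : ℝ) ≤
      g*∏ p ∈ g.primeFactors, ((1-1/(p:ℝ))*(if (p:ℤ) ∣ (m1:ℤ)*n1*c then 1 else (1-1/(p:ℝ)))) := by
  obtain ⟨u, v, huv⟩ : ∃ u v : ℤ, u*n1 - v*m1 = 1 := by
    have h := Int.isCoprime_iff_gcd_eq_one.2 (show Int.gcd (n1:ℤ) m1 = 1 from by simpa using hcop.symm)
    obtain ⟨a, b, hab⟩ := h
    exact ⟨a, -b, by linarith⟩
  set A : ℕ → Finset ℕ := fun p =>
    (Finset.range p).filter (fun t : ℕ => ¬ (p:ℤ) ∣ (c*u+m1*t) ∧ ¬ (p:ℤ) ∣ (c*v+n1*t)) with hA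
  have hgZ : (0:ℤ) < g := by exact_mod_cast hg
  have key : ∀ x ∈ Xc g m1 n1 c, ((g*m1 : ℕ):ℤ) ∣ (x.1:ℤ) - (c*u+m1*((u*x.2-v*x.1) % g)) ∧
      ((g*n1 : ℕ):ℤ) ∣ (x.2:ℤ) - (c*v+n1*((u*x.2-v*x.1) % g)) := by
    intro x hx
    obtain ⟨k, hk⟩ := (Finset.mem_filter.1 hx).2.2.2
    push_cast at hk
    have hmod := Int.emod_add_mul_ediv (u*x.2-v*x.1) g
    set r := (u*(x.2:ℤ)-v*x.1) % g
    set q := (u*(x.2:ℤ)-v*x.1) / g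
    constructor
    · refine ⟨u*n1*k + q, ?_⟩
      push_cast
      linear_combination (-(x.1:ℤ))*huv + u*hk - m1*hmod
    · refine ⟨v*m1*k + q, ?_⟩
      push_cast
      linear_combination (-(x.2:ℤ))*huv + v*hk - n1*hmod
  have h1 : (Xc g m1 n1 c).card ≤ ((Finset.range g).filter (fun t => ∀ p ∈ g.primeFactors, t % p ∈ A p)).card := by
    apply Finset.card_le_card_of_injOn (fun x => ((u*x.2-v*x.1) % g).toNat)
    · intro x hx
      have hk := key x hx
      have hx' := Finset.mem_filter.1 hx
      have hr0 := Int.emod_nonneg (u*(x.2:ℤ)-v*x.1) hgZ.ne'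
      have hr1 := Int.emod_lt_of_pos (u*(x.2:ℤ)-v*x.1) hgZ
      set r := (u*(x.2:ℤ)-v*x.1) % g with hr
      simp only [Finset.coe_filter, Finset.mem_range, Set.mem_ofPred_eq]
      refine ⟨by omega, fun p hp => ?_⟩
      have hpp := Nat.prime_of_mem_primeFactors hp
      have hpg := Nat.dvd_of_mem_primeFactors hp
      have hpd : (p:ℤ) ∣ r - ((r.toNat % p : ℕ) : ℤ) := by
        push_cast
        rw [Int.toNat_of_nonneg hr0]
        exact Int.dvd_self_sub_emod
      refine Finset.mem_filter.2 ⟨Finset.mem_range.2 (Nat.mod_lt _ hpp.pos), fun hd => ?_, fun hd => ?_⟩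
      · have e1 : (p:ℤ) ∣ (x.1:ℤ) := by
          have e2 : (p:ℤ) ∣ (x.1:ℤ) - (c*u+m1*r) := (Int.natCast_dvd_natCast.2 (hpg.mul_right m1)).trans hk.1
          have : (x.1:ℤ) = ((x.1:ℤ) - (c*u+m1*r)) + (c*u+m1*((r.toNat % p : ℕ) : ℤ)) +
            m1*(r - ((r.toNat % p : ℕ) : ℤ)) := by ring
          rw [this]
          exact dvd_add (dvd_add e2 hd) (hpd.mul_left _)
        exact hpp.one_lt.ne' (Nat.eq_one_of_dvd_coprimes hx'.2.1 (Int.natCast_dvd_natCast.1 e1) (hpg.mul_right m1))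
      · have e1 : (p:ℤ) ∣ (x.2:ℤ) := by
          have e2 : (p:ℤ) ∣ (x.2:ℤ) - (c*v+n1*r) := (Int.natCast_dvd_natCast.2 (hpg.mul_right n1)).trans hk.2
          have : (x.2:ℤ) = ((x.2:ℤ) - (c*v+n1*r)) + (c*v+n1*((r.toNat % p : ℕ) : ℤ)) +
            n1*(r - ((r.toNat % p : ℕ) : ℤ)) := by ring
          rw [this]
          exact dvd_add (dvd_add e2 hd) (hpd.mul_left _)
        exact hpp.one_lt.ne' (Nat.eq_one_of_dvd_coprimes hx'.2.2.1 (Int.natCast_dvd_natCast.1 e1) (hpg.mul_right n1))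
    · intro x hx y hy hxy
      have hkx := key x hx
      have hky := key y hy
      have hx' := Finset.mem_filter.1 hx
      have hy' := Finset.mem_filter.1 hy
      have hx2 := Finset.mem_product.1 hx'.1
      have hy2 := Finset.mem_product.1 hy'.1
      simp only [Finset.mem_range] at hx2 hy2
      have hr0 := Int.emod_nonneg (u*(x.2:ℤ)-v*x.1) hgZ.ne'
      have hr1 := Int.emod_nonneg (u*(y.2:ℤ)-v*y.1) hgZ.ne'
      have hreq : (u*(x.2:ℤ)-v*x.1) % g = (u*(y.2:ℤ)-v*y.1) % g := by
        simp only at hxy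
        omega
      rw [hreq] at hkx
      set r := (u*(y.2:ℤ)-v*y.1) % g
      have d1 : ((g*m1 : ℕ):ℤ) ∣ (x.1:ℤ) - y.1 := by
        have := dvd_sub hkx.1 hky.1
        ring_nf at this ⊢
        exact this
      have d2 : ((g*n1 : ℕ):ℤ) ∣ (x.2:ℤ) - y.2 := by
        have := dvd_sub hkx.2 hky.2
        ring_nf at this ⊢
        exact this
      refine Prod.ext ?_ ?_
      · have := Nat.modEq_iff_dvd.2 d1
        exact (Nat.ModEq.eq_of_lt_of_lt this hy2.1 hx2.1).symm
      · have := Nat.modEq_iff_dvd.2 d2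
        exact (Nat.ModEq.eq_of_lt_of_lt this hy2.2 hx2.2).symm
  have h2 := h1.trans (crt_count g hg A)
  have hQ0 : (0:ℝ) < ((∏ p ∈ g.primeFactors, p : ℕ):ℝ) := by
    exact_mod_cast Finset.prod_pos fun p hp => (Nat.prime_of_mem_primeFactors hp).pos
  calc ((Xc g m1 n1 c).card : ℝ) ≤ ((g / ∏ p ∈ g.primeFactors, p : ℕ):ℝ)*∏ p ∈ g.primeFactors, ((A p).card:ℝ) := by
        exact_mod_cast h2
    _ ≤ ((g / ∏ p ∈ g.primeFactors, p : ℕ):ℝ)*∏ p ∈ g.primeFactors,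
        (p*((1-1/(p:ℝ))*(if (p:ℤ) ∣ (m1:ℤ)*n1*c then 1 else (1-1/(p:ℝ))))) := by
        gcongr with p hp
        exact local_count (Nat.prime_of_mem_primeFactors hp) c u v m1 n1 huv
    _ = _ := by
        rw [Nat.cast_div (Nat.prod_primeFactors_dvd g) hQ0.ne', Finset.prod_mul_distrib, ← mul_assoc]
        congr 1
        push_cast
        push_cast at hQ0
        field_simp

lemma Xc_coprime (g m1 n1 : ℕ) (hcop : Nat.Coprime m1 n1) (c : ℤ) {x : ℕ × ℕ} (hx : x ∈ Xc g m1 n1 c) :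
    Nat.Coprime c.natAbs (m1*n1) := by
  have hx' := Finset.mem_filter.1 hx
  have hd := hx'.2.2.2
  have one : ∀ {a b p : ℕ}, p.Prime → Nat.Coprime a b → p ∣ a → p ∣ b → False := fun hp h h1 h2 =>
    hp.one_lt.ne' (Nat.eq_one_of_dvd_coprimes h h1 h2)
  apply Nat.Coprime.mul_right
  · refine Nat.coprime_of_dvd fun p hp hpc hpm => ?_
    have e1 : (p:ℤ) ∣ (x.1:ℤ)*n1 := by
      have h1 : (p:ℤ) ∣ (x.1:ℤ)*n1 - x.2*m1 - c :=
        (Int.natCast_dvd_natCast.2 ((hpm.mul_left g).mul_right n1)).trans hd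
      have h2 : (p:ℤ) ∣ c := Int.natCast_dvd.2 hpc
      have h3 : (p:ℤ) ∣ (x.2:ℤ)*m1 := (Int.natCast_dvd_natCast.2 hpm).mul_left _
      have : (x.1:ℤ)*n1 = ((x.1:ℤ)*n1 - x.2*m1 - c) + x.2*m1 + c := by ring
      rw [this]
      exact dvd_add (dvd_add h1 h3) h2
    have e2 : p ∣ x.1*n1 := by exact_mod_cast e1
    rcases (Nat.Prime.dvd_mul hp).1 e2 with h | h
    · exact one hp hx'.2.1 h (hpm.mul_left g)
    · exact one hp hcop hpm h
  · refine Nat.coprime_of_dvd fun p hp hpc hpn => ?_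
    have e1 : (p:ℤ) ∣ (x.2:ℤ)*m1 := by
      have h1 : (p:ℤ) ∣ (x.1:ℤ)*n1 - x.2*m1 - c :=
        (Int.natCast_dvd_natCast.2 (hpn.mul_left (g*m1))).trans hd
      have h2 : (p:ℤ) ∣ c := Int.natCast_dvd.2 hpc
      have h3 : (p:ℤ) ∣ (x.1:ℤ)*n1 := (Int.natCast_dvd_natCast.2 hpn).mul_left _
      have : (x.2:ℤ)*m1 = (x.1:ℤ)*n1 - ((x.1:ℤ)*n1 - x.2*m1 - c) - c := by ring
      rw [this]
      exact dvd_sub (dvd_sub h3 h1) h2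
    have e2 : p ∣ x.2*m1 := by exact_mod_cast e1
    rcases (Nat.Prime.dvd_mul hp).1 e2 with h | h
    · exact one hp hx'.2.2.1 h (hpn.mul_left g)
    · exact one hp hcop h hpn

end DS


namespace DS
open Finset

lemma prime_pos_facts {p : ℕ} (hp : p.Prime) : (0:ℝ) < 1 - 1/(p:ℝ) ∧ (1:ℝ) - 1/(p:ℝ) ≤ 1 ∧ (1 - 1/(p:ℝ)) * (1 + 1/((p:ℝ)-1)) = 1 ∧ 1 ≤ 1 + 1/((p:ℝ)-1) ∧ 1 ≤ (1 - 1/(p:ℝ)) * Real.exp (2 * (1/(p:ℝ))) := by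
  have h2 : (2:ℝ) ≤ p := by exact_mod_cast hp.two_le
  have h3 : (1:ℝ)/p ≤ 1/2 := by
    apply one_div_le_one_div_of_le <;> linarith
  have h4 : (0:ℝ) < 1/p := by positivity
  refine ⟨by linarith, by linarith, ?_, ?_, ?_⟩
  · have : (p:ℝ) - 1 ≠ 0 := by linarith
    field_simp
    ring
  · have : (0:ℝ) < (p:ℝ) - 1 := by linarith
    have : (0:ℝ) < 1/((p:ℝ)-1) := by positivity
    linarith
  · have := Real.add_one_le_exp (2 * (1/(p:ℝ)))
    nlinarith [Real.exp_pos (2 * (1/(p:ℝ)))]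

noncomputable def RR (g M : ℕ) : ℝ := ∏ p ∈ g.primeFactors.filter (fun p => ¬ p ∣ M), (1 - 1/(p:ℝ))

lemma RR_nonneg (g M : ℕ) : 0 ≤ RR g M := by
  apply prod_nonneg
  intro p hp
  exact (prime_pos_facts (Nat.prime_of_mem_primeFactors (mem_filter.1 hp).1)).1.le

lemma prodG (g m1 n1 : ℕ) (hg : 0 < g) (c : ℤ) (hc : c ≠ 0) :
    ∏ p ∈ g.primeFactors, ((1-1/(p:ℝ)) * (if (p:ℤ) ∣ (m1:ℤ)*n1*c then 1 else (1-1/(p:ℝ))))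
      ≤ rr g * (RR g (m1*n1) * (1 / rr c.natAbs)) := by
  rw [prod_mul_distrib, ← rr_prod hg.ne']
  apply mul_le_mul_of_nonneg_left _ (rr_nonneg g)
  have e1 : ∏ p ∈ g.primeFactors, (if (p:ℤ) ∣ (m1:ℤ)*n1*c then (1:ℝ) else (1-1/(p:ℝ)))
      = RR g (m1*n1) * ∏ p ∈ g.primeFactors.filter (fun p => ¬ p ∣ m1*n1), (if p ∣ c.natAbs then (1 + 1/((p:ℝ)-1)) else 1) := by
    unfold RR
    rw [← prod_mul_distrib, prod_filter]
    apply prod_congr rfl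
    intro p hp
    have hpp := Nat.prime_of_mem_primeFactors hp
    obtain ⟨h1, h2, h3, h4, h5⟩ := prime_pos_facts hpp
    have hiff : (p:ℤ) ∣ (m1:ℤ)*n1*c ↔ (p ∣ m1*n1 ∨ p ∣ c.natAbs) := by
      rw [(Nat.prime_iff_prime_int.1 hpp).dvd_mul, ← Int.natCast_dvd]
      norm_cast
    by_cases hM : p ∣ m1*n1
    · simp [hiff, hM]
    · by_cases hcc : p ∣ c.natAbs
      · simp only [hiff, hM, hcc, or_true, if_true, not_false_iff]; rw [h3]
      · simp only [hiff, hM, hcc, or_false, if_false, not_false_iff, if_true, mul_one]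
  rw [e1]
  apply mul_le_mul_of_nonneg_left _ (RR_nonneg _ _)
  rw [rr_inv (Int.natAbs_ne_zero.2 hc), ← prod_filter]
  apply prod_le_prod_of_subset_of_one_le
  · intro p hp
    simp only [mem_filter] at hp
    exact Nat.mem_primeFactors.2 ⟨Nat.prime_of_mem_primeFactors hp.1.1, hp.2, Int.natAbs_ne_zero.2 hc⟩
  · intro p hp
    simp only [mem_filter] at hp
    have := (prime_pos_facts (Nat.prime_of_mem_primeFactors hp.1.1)).2.2.2.1
    linarith
  · intro p hp _
    exact (prime_pos_facts (Nat.prime_of_mem_primeFactors hp)).2.2.2.1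

lemma rr_mul_rr (g m1 n1 : ℕ) (hg : 0 < g) (hm : 0 < m1) (hn : 0 < n1) (hcop : Nat.Coprime m1 n1) :
    rr (g*m1) * rr (g*n1) = rr g * RR g (m1*n1) * rr (m1*n1) := by
  have hM : m1*n1 ≠ 0 := (Nat.mul_pos hm hn).ne'
  rw [rr_prod (Nat.mul_pos hg hm).ne', rr_prod (Nat.mul_pos hg hn).ne', rr_prod hg.ne', rr_prod hM, RR,
    ← prod_union_inter]
  have hin : (g*m1).primeFactors ∩ (g*n1).primeFactors = g.primeFactors := by
    ext p
    simp only [mem_inter, Nat.mem_primeFactors]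
    constructor
    · rintro ⟨⟨hp, h1, _⟩, _, h2, _⟩
      refine ⟨hp, ?_, hg.ne'⟩
      by_contra hpg
      have h1 := (hp.dvd_mul.1 h1).resolve_left hpg
      have h2 := (hp.dvd_mul.1 h2).resolve_left hpg
      exact Nat.not_coprime_of_dvd_of_dvd hp.one_lt h1 h2 hcop
    · rintro ⟨hp, h1, _⟩
      exact ⟨⟨hp, h1.mul_right _, (Nat.mul_pos hg hm).ne'⟩, hp, h1.mul_right _, (Nat.mul_pos hg hn).ne'⟩
  have hun : (g*m1).primeFactors ∪ (g*n1).primeFactors = (g.primeFactors.filter (fun p => ¬ p ∣ m1*n1)) ∪ (m1*n1).primeFactors := by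
    ext p
    simp only [mem_union, mem_filter, Nat.mem_primeFactors]
    by_cases hp : p.Prime
    · have := (Nat.mul_pos hg hm).ne'
      have := (Nat.mul_pos hg hn).ne'
      have := hg.ne'
      simp only [hp.dvd_mul]
      tauto
    · tauto
  rw [hin, hun, prod_union]
  · ring
  · rw [disjoint_left]
    intro p hp hp2
    exact (mem_filter.1 hp).2 (Nat.dvd_of_mem_primeFactors hp2)

lemma sieve_to_exp (M z : ℕ) (hM : M ≠ 0) :
    ∏ p ∈ M.primeFactors.filter (fun p => ¬ z < p), (1-1/(p:ℝ)) ≤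
      rr M * Real.exp (2 * ∑ p ∈ M.primeFactors.filter (fun p => z < p), 1/(p:ℝ)) := by
  rw [rr_prod hM, ← prod_filter_mul_prod_filter_not M.primeFactors (fun p => z < p), mul_sum, Real.exp_sum,
    mul_comm (∏ p ∈ M.primeFactors.filter (fun p => z < p), (1-1/(p:ℝ))), mul_assoc, ← prod_mul_distrib]
  apply le_mul_of_one_le_right
  · apply prod_nonneg
    intro p hp
    exact (prime_pos_facts (Nat.prime_of_mem_primeFactors (mem_filter.1 hp).1)).1.le
  · refine le_of_eq_of_le prod_const_one.symm (prod_le_prod (fun _ _ => zero_le_one) ?_)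
    intro p hp
    exact (prime_pos_facts (Nat.prime_of_mem_primeFactors (mem_filter.1 hp).1)).2.2.2.2

lemma card_Xc_le (g m1 n1 : ℕ) (hg : 0 < g) (hm : 0 < m1) (hn : 0 < n1) (hcop : Nat.Coprime m1 n1)
    (c : ℤ) (hc : c ≠ 0) :
    ((Xc g m1 n1 c).card : ℝ) ≤ if Nat.Coprime c.natAbs (m1*n1) then g * (rr g * (RR g (m1*n1) * (1 / rr c.natAbs))) else 0 := by
  split_ifs with h
  · refine (card_Xc g m1 n1 hg hm hn hcop c).trans ?_
    exact mul_le_mul_of_nonneg_left (prodG g m1 n1 hg c hc) (by positivity)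
  · rw [Nat.cast_nonpos, card_eq_zero, eq_empty_iff_forall_notMem]
    intro x hx
    exact h (Xc_coprime g m1 n1 hcop c hx)

lemma sum_Xc_le (g m1 n1 K : ℕ) (hg : 0 < g) (hm : 0 < m1) (hn : 0 < n1) (hcop : Nat.Coprime m1 n1) :
    ∑ c ∈ Icc 1 K, (((Xc g m1 n1 (c:ℤ)).card : ℝ) + ((Xc g m1 n1 (-(c:ℤ))).card : ℝ))
      ≤ 12 * Real.exp 3 * g * K * (rr (g*m1) * rr (g*n1)) *
        Real.exp (2 * ∑ p ∈ (m1*n1).primeFactors.filter (fun p => Nat.log 4 K < p), 1/(p:ℝ)) := by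
  rcases Nat.eq_zero_or_pos K with rfl | hK
  · simp
  have hM : m1*n1 ≠ 0 := (Nat.mul_pos hm hn).ne'
  have hA : 0 ≤ (g:ℝ) * (rr g * RR g (m1*n1)) :=
    mul_nonneg (by positivity) (mul_nonneg (rr_nonneg _) (RR_nonneg _ _))
  calc _ ≤ ∑ c ∈ Icc 1 K, (if Nat.Coprime c (m1*n1) then 2 * (g * (rr g * RR g (m1*n1))) * (1 / rr c) else 0) := by
        apply sum_le_sum
        intro c hc
        have hc0 : c ≠ 0 := by have := (mem_Icc.1 hc).1; omega
        have h1 := card_Xc_le g m1 n1 hg hm hn hcop (c:ℤ) (by exact_mod_cast hc0)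
        have h2 := card_Xc_le g m1 n1 hg hm hn hcop (-(c:ℤ)) (by simpa using hc0)
        simp only [Int.natAbs_neg, Int.natAbs_natCast] at h1 h2
        split_ifs at h1 h2 ⊢ with h
        · linarith
        · linarith
    _ = 2 * (g * (rr g * RR g (m1*n1))) * ∑ c ∈ (Icc 1 K).filter (fun c => Nat.Coprime c (m1*n1)), 1 / rr c := by
        rw [← sum_filter, mul_sum]
    _ ≤ 2 * (g * (rr g * RR g (m1*n1))) * (Real.exp 3*6*K*(rr (m1*n1) * Real.exp (2 * ∑ p ∈ (m1*n1).primeFactors.filter (fun p => Nat.log 4 K < p), 1/(p:ℝ)))) := by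
        apply mul_le_mul_of_nonneg_left _ (by linarith)
        refine (sieve K (m1*n1) hK hM).trans ?_
        exact mul_le_mul_of_nonneg_left (sieve_to_exp _ _ hM) (by positivity)
    _ = _ := by
        rw [rr_mul_rr g m1 n1 hg hm hn hcop]; ring

lemma card_Xc_zero (g m1 n1 : ℕ) (_hg : 0 < g) (hm : 0 < m1) (hn : 0 < n1) (hcop : Nat.Coprime m1 n1) :
    ((Xc g m1 n1 0).card : ℝ) ≤ if g*m1 = g*n1 then ((g*m1).totient : ℝ) else 0 := by
  by_cases h : m1*n1 = 1
  · have h1 : m1 = 1 := Nat.eq_one_of_mul_eq_one_right h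
    have h2 : n1 = 1 := Nat.eq_one_of_mul_eq_one_left h
    subst h1; subst h2
    simp only [if_true, Nat.cast_le, mul_one]
    have : Nat.totient g = ((range g).filter (fun a => Nat.Coprime a g)).card := by
      rw [Nat.totient]; congr 1; ext a; simp [Nat.coprime_comm]
    rw [this]
    apply card_le_card_of_injOn (fun x => x.1)
    · intro x hx
      simp only [Xc, mem_coe, mem_filter, mem_product, mem_range, mul_one] at hx ⊢
      exact ⟨hx.1.1, hx.2.1⟩
    · intro x hx y hy hxy
      simp only [Xc, mem_coe, mem_filter, mem_product, mem_range, mul_one] at hx hy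
      have key : ∀ z : ℕ × ℕ, z.1 < g → z.2 < g → (g:ℤ) ∣ (z.1:ℤ) * ((1:ℕ):ℤ) - z.2 * ((1:ℕ):ℤ) - 0 → z.1 = z.2 := by
        intro z h1 h2 h3
        have h3' : (g:ℤ) ∣ (z.1:ℤ) - z.2 := by simpa using h3
        have := Int.emod_emod_of_dvd
        have h4 := Int.eq_zero_of_abs_lt_dvd h3' (by rw [abs_lt]; constructor <;> omega)
        omega
      have a1 := key x hx.1.1 hx.1.2 hx.2.2.2
      have a2 := key y hy.1.1 hy.1.2 hy.2.2.2
      ext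
      · exact hxy
      · rw [← a1, ← a2]; exact hxy
  · have : Xc g m1 n1 0 = ∅ := by
      rw [eq_empty_iff_forall_notMem]
      intro x hx
      have := Xc_coprime g m1 n1 hcop 0 hx
      simp at this
      apply h; simp [this]
    rw [this]
    split_ifs <;> simp

/-- pairs counting -/
lemma pairs (m n : ℕ) (hm : 0 < m) (hn : 0 < n) (D : ℝ) (Y : Finset (ℕ × ℕ))
    (hY : ∀ x ∈ Y, x.1 < m ∧ x.2 < n ∧ Nat.Coprime x.1 m ∧ Nat.Coprime x.2 n ∧
      ∃ k : ℤ, |(x.1:ℝ)/m - x.2/n - k| * (m*n) ≤ D * Nat.gcd m n) :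
    (Y.card : ℝ) ≤ (if m = n then (m.totient : ℝ) else 0) +
      12 * Real.exp 3 * (Nat.gcd m n) * ⌊D⌋₊ * (rr m * rr n) *
        Real.exp (2 * Lf m n (Nat.log 4 ⌊D⌋₊)) := by
  set K := ⌊D⌋₊ with hKD
  set g := Nat.gcd m n with hgdef
  have hg : 0 < g := Nat.gcd_pos_of_pos_left n hm
  set m1 := m / g with hm1
  set n1 := n / g with hn1
  have em : m = g * m1 := (Nat.mul_div_cancel' (Nat.gcd_dvd_left m n)).symm
  have en : n = g * n1 := (Nat.mul_div_cancel' (Nat.gcd_dvd_right m n)).symm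
  have hm1p : 0 < m1 := Nat.pos_of_ne_zero (by rintro h; rw [h] at em; omega)
  have hn1p : 0 < n1 := Nat.pos_of_ne_zero (by rintro h; rw [h] at en; omega)
  have hcop : Nat.Coprime m1 n1 := Nat.coprime_div_gcd_div_gcd hg
  have hL : Lf m n (Nat.log 4 K) = ∑ p ∈ (m1*n1).primeFactors.filter (fun p => Nat.log 4 K < p), 1/(p:ℝ) := rfl
  have hsub : Y ⊆ Xc g m1 n1 0 ∪ (Icc 1 K).biUnion (fun c => Xc g m1 n1 (c:ℤ) ∪ Xc g m1 n1 (-(c:ℤ))) := by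
    intro x hx
    obtain ⟨h1, h2, h3, h4, k, hk⟩ := hY x hx
    have hgR : (0:ℝ) < g := by exact_mod_cast hg
    have hm1R : (0:ℝ) < m1 := by exact_mod_cast hm1p
    have hn1R : (0:ℝ) < n1 := by exact_mod_cast hn1p
    set c : ℤ := (x.1:ℤ)*n1 - x.2*m1 - k*(g*m1*n1) with hc
    have hcK : |c| ≤ (K:ℤ) := by
      have e : ((|c| : ℤ):ℝ) * g = |(x.1:ℝ)/m - x.2/n - k| * (m*n) := by
        rw [Int.cast_abs, ← abs_of_pos hgR, ← abs_mul, ← abs_of_pos (show (0:ℝ) < (m:ℝ)*n by positivity), ← abs_mul]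
        congr 1
        rw [hc]
        have em' : (m:ℝ) = g*m1 := by exact_mod_cast em
        have en' : (n:ℝ) = g*n1 := by exact_mod_cast en
        rw [em', en']
        push_cast
        field_simp
      rw [← e] at hk
      have h5 := le_of_mul_le_mul_right hk hgR
      have h6 : c.natAbs ≤ K := by
        apply Nat.le_floor
        rw [Int.abs_eq_natAbs, Int.cast_natCast] at h5
        exact h5
      rw [Int.abs_eq_natAbs]
      exact_mod_cast h6
    have hmem : x ∈ Xc g m1 n1 c := by
      simp only [Xc, mem_filter, mem_product, mem_range]
      refine ⟨⟨em ▸ h1, en ▸ h2⟩, em ▸ h3, en ▸ h4, ⟨k, ?_⟩⟩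
      rw [hc]; push_cast; ring
    rw [mem_union, mem_biUnion]
    rcases eq_or_ne c 0 with h0 | h0
    · left; rw [← h0]; exact hmem
    · right
      refine ⟨c.natAbs, mem_Icc.2 ⟨Int.natAbs_pos.2 h0, by rw [Int.abs_eq_natAbs] at hcK; exact_mod_cast hcK⟩, ?_⟩
      rw [mem_union]
      rcases Int.natAbs_eq c with h | h
      · left; rw [← h]; exact hmem
      · right; rw [← h]; exact hmem
  have hcard : Y.card ≤ (Xc g m1 n1 0).card + ∑ c ∈ Icc 1 K, ((Xc g m1 n1 (c:ℤ)).card + (Xc g m1 n1 (-(c:ℤ))).card) := by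
    refine (card_le_card hsub).trans ((card_union_le _ _).trans ?_)
    apply Nat.add_le_add_left
    refine card_biUnion_le.trans (sum_le_sum fun c _ => card_union_le _ _)
  have hcard' : (Y.card:ℝ) ≤ (Xc g m1 n1 0).card + ∑ c ∈ Icc 1 K, (((Xc g m1 n1 (c:ℤ)).card:ℝ) + (Xc g m1 n1 (-(c:ℤ))).card) := by
    exact_mod_cast hcard
  have hz := card_Xc_zero g m1 n1 hg hm1p hn1p hcop
  have hs := sum_Xc_le g m1 n1 K hg hm1p hn1p hcop
  rw [← em, ← en] at hz hs
  rw [hL]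
  linarith

end DS


namespace DS
open MeasureTheory

noncomputable section

lemma ball_le (x : UnitAddCircle) {d : ℝ} (hd : 0 ≤ d) : volume.real (Metric.ball x d) ≤ 2*d := by
  refine (measureReal_mono Metric.ball_subset_closedBall).trans ?_
  rw [Measure.real, AddCircle.volume_closedBall, ENNReal.toReal_ofReal (le_min zero_le_one (by linarith))]
  exact min_le_right _ _

lemma ball_ge (x : UnitAddCircle) {d : ℝ} (hd : 0 ≤ d) (hd1 : d ≤ 1) : d ≤ volume.real (Metric.ball x d) := by
  rcases hd.eq_or_lt with rfl | h
  · positivity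
  have : volume.real (Metric.closedBall x (d/2)) = d := by
    rw [Measure.real, AddCircle.volume_closedBall, ENNReal.toReal_ofReal (le_min zero_le_one (by linarith)),
      min_eq_right (by linarith)]
    ring
  conv_lhs => rw [← this]
  exact measureReal_mono (Metric.closedBall_subset_ball (by linarith))

def cop (n : ℕ) : Finset ℕ := (Finset.range n).filter (fun a => Nat.Coprime a n)

lemma card_cop (n : ℕ) : (cop n).card = n.totient := by
  rw [cop, Nat.totient]; congr 1; ext a; simp [Nat.coprime_comm]

def Bs (δ : ℕ → ℝ) (n a : ℕ) : Set UnitAddCircle := Metric.ball (((a:ℝ)/n : ℝ) : UnitAddCircle) (δ n)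

def ff (δ : ℕ → ℝ) (n : ℕ) (x : UnitAddCircle) : ℝ := ∑ a ∈ cop n, (Bs δ n a).indicator (fun _ => (1:ℝ)) x

lemma Bs_meas (δ : ℕ → ℝ) (n a : ℕ) : MeasurableSet (Bs δ n a) := measurableSet_ball

lemma ind_int {s : Set UnitAddCircle} (hs : MeasurableSet s) : Integrable (s.indicator (fun _ => (1:ℝ))) volume :=
  (integrable_const (1:ℝ)).indicator hs

lemma ff_int (δ : ℕ → ℝ) (n : ℕ) : Integrable (ff δ n) volume := by
  unfold ff
  exact integrable_finsetSum _ fun a _ => ind_int (Bs_meas δ n a)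

lemma ff_mul (δ : ℕ → ℝ) (m n : ℕ) (x : UnitAddCircle) : ff δ m x * ff δ n x =
    ∑ y ∈ cop m ×ˢ cop n, (Bs δ m y.1 ∩ Bs δ n y.2).indicator (fun _ => (1:ℝ)) x := by
  unfold ff
  rw [Finset.sum_mul_sum, Finset.sum_product]
  refine Finset.sum_congr rfl fun a _ => Finset.sum_congr rfl fun b _ => ?_
  by_cases h1 : x ∈ Bs δ m a <;> by_cases h2 : x ∈ Bs δ n b <;> simp [Set.indicator, h1, h2]

lemma ff_mul_int (δ : ℕ → ℝ) (m n : ℕ) : Integrable (fun x => ff δ m x * ff δ n x) volume := by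
  simp only [ff_mul]
  exact integrable_finsetSum _ fun y _ => ind_int ((Bs_meas δ m y.1).inter (Bs_meas δ n y.2))

lemma int_ff_ge (ψ : ℕ → ℝ) (n : ℕ) (h0 : 0 ≤ ψ n / n) (h1 : ψ n / n ≤ 1) :
    ψ n * rr n ≤ ∫ x, ff (fun n => ψ n / n) n x := by
  unfold ff
  rw [integral_finsetSum _ fun a _ => ind_int (Bs_meas _ n a)]
  have : ∀ a ∈ cop n, ψ n / n ≤ ∫ x, (Bs (fun n => ψ n / n) n a).indicator (fun _ => (1:ℝ)) x := by
    intro a _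
    rw [integral_indicator (Bs_meas _ n a)]
    simp only [integral_const, smul_eq_mul, mul_one, measureReal_restrict_apply_univ]
    exact ball_ge _ h0 h1
  have h := Finset.sum_le_sum this
  rw [Finset.sum_const, card_cop, nsmul_eq_mul] at h
  refine le_trans (le_of_eq ?_) h
  unfold rr; ring

lemma int_cross (ψ : ℕ → ℝ) (hψ : ∀ n, 0 ≤ ψ n) (m n : ℕ) (hm : 0 < m) (hn : 0 < n) :
    ∫ x, ff (fun n => ψ n / n) m x * ff (fun n => ψ n / n) n x ≤
      (if m = n then 2*(ψ m * rr m) else 0) +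
      48 * Real.exp 3 * (ψ m * rr m * (ψ n * rr n) * Real.exp (2 * Lf m n (zf ψ m n))) := by
  classical
  set δ : ℕ → ℝ := fun n => ψ n / n with hδ
  have hmR : (0:ℝ) < m := by exact_mod_cast hm
  have hnR : (0:ℝ) < n := by exact_mod_cast hn
  have hgp : 0 < Nat.gcd m n := Nat.gcd_pos_of_pos_left n hm
  have hgR : (0:ℝ) < (Nat.gcd m n : ℕ) := by exact_mod_cast hgp
  have dm : 0 ≤ δ m := div_nonneg (hψ m) hmR.le
  have dn : 0 ≤ δ n := div_nonneg (hψ n) hnR.le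
  have em : δ m * m = ψ m := by rw [hδ]; field_simp
  have en : δ n * n = ψ n := by rw [hδ]; field_simp
  set Y := (cop m ×ˢ cop n).filter (fun y => (Bs δ m y.1 ∩ Bs δ n y.2).Nonempty) with hY
  have eD : 2 * Df ψ m n * (Nat.gcd m n : ℕ) = 2 * (max (δ m) (δ n)) * (m*n) := by
    unfold Df
    rw [← em, ← en, max_mul_of_nonneg _ _ (by positivity) |> (mul_assoc 2 _ _).trans ∘ congrArg (2 * ·)]
    rw [mul_assoc, div_mul_cancel₀ _ hgR.ne', max_comm]
    congr 2 <;> ring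
  have hcount := pairs m n hm hn (2 * Df ψ m n) Y (by
    intro y hy
    simp only [hY, cop, Finset.mem_filter, Finset.mem_product, Finset.mem_range] at hy
    obtain ⟨⟨⟨h1, h2⟩, h3, h4⟩, x, hx1, hx2⟩ := hy
    refine ⟨h1, h3, h2, h4, round ((y.1:ℝ)/m - y.2/n), ?_⟩
    rw [eD]
    apply mul_le_mul_of_nonneg_right _ (by positivity)
    rw [← UnitAddCircle.norm_eq, AddCircle.coe_sub, ← dist_eq_norm]
    have t := dist_triangle_left (((y.1:ℝ)/m : ℝ) : UnitAddCircle) (((y.2:ℝ)/n : ℝ) : UnitAddCircle) x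
    have t1 : dist x _ < δ m := hx1
    have t2 : dist x _ < δ n := hx2
    have := le_max_left (δ m) (δ n)
    have := le_max_right (δ m) (δ n)
    linarith)
  have hK : ((⌊2 * Df ψ m n⌋₊ : ℕ) : ℝ) * (Nat.gcd m n : ℕ) ≤ 2 * (max (δ m) (δ n)) * (m*n) := by
    rw [← eD]
    apply mul_le_mul_of_nonneg_right _ hgR.le
    apply Nat.floor_le
    unfold Df
    have := hψ n
    positivity
  have hint : ∫ x, ff δ m x * ff δ n x ≤ Y.card * (2 * min (δ m) (δ n)) := by
    simp only [ff_mul]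
    rw [integral_finsetSum _ fun y _ => ind_int ((Bs_meas δ m y.1).inter (Bs_meas δ n y.2))]
    rw [← nsmul_eq_mul, ← Finset.sum_const, hY, Finset.sum_filter]
    apply Finset.sum_le_sum
    intro y _
    rw [integral_indicator ((Bs_meas δ m y.1).inter (Bs_meas δ n y.2))]
    simp only [integral_const, smul_eq_mul, mul_one, measureReal_restrict_apply_univ]
    split_ifs with h
    · rw [mul_min_of_nonneg _ _ zero_le_two]
      exact le_min ((measureReal_mono Set.inter_subset_left).trans (ball_le _ dm))
        ((measureReal_mono Set.inter_subset_right).trans (ball_le _ dn))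
    · rw [Set.not_nonempty_iff_eq_empty.1 h]; simp
  refine hint.trans ?_
  have hmin : 0 ≤ 2 * min (δ m) (δ n) := by positivity
  refine (mul_le_mul_of_nonneg_right hcount hmin).trans ?_
  rw [add_mul]
  apply add_le_add
  · split_ifs with h
    · subst h
      rw [min_self, rr, ← em]
      apply le_of_eq
      field_simp
    · simp
  · have hE : 0 ≤ rr m * rr n * Real.exp (2 * Lf m n (zf ψ m n)) :=
      mul_nonneg (mul_nonneg (rr_nonneg _) (rr_nonneg _)) (Real.exp_pos _).le
    have hmm : max (δ m) (δ n) * min (δ m) (δ n) = δ m * δ n := max_mul_min _ _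
    change 12 * Real.exp 3 * (Nat.gcd m n : ℕ) * (⌊2 * Df ψ m n⌋₊ : ℕ) * (rr m * rr n) * Real.exp (2 * Lf m n (zf ψ m n)) * (2 * min (δ m) (δ n)) ≤ _
    calc _ = 24 * Real.exp 3 * (rr m * rr n * Real.exp (2 * Lf m n (zf ψ m n))) * (min (δ m) (δ n)) * (((⌊2 * Df ψ m n⌋₊ : ℕ) : ℝ) * (Nat.gcd m n : ℕ)) := by ring
      _ ≤ 24 * Real.exp 3 * (rr m * rr n * Real.exp (2 * Lf m n (zf ψ m n))) * (min (δ m) (δ n)) * (2 * (max (δ m) (δ n)) * (m*n)) := by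
        apply mul_le_mul_of_nonneg_left hK
        have : 0 ≤ min (δ m) (δ n) := le_min dm dn
        positivity
      _ = 48 * Real.exp 3 * (rr m * rr n * Real.exp (2 * Lf m n (zf ψ m n))) * (max (δ m) (δ n) * min (δ m) (δ n)) * (m*n) := by ring
      _ = _ := by rw [hmm, ← em, ← en]; ring

/-- second moment bound -/
lemma union_ge : ∃ c : ℝ, 0 < c ∧ ∀ ψ : ℕ → ℝ, (∀ n, 0 ≤ ψ n) → (∀ n, ψ n / n ≤ 1) →
    ∀ S : Finset ℕ, (∀ n ∈ S, 0 < n) → 1 ≤ ∑ n ∈ S, ψ n * rr n → ∑ n ∈ S, ψ n * rr n ≤ 2 →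
    c ≤ volume.real (⋃ n ∈ S, ⋃ a ∈ cop n, Bs (fun n => ψ n / n) n a) := by
  obtain ⟨C, hC, han⟩ := anatomy
  set Q : ℝ := 4 + 48 * Real.exp 3 * C with hQ
  have hQ0 : 0 < Q := by positivity
  refine ⟨1/Q, by positivity, ?_⟩
  intro ψ hψ h1 S hS hS1 hS2
  have han := han ψ hψ S (fun n hn => (hS n hn).ne') hS2
  set δ : ℕ → ℝ := fun n => ψ n / n with hδ
  set A := ⋃ n ∈ S, ⋃ a ∈ cop n, Bs δ n a with hA
  have hAm : MeasurableSet A :=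
    Finset.measurableSet_biUnion _ fun n _ => Finset.measurableSet_biUnion _ fun a _ => Bs_meas δ n a
  set F : UnitAddCircle → ℝ := fun x => ∑ n ∈ S, ff δ n x with hF
  have hFi : Integrable F volume := integrable_finsetSum _ fun n _ => ff_int δ n
  have eFF : (fun x => F x * F x) = fun x => ∑ m ∈ S, ∑ n ∈ S, ff δ m x * ff δ n x := by
    ext x; rw [hF]; simp only [Finset.sum_mul_sum]
  have hFFi : Integrable (fun x => F x * F x) volume := by
    rw [eFF]
    exact integrable_finsetSum _ fun m _ => integrable_finsetSum _ fun n _ => ff_mul_int δ m n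
  have hI1 : 1 ≤ ∫ x, F x := by
    refine hS1.trans ?_
    rw [hF, integral_finsetSum _ fun n _ => ff_int δ n]
    exact Finset.sum_le_sum fun n _ => int_ff_ge ψ n (div_nonneg (hψ n) (Nat.cast_nonneg n)) (h1 n)
  have hI2 : ∫ x, F x * F x ≤ Q := by
    rw [eFF, integral_finsetSum _ fun m _ => integrable_finsetSum _ fun n _ => ff_mul_int δ m n]
    calc _ = ∑ m ∈ S, ∑ n ∈ S, ∫ x, ff δ m x * ff δ n x :=
          Finset.sum_congr rfl fun m _ => integral_finsetSum _ fun n _ => ff_mul_int δ m n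
      _ ≤ ∑ m ∈ S, ∑ n ∈ S, ((if m = n then 2*(ψ m * rr m) else 0) +
      48 * Real.exp 3 * (ψ m * rr m * (ψ n * rr n) * Real.exp (2 * Lf m n (zf ψ m n)))) :=
          Finset.sum_le_sum fun m hm => Finset.sum_le_sum fun n hn => int_cross ψ hψ m n (hS m hm) (hS n hn)
      _ = 2 * ∑ m ∈ S, ψ m * rr m + 48 * Real.exp 3 * ∑ m ∈ S, ∑ n ∈ S, (ψ m * rr m * (ψ n * rr n) * Real.exp (2 * Lf m n (zf ψ m n))) := by
          simp only [Finset.sum_add_distrib, Finset.mul_sum]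
          congr 1
          apply Finset.sum_congr rfl
          intro m hm
          rw [Finset.sum_ite_eq, if_pos hm]
      _ ≤ _ := by
          have : 0 < 48 * Real.exp 3 := by positivity
          have := mul_le_mul_of_nonneg_left han this.le
          linarith
  have hpt : ∀ x, 2 * Q * F x - F x * F x ≤ Q^2 * A.indicator (fun _ => (1:ℝ)) x := by
    intro x
    by_cases hx : x ∈ A
    · rw [Set.indicator_of_mem hx]; nlinarith [sq_nonneg (F x - Q)]
    · have : F x = 0 := by
        rw [hF]
        apply Finset.sum_eq_zero
        intro n hn
        apply Finset.sum_eq_zero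
        intro a ha
        apply Set.indicator_of_notMem
        intro h
        exact hx (Set.mem_biUnion hn (Set.mem_biUnion ha h))
      rw [this, Set.indicator_of_notMem hx]; simp
  have hfin := integral_mono ((hFi.const_mul (2*Q)).sub hFFi) ((ind_int hAm).const_mul (Q^2)) hpt
  rw [integral_const_mul, integral_indicator hAm] at hfin
  simp only [integral_const, smul_eq_mul, mul_one, measureReal_restrict_apply_univ] at hfin
  have e : ∫ x, ((fun x => 2 * Q * F x) - fun x => F x * F x) x = 2*Q * (∫ x, F x) - ∫ x, F x * F x := by
    simp only [Pi.sub_apply]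
    rw [integral_sub (hFi.const_mul _) hFFi, integral_const_mul]
  rw [e] at hfin
  rw [div_le_iff₀ hQ0]
  have h3 : 2*Q*1 ≤ 2*Q*(∫ x, F x) := mul_le_mul_of_nonneg_left hI1 (by linarith)
  have h4 : Q * 1 ≤ Q * (volume.real A * Q) := by nlinarith
  exact le_of_mul_le_mul_left h4 hQ0

end
end DS


namespace DS
open MeasureTheory Filter Topology

lemma prod_lower (s : Finset ℕ) (hs : ∀ p ∈ s, 2 ≤ p) : 1/((s.card:ℝ)+1) ≤ ∏ p ∈ s, (1-1/(p:ℝ)) := by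
  induction s using Finset.induction_on_max with
  | empty => simp
  | insert p s hp ih =>
    have hn : p ∉ s := fun h => lt_irrefl _ (hp p h)
    rw [Finset.prod_insert hn, Finset.card_insert_of_notMem hn]
    have ih := ih (fun q hq => hs q (Finset.mem_insert_of_mem hq))
    have hp2 := hs p (Finset.mem_insert_self _ _)
    have hc : s.card ≤ p - 2 := by
      have : s ⊆ Finset.Ico 2 p := fun q hq => Finset.mem_Ico.2 ⟨hs q (Finset.mem_insert_of_mem hq), hp q hq⟩
      simpa using Finset.card_le_card this
    have hc' : (s.card:ℝ) + 2 ≤ p := by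
      have : s.card + 2 ≤ p := by omega
      exact_mod_cast this
    have h1 : 1/(p:ℝ) ≤ 1/((s.card:ℝ)+2) := one_div_le_one_div_of_le (by positivity) hc'
    have h2 : ((s.card:ℝ)+1)/((s.card:ℝ)+2) ≤ 1 - 1/(p:ℝ) := by
      have : ((s.card:ℝ)+1)/((s.card:ℝ)+2) = 1 - 1/((s.card:ℝ)+2) := by field_simp; ring
      linarith
    calc _ = ((s.card:ℝ)+1)/((s.card:ℝ)+2) * (1/((s.card:ℝ)+1)) := by push_cast; field_simp; ring
      _ ≤ _ := mul_le_mul h2 ih (by positivity) (le_trans (by positivity) h2)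

lemma sq_le_two_pow (k : ℕ) : (k+1)^2 ≤ 4 * 2^k := by
  induction k with
  | zero => norm_num
  | succ k ih =>
    rcases Nat.lt_or_ge k 2 with h | h
    · interval_cases k <;> norm_num
    · rw [pow_succ 2]; nlinarith

lemma totient_large (n : ℕ) (hn : n ≠ 0) : Real.sqrt n ≤ 2 * (n.totient : ℝ) := by
  have hnR : (0:ℝ) < n := by exact_mod_cast Nat.pos_of_ne_zero hn
  set k := n.primeFactors.card with hk
  have h1 : 2^k ≤ n := by
    refine le_trans ?_ (Nat.le_of_dvd (Nat.pos_of_ne_zero hn) (Nat.prod_primeFactors_dvd n))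
    apply Finset.pow_card_le_prod
    intro p hp
    exact (Nat.prime_of_mem_primeFactors hp).two_le
  have h2 : ((k:ℝ)+1)^2 ≤ 4 * n := by
    have := (sq_le_two_pow k).trans (Nat.mul_le_mul_left 4 h1)
    exact_mod_cast this
  have h3 : (k:ℝ)+1 ≤ 2 * Real.sqrt n := by
    apply le_of_sq_le_sq _ (by positivity)
    rw [mul_pow, Real.sq_sqrt hnR.le]; linarith
  have h4 := prod_lower n.primeFactors (fun p hp => (Nat.prime_of_mem_primeFactors hp).two_le)
  rw [← rr_prod hn, rr, div_le_div_iff₀ (by positivity) hnR] at h4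
  have h5 : (n.totient:ℝ) * ((k:ℝ)+1) ≤ n.totient * (2 * Real.sqrt n) := mul_le_mul_of_nonneg_left h3 (by positivity)
  have h6 : Real.sqrt n * Real.sqrt n ≤ (2 * (n.totient : ℝ)) * Real.sqrt n := by
    rw [Real.mul_self_sqrt hnR.le]; linarith
  exact le_of_mul_le_mul_right h6 (Real.sqrt_pos.2 hnR)

/-- capped function -/
noncomputable def cap (ψ : ℕ → ℝ) (n : ℕ) : ℝ := min (ψ n) (n / (n.totient : ℝ))

lemma cap_nonneg {ψ : ℕ → ℝ} (hψ : ∀ n, 0 ≤ ψ n) (n : ℕ) : 0 ≤ cap ψ n := le_min (hψ n) (by positivity)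

lemma cap_div_le (ψ : ℕ → ℝ) (n : ℕ) : cap ψ n / n ≤ 1 / (n.totient : ℝ) := by
  rcases Nat.eq_zero_or_pos n with rfl | hn
  · simp
  have hnR : (0:ℝ) < n := by exact_mod_cast hn
  rw [div_le_iff₀ hnR]
  refine (min_le_right _ _).trans (le_of_eq ?_)
  ring

lemma cap_div_le_one (ψ : ℕ → ℝ) (n : ℕ) : cap ψ n / n ≤ 1 := by
  refine (cap_div_le ψ n).trans ?_
  rcases Nat.eq_zero_or_pos n with rfl | hn
  · simp
  have : (1:ℝ) ≤ n.totient := by exact_mod_cast Nat.totient_pos.2 hn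
  rw [div_le_one (by linarith)]; exact this

lemma cap_tendsto {ψ : ℕ → ℝ} (hψ : ∀ n, 0 ≤ ψ n) : Tendsto (fun n => cap ψ n / n) atTop (𝓝 0) := by
  have h : Tendsto (fun n : ℕ => 2 / Real.sqrt n) atTop (𝓝 0) :=
    Tendsto.const_div_atTop (Real.tendsto_sqrt_atTop.comp tendsto_natCast_atTop_atTop) 2
  apply squeeze_zero' _ _ h
  · exact Eventually.of_forall fun n => div_nonneg (cap_nonneg hψ n) (Nat.cast_nonneg n)
  · filter_upwards [eventually_gt_atTop 0] with n hn
    refine (cap_div_le ψ n).trans ?_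
    have h1 := totient_large n hn.ne'
    have h2 : (0:ℝ) < n.totient := by exact_mod_cast Nat.totient_pos.2 hn
    rw [div_le_div_iff₀ h2 (Real.sqrt_pos.2 (by exact_mod_cast hn))]
    linarith

lemma cap_mul (ψ : ℕ → ℝ) (n : ℕ) : cap ψ n * rr n = min (ψ n * rr n) (if n = 0 then 0 else 1) := by
  rcases Nat.eq_zero_or_pos n with rfl | hn
  · simp [rr]
  have hnR : (0:ℝ) < n := by exact_mod_cast hn
  have h2 : (0:ℝ) < n.totient := by exact_mod_cast Nat.totient_pos.2 hn
  rw [cap, min_mul_of_nonneg _ _ (rr_nonneg n), if_neg hn.ne']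
  congr 1
  unfold rr; field_simp

lemma cap_mul_le (ψ : ℕ → ℝ) (n : ℕ) : cap ψ n * rr n ≤ 1 := by
  rw [cap_mul]; refine (min_le_right _ _).trans ?_
  split_ifs <;> simp

lemma cap_not_summable {ψ : ℕ → ℝ} (h : ¬ Summable (fun n => ψ n * rr n)) :
    ¬ Summable (fun n => cap ψ n * rr n) := by
  intro hs
  apply h
  have h1 : ∀ᶠ n in atTop, cap ψ n * rr n < 1 := hs.tendsto_atTop_zero.eventually (gt_mem_nhds one_pos)
  apply (summable_congr_atTop ?_).1 hs
  filter_upwards [h1, eventually_gt_atTop 0] with n h1 hn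
  rw [cap_mul, if_neg hn.ne'] at h1 ⊢
  rcases min_choice (ψ n * rr n) 1 with h | h
  · exact h
  · linarith

lemma exists_block {u : ℕ → ℝ} (h0 : ∀ n, 0 ≤ u n) (h1 : ∀ n, u n ≤ 1) (hs : ¬ Summable u) (N : ℕ) :
    ∃ S : Finset ℕ, (∀ n ∈ S, N ≤ n) ∧ 1 ≤ ∑ n ∈ S, u n ∧ ∑ n ∈ S, u n ≤ 2 := by
  have hs2 : ¬ Summable (fun n => u (n+N)) := by rwa [summable_nat_add_iff]
  have ht := (not_summable_iff_tendsto_nat_atTop_of_nonneg (fun n => h0 (n+N))).1 hs2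
  have hex : ∃ k, 1 ≤ ∑ i ∈ Finset.range k, u (i+N) := (ht.eventually_ge_atTop 1).exists
  classical
  set k := Nat.find hex with hk
  have hk1 := Nat.find_spec hex
  refine ⟨(Finset.range k).image (· + N), ?_, ?_, ?_⟩
  · intro n hn
    simp only [Finset.mem_image] at hn
    obtain ⟨i, _, rfl⟩ := hn
    omega
  · rw [Finset.sum_image (fun a _ b _ h => by simpa using h)]; exact hk1
  · rw [Finset.sum_image (fun a _ b _ h => by simpa using h)]
    rcases Nat.eq_zero_or_pos k with h | h
    · rw [h]; simp
    · obtain ⟨j, hj⟩ := Nat.exists_eq_succ_of_ne_zero h.ne'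
      have := Nat.find_min hex (m := j) (by omega)
      rw [hj, Finset.sum_range_succ]
      have := h1 (j+N)
      linarith

lemma circle_ae {ψ : ℕ → ℝ} (hψ : ∀ n, 0 ≤ ψ n) (h : ¬ Summable (fun n => ψ n * rr n)) :
    ∀ᵐ x : UnitAddCircle, x ∈ addWellApproximable UnitAddCircle (fun n => cap ψ n / n) := by
  set δ : ℕ → ℝ := fun n => cap ψ n / n with hδ
  rcases AddCircle.addWellApproximable_ae_empty_or_univ (T := 1) δ (cap_tendsto hψ) with he | hu
  · exfalso
    obtain ⟨c, hc, hun⟩ := union_ge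
    set E : ℕ → Set UnitAddCircle := fun N => ⋃ n ∈ {n : ℕ | N < n}, ⋃ a ∈ cop n, Bs δ n a with hE
    have hEm : ∀ N, MeasurableSet (E N) := fun N =>
      MeasurableSet.biUnion (Set.to_countable _) fun n _ =>
        Finset.measurableSet_biUnion _ fun a _ => Bs_meas δ n a
    have hanti : Antitone E := fun M N hMN =>
      Set.biUnion_subset_biUnion_left fun n (hn : N < n) => lt_of_le_of_lt hMN hn
    have hEc : ∀ N, ENNReal.ofReal c ≤ volume (E N) := by
      intro N
      obtain ⟨S, hS, hS1, hS2⟩ := exists_block (u := fun n => cap ψ n * rr n)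
        (fun n => mul_nonneg (cap_nonneg hψ n) (rr_nonneg n)) (cap_mul_le ψ) (cap_not_summable h) (N+1)
      have h3 := hun (cap ψ) (cap_nonneg hψ) (cap_div_le_one ψ) S (fun n hn => by have := hS n hn; omega) hS1 hS2
      rw [ENNReal.ofReal_le_iff_le_toReal (measure_ne_top _ _)]
      refine h3.trans (measureReal_mono ?_ (measure_ne_top _ _))
      exact Set.biUnion_subset_biUnion_left fun n hn => hS n hn
    have hlim := tendsto_measure_iInter_atTop (μ := (volume : Measure UnitAddCircle)) (fun N => (hEm N).nullMeasurableSet) hanti ⟨0, measure_ne_top _ _⟩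
    have hge : ENNReal.ofReal c ≤ volume (⋂ N, E N) := ge_of_tendsto' hlim hEc
    have hsub : (⋂ N, E N) ⊆ addWellApproximable UnitAddCircle δ := by
      intro x hx
      rw [UnitAddCircle.mem_addWellApproximable_iff, ← Nat.frequently_atTop_iff_infinite, frequently_atTop]
      intro N
      have := Set.mem_iInter.1 hx N
      simp only [hE, Set.mem_iUnion] at this
      obtain ⟨n, hn, a, ha, hxa⟩ := this
      simp only [cop, Finset.mem_filter, Finset.mem_range] at ha
      refine ⟨n, le_of_lt hn, a, ha.1, ha.2, ?_⟩
      rw [← dist_eq_norm]; exact hxa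
    have hz : volume (addWellApproximable UnitAddCircle δ) = 0 := by
      simpa [ae_iff] using he
    have := hge.trans (measure_mono hsub)
    rw [hz] at this
    simp at this
    linarith
  · exact hu

end DS

open MeasureTheory

theorem duffin_schaeffer (ψ : ℕ → ℝ) (hψ : ∀ n, 0 ≤ ψ n)
    (hdiv : ¬ Summable (fun n : ℕ => ψ n * (Nat.totient n : ℝ) / n)) :
    ∀ᵐ α ∂(volume.restrict (Set.Icc (0:ℝ) 1)),
      {p : ℤ × ℕ | 0 < p.2 ∧ Int.gcd p.1 (p.2 : ℤ) = 1 ∧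
        |α - (p.1 : ℝ) / (p.2 : ℝ)| ≤ ψ p.2 / p.2}.Infinite := by
  have hdiv' : ¬ Summable (fun n => ψ n * DS.rr n) := by
    refine fun h => hdiv (h.congr fun n => ?_)
    unfold DS.rr; ring
  have hae := DS.circle_ae hψ hdiv'
  have hmp := UnitAddCircle.measurePreserving_mk 0
  have h2 := hmp.quasiMeasurePreserving.ae hae
  rw [zero_add] at h2
  rw [← Measure.restrict_congr_set (Ioc_ae_eq_Icc (a := (0:ℝ)) (b := 1))]
  filter_upwards [h2] with α hα
  rw [UnitAddCircle.mem_addWellApproximable_iff] at hα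
  intro hfin
  apply hα
  refine (hfin.image Prod.snd).subset ?_
  rintro n ⟨m, hmn, hgcd, hlt⟩
  have hn : 0 < n := by omega
  have hnR : (0:ℝ) < n := by exact_mod_cast hn
  rw [← AddCircle.coe_sub, UnitAddCircle.norm_eq] at hlt
  set k := round (α - (m:ℝ)/n) with hk
  refine ⟨((m:ℤ) + k*n, n), ⟨hn, ?_, ?_⟩, rfl⟩
  · simp only [Int.gcd_add_mul_right_left]
    exact_mod_cast hgcd
  · simp only
    have e : α - (((m:ℤ) + k*n : ℤ) : ℝ)/n = α - (m:ℝ)/n - k := by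
      push_cast; field_simp; ring
    rw [e]
    refine hlt.le.trans ?_
    exact div_le_div_of_nonneg_right (min_le_left _ _) hnR.le
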